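/- arXiv:2012.07670 — 5 statements merged into one kernel-verified Lean document; each statement's English description precedes it below -/
import Mathlib

section
/- Let n ≥ 2, 1 ≤ k ≤ n, and let A, B be real symmetric n×n matrices with λ(A) ∈ Γ_k and λ(B) ∈ Γ_k. Then (1/k)·(d/dt)|_{t=0} S_k(A + tB) ≥ S_k(A)^{(k−1)/k} · S_k(B)^{1/k}. (Equivalently, writing S_k^{ij}(A) for the partial derivative of S_k with respect to the (i,j)-entry, (1/k)·Σ_{i,j} S_k^{ij}(A) B_{ij} ≥ S_k(A)^{(k−1)/k} S_k(B)^{1/k}.) -/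
/-- The `j`-th elementary symmetric polynomial of `lam ∈ ℝⁿ`. -/
noncomputable def sigmaE {n : ℕ} (j : ℕ) (lam : Fin n → ℝ) : ℝ :=
  ∑ s ∈ Finset.powersetCard j Finset.univ, ∏ i ∈ s, lam i

/-- The Gårding cone `Γ_k = {λ ∈ ℝⁿ : σ_j(λ) > 0 for j = 1,…,k}`. -/
def GardingCone (n k : ℕ) : Set (Fin n → ℝ) :=
  {lam | ∀ j, 1 ≤ j → j ≤ k → 0 < sigmaE j lam}

open scoped Classical in
/-- `S_k(A) = σ_k(λ(A))` for a Hermitian (= real symmetric) matrix `A`. -/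
noncomputable def SkM {n : ℕ} (k : ℕ) (A : Matrix (Fin n) (Fin n) ℝ) : ℝ :=
  if hA : A.IsHermitian then sigmaE k hA.eigenvalues else 0

/-- The dual Gårding cone `Γ_k^*`. -/
def GardingDual (n k : ℕ) : Set (Fin n → ℝ) :=
  {lam | ∀ mu ∈ GardingCone n k, 0 ≤ ∑ i, lam i * mu i}

/-- `ρ_k^*(λ) = inf{(λ·μ)/n : μ ∈ Γ_k, σ_k(μ) ≥ C(n,k)}`. -/
noncomputable def rhoStar (n k : ℕ) (lam : Fin n → ℝ) : ℝ :=
  sInf {r : ℝ | ∃ mu : Fin n → ℝ, mu ∈ GardingCone n k ∧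
    (n.choose k : ℝ) ≤ sigmaE k mu ∧ r = (∑ i, lam i * mu i) / n}


namespace GKH
open Polynomial Matrix

/-- Sum of the principal `k × k` minors. -/
noncomputable def eM {R : Type*} [CommRing R] {n : ℕ} (k : ℕ) (M : Matrix (Fin n) (Fin n) R) : R :=
  ∑ s ∈ (Finset.univ : Finset (Fin n)).powersetCard k,
    (M.submatrix (Subtype.val : s → Fin n) (Subtype.val : s → Fin n)).det

variable {R : Type*} [CommRing R] {n : ℕ}

lemma eM_smul (k : ℕ) (c : R) (M : Matrix (Fin n) (Fin n) R) :
    eM k (c • M) = c ^ k * eM k M := by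
  unfold eM
  rw [Finset.mul_sum]
  refine Finset.sum_congr rfl fun s hs => ?_
  have : (c • M).submatrix (Subtype.val : s → Fin n) (Subtype.val : s → Fin n)
      = c • M.submatrix Subtype.val Subtype.val := rfl
  rw [this, det_smul, Fintype.card_coe, (Finset.mem_powersetCard.mp hs).2]

lemma eM_map {S : Type*} [CommRing S] (k : ℕ) (f : R →+* S) (M : Matrix (Fin n) (Fin n) R) :
    eM k (M.map f) = f (eM k M) := by
  unfold eM
  rw [map_sum]
  refine Finset.sum_congr rfl fun s hs => ?_
  rw [RingHom.map_det]; rfl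

lemma eM_one (k : ℕ) : eM k (1 : Matrix (Fin n) (Fin n) R) = (n.choose k : R) := by
  unfold eM
  rw [Finset.sum_congr rfl (g := fun _ => (1 : R))]
  · simp
  · intro s hs
    rw [submatrix_one _ Subtype.val_injective, det_one]

lemma eM_continuous [TopologicalSpace R] [IsTopologicalRing R] {S : Type*} [TopologicalSpace S]
    (k : ℕ) {M : S → Matrix (Fin n) (Fin n) R} (hM : Continuous M) :
    Continuous fun s => eM k (M s) := by
  unfold eM
  refine continuous_finsetSum _ fun s _ => ?_
  exact (hM.matrix_submatrix _ _).matrix_det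

/-- The pencil polynomial `t ↦ eM k (t B + C)`. -/
noncomputable def pen (k : ℕ) (B D : Matrix (Fin n) (Fin n) R) : R[X] :=
  eM k ((X : R[X]) • B.map C + D.map C)

lemma pen_eval (k : ℕ) (B D : Matrix (Fin n) (Fin n) R) (t : R) :
    (pen k B D).eval t = eM k (t • B + D) := by
  unfold pen
  rw [← coe_evalRingHom, ← eM_map]
  congr 1
  ext i j
  simp only [Matrix.add_apply, Matrix.smul_apply, Matrix.map_apply, smul_eq_mul, coe_evalRingHom, eval_add, eval_mul,
    eval_X, eval_C]

lemma pen_map {S : Type*} [CommRing S] (f : R →+* S) (k : ℕ) (B D : Matrix (Fin n) (Fin n) R) :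
    (pen k B D).map f = pen k (B.map f) (D.map f) := by
  unfold pen
  rw [← coe_mapRingHom, ← eM_map]
  congr 1
  ext i j
  simp

lemma pen_natDegree_le (k : ℕ) (B D : Matrix (Fin n) (Fin n) R) : (pen k B D).natDegree ≤ k := by
  unfold pen eM
  refine natDegree_sum_le_of_forall_le _ _ fun s hs => ?_
  have h := natDegree_det_X_add_C_le (B.submatrix (Subtype.val : s → Fin n) Subtype.val)
    (D.submatrix (Subtype.val : s → Fin n) Subtype.val)
  rw [Fintype.card_coe, (Finset.mem_powersetCard.mp hs).2] at h
  exact h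

lemma pen_coeff (k : ℕ) (B D : Matrix (Fin n) (Fin n) R) : (pen k B D).coeff k = eM k B := by
  unfold pen eM
  rw [finsetSum_coeff]
  refine Finset.sum_congr rfl fun s hs => ?_
  have h := coeff_det_X_add_C_card (B.submatrix (Subtype.val : s → Fin n) Subtype.val)
    (D.submatrix (Subtype.val : s → Fin n) Subtype.val)
  rw [Fintype.card_coe, (Finset.mem_powersetCard.mp hs).2] at h
  exact h

lemma pen_natDegree (k : ℕ) (B D : Matrix (Fin n) (Fin n) R) (h : eM k B ≠ 0) :
    (pen k B D).natDegree = k :=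
  le_antisymm (pen_natDegree_le k B D) (le_natDegree_of_ne_zero (by rwa [pen_coeff]))

lemma pen_leadingCoeff (k : ℕ) (B D : Matrix (Fin n) (Fin n) R) (h : eM k B ≠ 0) :
    (pen k B D).leadingCoeff = eM k B := by
  rw [leadingCoeff, pen_natDegree k B D h, pen_coeff]

/-- relation with elementary symmetric functions of eigenvalues -/
lemma eM_eq_sigmaE {k : ℕ} (hk : k ≤ n) {A : Matrix (Fin n) (Fin n) ℝ} (hA : A.IsHermitian) :
    eM k A = sigmaE k hA.eigenvalues := by
  have h1 := charpoly_coeff_eq_sum_minors A k (by simpa using hk)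
  have h2 : A.charpoly.coeff (Fintype.card (Fin n) - k) = (-1) ^ k * sigmaE k hA.eigenvalues := by
    rw [hA.charpoly_eq]
    have : (∏ i, (X - C ((hA.eigenvalues i : ℝ)))) =
        ∏ i ∈ (Finset.univ : Finset (Fin n)), (X + C (-(hA.eigenvalues i))) := by
      simp [sub_eq_add_neg]
    simp only [RCLike.ofReal_real_eq_id, id]
    rw [this, Finset.prod_X_add_C_coeff _ _ (by simp)]
    have hc : (Finset.univ : Finset (Fin n)).card - (Fintype.card (Fin n) - k) = k := by
      simp; omega
    rw [hc]
    unfold sigmaE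
    rw [Finset.mul_sum]
    refine Finset.sum_congr rfl fun s hs => ?_
    rw [Finset.prod_neg, (Finset.mem_powersetCard.mp hs).2]
  rw [h2] at h1
  exact (mul_left_cancel₀ (pow_ne_zero k (by norm_num)) h1).symm

lemma eM_shift {k : ℕ} (hk : k ≤ n) (z : R) (M : Matrix (Fin n) (Fin n) R) :
    (-1) ^ k * eM k (z • (1 : Matrix (Fin n) (Fin n) R) + M)
      = (hasseDeriv (n - k) M.charpoly).eval (-z) := by
  have h1 := charpoly_coeff_eq_sum_minors (z • 1 + M) k (by simpa using hk)
  have h2 : (z • 1 + M) = M - scalar (Fin n) (-z) := by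
    ext i j
    by_cases h : i = j
    · subst h; simp; ring
    · simp [h]
  unfold eM
  rw [← h1, h2, charpoly_sub_scalar, ← taylor_coeff, taylor_apply]
  simp

lemma eM_shift_sum {k : ℕ} (hk : k ≤ n) (z : R) (M : Matrix (Fin n) (Fin n) R) :
    eM k (z • (1 : Matrix (Fin n) (Fin n) R) + M)
      = ∑ j ∈ Finset.range (k + 1), ((j + (n - k)).choose (n - k) : R) * eM (k - j) M * z ^ j := by
  have h := eM_shift hk z M
  have h3 : (hasseDeriv (n - k) M.charpoly).natDegree < k + 1 := by
    nontriviality R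
    have := natDegree_hasseDeriv_le M.charpoly (n - k)
    rw [charpoly_natDegree_eq_dim, Fintype.card_fin] at this
    omega
  rw [eval_eq_sum_range' h3] at h
  have h4 : eM k (z • (1 : Matrix (Fin n) (Fin n) R) + M) =
      (-1) ^ k * ((-1) ^ k * eM k (z • (1 : Matrix (Fin n) (Fin n) R) + M)) := by
    rw [← mul_assoc, ← mul_pow]; simp
  rw [h4, h, Finset.mul_sum]
  refine Finset.sum_congr rfl fun j hj => ?_
  have hj' : j ≤ k := by simpa [Nat.lt_succ_iff] using hj
  rw [hasseDeriv_coeff]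
  have h1 := charpoly_coeff_eq_sum_minors M (k - j) (by simp; omega)
  rw [show Fintype.card (Fin n) - (k - j) = j + (n - k) by simp; omega] at h1
  rw [h1]
  change _ * (_ * ((-1) ^ (k - j) * eM (k - j) M) * _) = _
  have h5 : (-1 : R) ^ k * (-1) ^ (k - j) * (-1) ^ j = 1 := by
    rw [mul_assoc, ← pow_add, Nat.sub_add_cancel hj', ← mul_pow]; simp
  rw [neg_pow z j]
  linear_combination (((j + (n - k)).choose (n - k) : R) * eM (k - j) M * z ^ j) * h5

end GKH

namespace GKH
open Polynomial Matrix

lemma deriv_real_roots {q : ℂ[X]} (hd : 0 < q.natDegree) (hq : ∀ z, q.eval z = 0 → z.im = 0) :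
    ∀ z, q.derivative.eval z = 0 → z.im = 0 := by
  intro z hz
  have h0 : q.derivative ≠ 0 := fun h => by
    have := derivative_eq_zero.mp h
    omega
  have h1 := rootSet_derivative_subset_convexHull_rootSet (P := q)
    (natDegree_pos_iff_degree_pos.mp hd)
  have h2 : z ∈ q.derivative.rootSet ℂ := by
    rw [mem_rootSet]; exact ⟨h0, by simpa using hz⟩
  have h3 : Convex ℝ {w : ℂ | w.im = 0} :=
    (convex_hyperplane (𝕜 := ℝ) (f := Complex.im) Complex.imLm.isLinear (0 : ℝ))
  have h4 : convexHull ℝ (q.rootSet ℂ) ⊆ {w : ℂ | w.im = 0} := by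
    refine convexHull_min ?_ h3
    intro w hw
    rw [mem_rootSet] at hw
    exact hq w (by simpa using hw.2)
  exact h4 (h1 h2)

lemma iterate_deriv_real_roots (m : ℕ) : ∀ {q : ℂ[X]}, m < q.natDegree →
    (∀ z, q.eval z = 0 → z.im = 0) → ∀ z, (derivative^[m] q).eval z = 0 → z.im = 0 := by
  induction m with
  | zero => intro q _ hq; simpa using hq
  | succ m ih =>
    intro q hm hq
    rw [Function.iterate_succ_apply]
    refine ih ?_ (deriv_real_roots (by omega) hq)
    rw [natDegree_derivative]; omega

lemma hasse_real_roots (m : ℕ) {q : ℂ[X]} (hm : m < q.natDegree)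
    (hq : ∀ z, q.eval z = 0 → z.im = 0) (z : ℂ) (hz : (hasseDeriv m q).eval z = 0) :
    z.im = 0 := by
  refine iterate_deriv_real_roots m hm hq z ?_
  rw [← factorial_smul_hasseDeriv]
  simp [hz]

variable {n : ℕ}

/-- complexification -/
noncomputable abbrev cx (M : Matrix (Fin n) (Fin n) ℝ) : Matrix (Fin n) (Fin n) ℂ :=
  M.map Complex.ofRealHom

lemma eM_cx (k : ℕ) (M : Matrix (Fin n) (Fin n) ℝ) : eM k (cx M) = ((eM k M : ℝ) : ℂ) := by
  rw [eM_map]; rfl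

lemma shift_real {k : ℕ} (hk1 : 1 ≤ k) (hk : k ≤ n) {Y : Matrix (Fin n) (Fin n) ℝ}
    (hY : Y.IsHermitian) (z : ℂ) (hz : eM k (z • (1 : Matrix (Fin n) (Fin n) ℂ) + cx Y) = 0) :
    z.im = 0 := by
  have h := eM_shift hk z (cx Y)
  rw [hz, mul_zero] at h
  have := hasse_real_roots (n - k) (q := (cx Y).charpoly) (by
    rw [charpoly_natDegree_eq_dim, Fintype.card_fin]; omega) (by
    intro w hw
    rw [cx, charpoly_map, hY.charpoly_eq, Polynomial.map_prod, eval_prod,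
      Finset.prod_eq_zero_iff] at hw
    obtain ⟨i, _, hi⟩ := hw
    simp [sub_eq_zero] at hi
    rw [hi]; simp) (-z) h.symm
  simpa using this

lemma shift_pos {k : ℕ} (hk : k ≤ n) {Y : Matrix (Fin n) (Fin n) ℝ}
    (hY : ∀ j, 1 ≤ j → j ≤ k → 0 < eM j Y) (hk1 : 1 ≤ k) {z : ℝ} (hz : 0 ≤ z) :
    0 < eM k (z • (1 : Matrix (Fin n) (Fin n) ℝ) + Y) := by
  rw [eM_shift_sum hk, Finset.sum_range_succ']
  have h0 : eM 0 Y = 1 := by simp [eM]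
  refine add_pos_of_nonneg_of_pos (Finset.sum_nonneg fun j hj => ?_) ?_
  · have : 0 ≤ eM (k - (j + 1)) Y := by
      rcases Nat.eq_zero_or_pos (k - (j + 1)) with h | h
      · rw [h, h0]; norm_num
      · exact (hY _ h (by omega)).le
    positivity
  · have := hY k hk1 le_rfl
    simpa using this

/-- zeros of `z ↦ eM k (z + B)` for `B` in the cone are negative reals. -/
lemma shift_neg {k : ℕ} (hk1 : 1 ≤ k) (hk : k ≤ n) {Y : Matrix (Fin n) (Fin n) ℝ}
    (hYh : Y.IsHermitian)
    (hY : ∀ j, 1 ≤ j → j ≤ k → 0 < eM j Y) (z : ℂ)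
    (hz : eM k (z • (1 : Matrix (Fin n) (Fin n) ℂ) + cx Y) = 0) :
    z.im = 0 ∧ z.re < 0 := by
  have him := shift_real hk1 hk hYh z hz
  refine ⟨him, ?_⟩
  by_contra! hre
  have h := shift_pos hk hY hk1 hre
  have hz' : z = (z.re : ℂ) := by
    apply Complex.ext <;> simp [him]
  have h2 : z • (1 : Matrix (Fin n) (Fin n) ℂ) + cx Y
      = cx (z.re • (1 : Matrix (Fin n) (Fin n) ℝ) + Y) := by
    rw [hz']
    ext i j
    by_cases hij : i = j
    · subst hij; simp
    · simp [hij]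
  rw [h2, eM_cx] at hz
  exact h.ne' (by exact_mod_cast hz)

section homotopy
variable {S : Type*} [TopologicalSpace S]

lemma roots_isOpen {k : ℕ} {B : Matrix (Fin n) (Fin n) ℂ} (hB : eM k B ≠ 0)
    {M : S → Matrix (Fin n) (Fin n) ℂ} (hM : Continuous M) {U : Set ℂ} (hU : IsOpen U) :
    IsOpen {s | ∃ t ∈ U, eM k (t • B + M s) = 0} := by
  rw [isOpen_iff_mem_nhds]
  rintro s₀ ⟨t₀, ht₀, h0⟩
  obtain ⟨ε, hε, hball⟩ := Metric.isOpen_iff.mp hU t₀ ht₀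
  have hc : Continuous fun s => ‖eM k (t₀ • B + M s)‖ :=
    (eM_continuous k (continuous_const.add hM)).norm
  have hpos : 0 < ‖eM k B‖ * ε ^ k := by positivity
  have hev : ∀ᶠ s in nhds s₀, ‖eM k (t₀ • B + M s)‖ < ‖eM k B‖ * ε ^ k := by
    refine hc.continuousAt.eventually_lt continuousAt_const ?_
    simpa [h0] using hpos
  filter_upwards [hev] with s hs
  by_contra hne
  simp only [not_exists, not_and] at hne
  refine absurd hs (not_lt.mpr ?_)
  have hsp := IsAlgClosed.splits (pen k B (M s))
  have h1 := hsp.eval_eq_prod_roots t₀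
  rw [pen_eval, pen_leadingCoeff k _ _ hB] at h1
  have hcard := splits_iff_card_roots.mp hsp
  rw [pen_natDegree k _ _ hB] at hcard
  rw [h1, norm_mul]
  refine mul_le_mul_of_nonneg_left ?_ (norm_nonneg _)
  have key : ∀ m : Multiset ℂ, (∀ r ∈ m, ε ≤ ‖t₀ - r‖) →
      ε ^ (Multiset.card m) ≤ ‖(m.map fun r => t₀ - r).prod‖ := by
    intro m
    induction m using Multiset.induction_on with
    | empty => simp
    | cons a m ih =>
      intro h
      rw [Multiset.card_cons, Multiset.map_cons, Multiset.prod_cons, norm_mul, pow_succ']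
      exact mul_le_mul (h a (by simp)) (ih fun r hr => h r (by simp [hr])) (by positivity)
        (norm_nonneg _)
  have hk' := key (pen k B (M s)).roots
  rw [hcard] at hk'
  refine hk' fun r hr => ?_
  by_contra! hlt
  refine hne r (hball ?_) ?_
  · rw [Metric.mem_ball, dist_comm, dist_eq_norm]; exact hlt
  · rw [← pen_eval]; exact (mem_roots'.mp hr).2

lemma roots_isClosed {k : ℕ} {B : Matrix (Fin n) (Fin n) ℂ} (hB : eM k B ≠ 0)
    {M : S → Matrix (Fin n) (Fin n) ℂ} (hM : Continuous M) {K : Set ℂ} (hK : IsClosed K) :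
    IsClosed {s | ∃ t ∈ K, eM k (t • B + M s) = 0} := by
  rw [← isOpen_compl_iff, isOpen_iff_mem_nhds]
  intro s₀ hs₀
  simp only [Set.mem_compl_iff, Set.mem_ofPred_eq, not_exists, not_and] at hs₀
  have hG : Continuous fun p : S × ℂ => eM k (B + p.2 • M p.1) :=
    eM_continuous k (by fun_prop)
  have hF : Continuous fun p : S × ℂ => eM k (p.2 • B + M p.1) :=
    eM_continuous k (by fun_prop)
  have h1 : ∀ᶠ p in nhds (s₀, (0 : ℂ)), eM k (B + p.2 • M p.1) ≠ 0 :=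
    hG.continuousAt.eventually_ne (by simpa using hB)
  rw [nhds_prod_eq] at h1
  obtain ⟨P, hP, Q, hQ, hPQ⟩ := Filter.eventually_prod_iff.mp h1
  obtain ⟨δ, hδ, hball⟩ := Metric.eventually_nhds_iff.mp hQ
  have hcomp : IsCompact (K ∩ Metric.closedBall (0 : ℂ) (2 / δ)) :=
    (isCompact_closedBall _ _).inter_left hK
  have h2 : ∀ᶠ s in nhds s₀, ∀ t ∈ K ∩ Metric.closedBall (0 : ℂ) (2 / δ),
      eM k (t • B + M s) ≠ 0 := by
    refine hcomp.eventually_forall_of_forall_eventually fun t ht => ?_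
    exact hF.continuousAt.eventually_ne (hs₀ t ht.1)
  filter_upwards [h2, hP] with s hs hPs
  simp only [Set.mem_compl_iff, Set.mem_ofPred_eq, not_exists, not_and]
  intro t ht hzero
  by_cases hb : ‖t‖ ≤ 2 / δ
  · exact hs t ⟨ht, by simpa using hb⟩ hzero
  · push Not at hb
    have htpos : 0 < ‖t‖ := lt_trans (by positivity) hb
    have ht0 : t ≠ 0 := norm_pos_iff.mp htpos
    have hq : Q t⁻¹ := hball (by
      rw [dist_zero_right, norm_inv, inv_lt_comm₀ htpos hδ]
      refine lt_trans ?_ hb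
      rw [inv_eq_one_div]; gcongr; norm_num)
    refine hPQ hPs hq ?_
    have : B + t⁻¹ • M s = t⁻¹ • (t • B + M s) := by
      rw [smul_add, smul_smul, inv_mul_cancel₀ ht0, one_smul]
    simp only [this, eM_smul, hzero, mul_zero]

lemma homotopy_roots [PreconnectedSpace S] {k : ℕ} {B : Matrix (Fin n) (Fin n) ℂ}
    (hB : eM k B ≠ 0) {M : S → Matrix (Fin n) (Fin n) ℂ} (hM : Continuous M) {U K : Set ℂ}
    (hU : IsOpen U) (hK : IsClosed K) (hUK : U ⊆ K)
    (hbd : ∀ s, ∀ t ∈ K, eM k (t • B + M s) = 0 → t ∈ U)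
    (s₀ s₁ : S) (h0 : ∀ t ∈ K, eM k (t • B + M s₀) ≠ 0) :
    ∀ t ∈ K, eM k (t • B + M s₁) ≠ 0 := by
  have heq : {s | ∃ t ∈ U, eM k (t • B + M s) = 0} = {s | ∃ t ∈ K, eM k (t • B + M s) = 0} := by
    ext s
    constructor
    · rintro ⟨t, ht, h⟩; exact ⟨t, hUK ht, h⟩
    · rintro ⟨t, ht, h⟩; exact ⟨t, hbd s t ht h, h⟩
  have hcl : IsClopen {s | ∃ t ∈ K, eM k (t • B + M s) = 0} :=
    ⟨roots_isClosed hB hM hK, heq ▸ roots_isOpen hB hM hU⟩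
  rcases isClopen_iff.mp hcl with h | h
  · intro t ht hz
    have : s₁ ∈ {s | ∃ t ∈ K, eM k (t • B + M s) = 0} := ⟨t, ht, hz⟩
    rw [h] at this; exact this
  · have : s₀ ∈ {s | ∃ t ∈ K, eM k (t • B + M s) = 0} := by rw [h]; trivial
    obtain ⟨t, ht, hz⟩ := this
    exact absurd hz (h0 t ht)

end homotopy
end GKH

namespace GKH
open Polynomial Matrix
variable {n : ℕ}

lemma upper_aux {k : ℕ} (hk1 : 1 ≤ k) (hk : k ≤ n) {B D : Matrix (Fin n) (Fin n) ℝ}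
    (hBh : B.IsHermitian) (hDh : D.IsHermitian)
    (hB : ∀ j, 1 ≤ j → j ≤ k → 0 < eM j B) {α : ℝ} (hα : 0 < α) (t : ℂ) (ht : 0 ≤ t.im) :
    eM k (t • cx B + ((α * Complex.I) • (1 : Matrix (Fin n) (Fin n) ℂ) + cx D)) ≠ 0 := by
  have hBne : eM k (cx B) ≠ 0 := by
    rw [eM_cx]; exact_mod_cast (hB k hk1 le_rfl).ne'
  have hαne : (α * Complex.I : ℂ) ≠ 0 := by simp [hα.ne']
  have hM : Continuous fun s : ℝ =>
      ((α * Complex.I) • (1 : Matrix (Fin n) (Fin n) ℂ) + (s : ℂ) • cx D) := by fun_prop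
  have := homotopy_roots hBne hM (U := {z : ℂ | 0 < z.im}) (K := {z : ℂ | 0 ≤ z.im})
    (isOpen_lt continuous_const Complex.continuous_im)
    (isClosed_le continuous_const Complex.continuous_im)
    (by intro z hz; simp only [Set.mem_ofPred_eq] at hz ⊢; exact hz.le) ?_ 0 1 ?_ t ht
  · simpa using this
  · intro s z hz h0
    simp only [Set.mem_ofPred_eq] at hz ⊢
    refine lt_of_le_of_ne hz fun him => ?_
    have hz' : z = (z.re : ℂ) := by
      apply Complex.ext <;> simp [← him]
    have h2 : z • cx B + ((α * Complex.I) • (1 : Matrix (Fin n) (Fin n) ℂ) + (s : ℂ) • cx D)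
        = (α * Complex.I) • (1 : Matrix (Fin n) (Fin n) ℂ) + cx (z.re • B + s • D) := by
      rw [hz']
      ext i j
      simp
      ring
    rw [h2] at h0
    have hH : (z.re • B + s • D).IsHermitian := by
      refine IsHermitian.add ?_ ?_
      · rw [IsHermitian, conjTranspose_smul, hBh.eq]; simp
      · rw [IsHermitian, conjTranspose_smul, hDh.eq]; simp
    have h3 := shift_real hk1 hk hH _ h0
    simp at h3
    exact hα.ne' h3
  · intro z hz h0
    simp only [Complex.ofReal_zero, zero_smul, add_zero] at h0
    by_cases hz0 : z = 0
    · rw [hz0, zero_smul, zero_add, eM_smul, eM_one] at h0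
      have : ((n.choose k : ℕ) : ℂ) ≠ 0 := by exact_mod_cast (Nat.choose_pos hk).ne'
      exact mul_ne_zero (pow_ne_zero _ hαne) this h0
    · have h2 : z • cx B + (α * Complex.I) • (1 : Matrix (Fin n) (Fin n) ℂ)
          = z • ((α * Complex.I / z) • (1 : Matrix (Fin n) (Fin n) ℂ) + cx B) := by
        rw [smul_add, smul_smul, mul_div_cancel₀ _ hz0, add_comm]
      rw [h2, eM_smul] at h0
      have h3 := (mul_eq_zero.mp h0).resolve_left (pow_ne_zero _ hz0)
      obtain ⟨h4, h5⟩ := shift_neg hk1 hk hBh hB _ h3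
      have h6 : (α * Complex.I / z) * z = α * Complex.I := div_mul_cancel₀ _ hz0
      have h7 := congrArg Complex.im h6
      rw [Complex.mul_im, h4] at h7
      simp at h7
      have hz' : 0 ≤ z.im := hz
      have : (α * Complex.I / z).re * z.im ≤ 0 := mul_nonpos_of_nonpos_of_nonneg h5.le hz'
      linarith

lemma upper {k : ℕ} (hk1 : 1 ≤ k) (hk : k ≤ n) {B D : Matrix (Fin n) (Fin n) ℝ}
    (hBh : B.IsHermitian) (hDh : D.IsHermitian)
    (hB : ∀ j, 1 ≤ j → j ≤ k → 0 < eM j B) (t : ℂ) (ht : 0 < t.im) :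
    eM k (t • cx B + cx D) ≠ 0 := by
  intro h0
  have hBne : eM k (cx B) ≠ 0 := by
    rw [eM_cx]; exact_mod_cast (hB k hk1 le_rfl).ne'
  have hM : Continuous fun s : ℝ =>
      (((s : ℂ) * Complex.I) • (1 : Matrix (Fin n) (Fin n) ℂ) + cx D) := by fun_prop
  have hop := roots_isOpen hBne hM (U := {z : ℂ | 0 < z.im})
    (isOpen_lt continuous_const Complex.continuous_im)
  have hmem : (0 : ℝ) ∈ {s : ℝ | ∃ t ∈ {z : ℂ | 0 < z.im},
      eM k (t • cx B + (((s : ℂ) * Complex.I) • (1 : Matrix (Fin n) (Fin n) ℂ) + cx D)) = 0} :=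
    ⟨t, ht, by simpa using h0⟩
  obtain ⟨ε, hε, hball⟩ := Metric.isOpen_iff.mp hop 0 hmem
  have h1 : (ε / 2) ∈ Metric.ball (0 : ℝ) ε := by
    rw [Metric.mem_ball, dist_zero_right, Real.norm_eq_abs, abs_of_pos (by positivity)]
    linarith
  obtain ⟨z, hz, hz0⟩ := hball h1
  exact upper_aux hk1 hk hBh hDh hB (half_pos hε) z (le_of_lt hz) hz0

lemma roots_real {k : ℕ} (hk1 : 1 ≤ k) (hk : k ≤ n) {B D : Matrix (Fin n) (Fin n) ℝ}
    (hBh : B.IsHermitian) (hDh : D.IsHermitian)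
    (hB : ∀ j, 1 ≤ j → j ≤ k → 0 < eM j B) (t : ℂ)
    (h0 : eM k (t • cx B + cx D) = 0) : t.im = 0 := by
  rcases lt_trichotomy t.im 0 with h | h | h
  · exfalso
    refine upper hk1 hk hBh hDh hB ((starRingEnd ℂ) t) (by simpa using h) ?_
    have h2 : (starRingEnd ℂ t) • cx B + cx D = (t • cx B + cx D).map (starRingEnd ℂ) := by
      ext i j
      simp
    rw [h2, eM_map, h0, map_zero]
  · exact h
  · exact absurd h0 (upper hk1 hk hBh hDh hB t h)

lemma roots_neg {k : ℕ} (hk1 : 1 ≤ k) (hk : k ≤ n) {A B : Matrix (Fin n) (Fin n) ℝ}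
    (hAh : A.IsHermitian) (hBh : B.IsHermitian)
    (hA : ∀ j, 1 ≤ j → j ≤ k → 0 < eM j A) (hB : ∀ j, 1 ≤ j → j ≤ k → 0 < eM j B) (t : ℂ)
    (h0 : eM k (t • cx B + cx A) = 0) : t.im = 0 ∧ t.re < 0 := by
  refine ⟨roots_real hk1 hk hBh hAh hB t h0, ?_⟩
  by_contra! ht
  revert h0
  have hBne : eM k (cx B) ≠ 0 := by
    rw [eM_cx]; exact_mod_cast (hB k hk1 le_rfl).ne'
  have hchoose : 0 < ((n.choose k : ℕ) : ℝ) := by exact_mod_cast (Nat.choose_pos hk)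
  let N : unitInterval → Matrix (Fin n) (Fin n) ℝ := fun s => (1 - (s : ℝ)) • 1 + (s : ℝ) • A
  have hNc : Continuous N := by fun_prop
  have hM : Continuous fun s => cx (N s) := hNc.matrix_map Complex.continuous_ofReal
  have hNH : ∀ s, (N s).IsHermitian := by
    intro s
    refine IsHermitian.add ?_ ?_
    · rw [IsHermitian, conjTranspose_smul]; simp
    · rw [IsHermitian, conjTranspose_smul, hAh.eq]; simp
  have hNpos : ∀ s, 0 < eM k (N s) := by
    intro s
    rcases eq_or_lt_of_le s.2.1 with h | h
    · simp only [N, ← h]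
      simpa [eM_one] using hchoose
    · have : N s = (s : ℝ) • (((1 - (s : ℝ)) / s) • (1 : Matrix (Fin n) (Fin n) ℝ) + A) := by
        simp only [N]
        rw [smul_add, smul_smul, mul_div_cancel₀ _ h.ne']
      rw [this, eM_smul]
      exact mul_pos (pow_pos h _)
        (shift_pos hk hA hk1 (div_nonneg (by linarith [s.2.2]) h.le))
  have := homotopy_roots hBne hM (U := {z : ℂ | 0 < z.re}) (K := {z : ℂ | 0 ≤ z.re})
    (isOpen_lt continuous_const Complex.continuous_re)
    (isClosed_le continuous_const Complex.continuous_re)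
    (by intro z hz; simp only [Set.mem_ofPred_eq] at hz ⊢; exact hz.le) ?_ 0 1 ?_ t ht
  · have h1 : N 1 = A := by simp [N]
    simpa only [h1] using this
  · intro s z hz h0
    simp only [Set.mem_ofPred_eq] at hz ⊢
    refine lt_of_le_of_ne hz fun hre => ?_
    have him := roots_real hk1 hk hBh (hNH s) hB z h0
    have hz' : z = 0 := by
      apply Complex.ext <;> simp [← hre, him]
    rw [hz', zero_smul, zero_add, eM_cx] at h0
    exact (hNpos s).ne' (by exact_mod_cast h0)
  · intro z hz h0
    have h1 : cx (N 0) = 1 := by simp [N, cx]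
    rw [h1] at h0
    by_cases hz0 : z = 0
    · rw [hz0, zero_smul, zero_add, eM_one] at h0
      exact hchoose.ne' (by exact_mod_cast h0)
    · have h2 : z • cx B + (1 : Matrix (Fin n) (Fin n) ℂ)
          = z • ((1 / z) • (1 : Matrix (Fin n) (Fin n) ℂ) + cx B) := by
        rw [smul_add, smul_smul, mul_div_cancel₀ _ hz0, add_comm, one_smul]
      rw [h2, eM_smul] at h0
      have h3 := (mul_eq_zero.mp h0).resolve_left (pow_ne_zero _ hz0)
      obtain ⟨h4, h5⟩ := shift_neg hk1 hk hBh hB _ h3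
      have h6 : (1 / z) * z = 1 := div_mul_cancel₀ _ hz0
      have h7 := congrArg Complex.re h6
      rw [Complex.mul_re, h4] at h7
      simp only [zero_mul, sub_zero, Complex.one_re] at h7
      have hz' : 0 ≤ z.re := hz
      have : (1 / z).re * z.re ≤ 0 := mul_nonpos_of_nonpos_of_nonneg h5.le hz'
      linarith

/-- AM-GM for multisets. -/
lemma amgm (m : Multiset ℝ) (hm : ∀ x ∈ m, 0 < x) (hc : 0 < Multiset.card m) :
    m.prod ^ ((1 : ℝ) / Multiset.card m) ≤ (1 / Multiset.card m : ℝ) * m.sum := by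
  induction m using Quotient.inductionOn with
  | h l =>
    simp only [Multiset.quot_mk_to_coe, Multiset.coe_card, Multiset.prod_coe, Multiset.sum_coe,
      Multiset.mem_coe] at *
    have := Real.geom_mean_le_arith_mean (Finset.univ : Finset (Fin l.length)) (fun _ => 1)
      (fun i => l.get i) (fun _ _ => zero_le_one) (by simpa using hc)
      (fun i _ => (hm _ (List.get_mem _ _)).le)
    simp only [Real.rpow_one, one_mul, Finset.sum_const, Finset.card_univ, Fintype.card_fin,
      nsmul_eq_mul, mul_one] at this
    rw [one_div, inv_mul_eq_div]
    convert this using 2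
    · rw [← List.prod_ofFn, List.ofFn_get]
    · rw [← List.sum_ofFn, List.ofFn_get]

lemma poly_ineq {k : ℕ} (hk1 : 1 ≤ k) (p : ℝ[X]) (hd : p.natDegree = k)
    (hroots : ∀ z : ℂ, (p.map Complex.ofRealHom).eval z = 0 → z.im = 0 ∧ z.re < 0)
    {a b : ℝ} (ha : 0 < a) (hb : 0 < b) (hpa : p.eval 0 = a) (hpb : p.leadingCoeff = b) :
    a ^ (((k : ℝ) - 1) / k) * b ^ ((1 : ℝ) / k) ≤ (1 / k : ℝ) * p.derivative.eval 0 := by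
  have hsp : p.Splits := by
    refine Splits.of_splits_map Complex.ofRealHom (IsAlgClosed.splits _) ?_
    intro z hz
    have := (hroots z (mem_roots'.mp hz).2).1
    exact ⟨z.re, by apply Complex.ext <;> simp [this]⟩
  have hneg : ∀ r ∈ p.roots, r < 0 := by
    intro r hr
    have h := (mem_roots'.mp hr).2
    have h2 := (hroots (r : ℂ) (by
      have : (p.map Complex.ofRealHom).eval (Complex.ofRealHom r) = 0 := by
        rw [eval_map_apply, h, map_zero]
      exact this)).2
    simpa using h2
  have hcard := splits_iff_card_roots.mp hsp
  rw [hd] at hcard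
  have hder := hsp.eval_derivative_eq_eval_mul_sum (x := 0) (by rw [hpa]; exact ha.ne')
  have hev := hsp.eval_eq_prod_roots 0
  rw [hpa, hpb] at hev
  rw [hpa] at hder
  set m : Multiset ℝ := p.roots.map fun z => 1 / (0 - z) with hm
  have hmc : Multiset.card m = k := by simp [hm, hcard]
  have hmp : m.prod = b / a := by
    have h1 : m.prod * (p.roots.map fun z => 0 - z).prod = 1 := by
      rw [hm, ← Multiset.prod_map_mul]
      apply Multiset.prod_eq_one
      intro x hx
      obtain ⟨r, hr, rfl⟩ := Multiset.mem_map.mp hx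
      have := hneg r hr
      have : (0 - r) ≠ 0 := by linarith
      field_simp
    rw [eq_div_iff ha.ne', hev]
    linear_combination b * h1
  have hag := amgm m (by
    intro x hx
    obtain ⟨r, hr, rfl⟩ := Multiset.mem_map.mp hx
    have := hneg r hr
    apply one_div_pos.mpr; linarith) (by omega)
  rw [hmc, hmp] at hag
  rw [hder]
  have hkpos : (0 : ℝ) < k := by exact_mod_cast hk1
  have heq : a ^ (((k : ℝ) - 1) / k) * b ^ ((1 : ℝ) / k) = a * (b / a) ^ ((1 : ℝ) / k) := by
    rw [Real.div_rpow hb.le ha.le, sub_div, div_self hkpos.ne', Real.rpow_sub ha, Real.rpow_one]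
    ring
  rw [heq]
  calc a * (b / a) ^ ((1 : ℝ) / k) ≤ a * ((1 / k : ℝ) * m.sum) :=
        mul_le_mul_of_nonneg_left hag ha.le
    _ = _ := by ring

end GKH

/-- **Gårding inequality for the k-Hessian operator** (Statement 0).
If `λ(A), λ(B) ∈ Γ_k` then `(1/k)·(d/dt)|_{t=0} S_k(A + tB) ≥ S_k(A)^{(k−1)/k}·S_k(B)^{1/k}`. -/
theorem garding_ineq_kHessian (n k : ℕ) (hn : 2 ≤ n) (hk1 : 1 ≤ k) (hkn : k ≤ n)
    (A B : Matrix (Fin n) (Fin n) ℝ) (hA : A.IsHermitian) (hB : B.IsHermitian)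
    (hAG : hA.eigenvalues ∈ GardingCone n k) (hBG : hB.eigenvalues ∈ GardingCone n k) :
    SkM k A ^ (((k : ℝ) - 1) / k) * SkM k B ^ ((1 : ℝ) / k)
      ≤ (1 / k : ℝ) * deriv (fun t : ℝ => SkM k (A + t • B)) 0 := by
  have hA' : ∀ j, 1 ≤ j → j ≤ k → 0 < GKH.eM j A := by
    intro j h1 h2
    rw [GKH.eM_eq_sigmaE (h2.trans hkn) hA]; exact hAG j h1 h2
  have hB' : ∀ j, 1 ≤ j → j ≤ k → 0 < GKH.eM j B := by
    intro j h1 h2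
    rw [GKH.eM_eq_sigmaE (h2.trans hkn) hB]; exact hBG j h1 h2
  have hS : ∀ M : Matrix (Fin n) (Fin n) ℝ, M.IsHermitian → SkM k M = GKH.eM k M := by
    intro M hM
    rw [SkM, dif_pos hM, GKH.eM_eq_sigmaE hkn hM]
  have hfun : (fun t : ℝ => SkM k (A + t • B)) = fun t => (GKH.pen k B A).eval t := by
    funext t
    rw [GKH.pen_eval, add_comm (t • B) A]
    refine hS _ (hA.add ?_)
    rw [Matrix.IsHermitian, Matrix.conjTranspose_smul, hB.eq]; simp
  rw [hfun, Polynomial.deriv, hS A hA, hS B hB]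
  have hBne := (hB' k hk1 le_rfl).ne'
  refine GKH.poly_ineq hk1 _ (GKH.pen_natDegree k B A hBne) ?_ (hA' k hk1 le_rfl)
    (hB' k hk1 le_rfl) ?_ (GKH.pen_leadingCoeff k B A hBne)
  · intro z hz
    rw [GKH.pen_map, GKH.pen_eval] at hz
    exact GKH.roots_neg hk1 hkn hA hB hA' hB' z hz
  · rw [GKH.pen_eval, zero_smul, zero_add]
end

section
/- Let n ≥ 2, 1 ≤ k ≤ n, and let A, B be real symmetric n×n matrices with λ(A) ∈ Γ_k and λ(B) ∈ Γ_k. Suppose λ_1,…,λ_k are real numbers such that S_k(tA + B) = S_k(A)·∏_{i=1}^k (t + λ_i) for all t ∈ ℝ. Then each λ_i > 0, and (1/k)·(d/dt)|_{t=0} S_k(A + tB) ≥ S_k(A)^{(k−1)/k} S_k(B)^{1/k} + (S_k(A)/k)·Σ_{i=1}^k ( √λ_i − (S_k(B)/S_k(A))^{1/(2k)} )². -/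
open Polynomial in
/-- Sum of principal `k × k` minors. -/
noncomputable def pk {R : Type*} [CommRing R] {n : ℕ} (k : ℕ) (M : Matrix (Fin n) (Fin n) R) : R :=
  ∑ s ∈ Finset.powersetCard k (Finset.univ : Finset (Fin n)),
    (M.submatrix (Subtype.val : s → Fin n) (Subtype.val : s → Fin n)).det

lemma pk_smul {R : Type*} [CommRing R] {n : ℕ} (k : ℕ) (c : R) (M : Matrix (Fin n) (Fin n) R) :
    pk k (c • M) = c ^ k * pk k M := by
  unfold pk
  rw [Finset.mul_sum]
  refine Finset.sum_congr rfl fun s hs => ?_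
  rw [Matrix.submatrix_smul, Pi.smul_apply, Pi.smul_apply, Matrix.det_smul, Fintype.card_coe,
    (Finset.mem_powersetCard.mp hs).2]

lemma pk_map {R S : Type*} [CommRing R] [CommRing S] {n : ℕ} (k : ℕ) (f : R →+* S)
    (M : Matrix (Fin n) (Fin n) R) : pk k (M.map f) = f (pk k M) := by
  unfold pk
  rw [map_sum]
  refine Finset.sum_congr rfl fun s hs => ?_
  rw [RingHom.map_det]
  rfl

lemma pk_continuous {n : ℕ} (k : ℕ) :
    Continuous (fun M : Matrix (Fin n) (Fin n) ℂ => pk k M) := by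
  unfold pk
  refine continuous_finsetSum _ fun s _ => ?_
  exact Continuous.matrix_det (continuous_id.matrix_submatrix _ _)

lemma pk_zero {R : Type*} [CommRing R] {n : ℕ} (M : Matrix (Fin n) (Fin n) R) :
    pk 0 M = 1 := by
  simp [pk]

open Polynomial in
/-- The polynomial `z ↦ pk (z A + Y)`. -/
noncomputable def pkPoly {n : ℕ} (k : ℕ) (A Y : Matrix (Fin n) (Fin n) ℂ) : ℂ[X] :=
  ∑ s ∈ Finset.powersetCard k (Finset.univ : Finset (Fin n)),
    Matrix.det ((X : ℂ[X]) • (A.submatrix (Subtype.val : s → Fin n) (Subtype.val : s → Fin n)).map C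
     + (Y.submatrix (Subtype.val : s → Fin n) (Subtype.val : s → Fin n)).map C)

open Polynomial in
lemma pkPoly_eval {n : ℕ} (k : ℕ) (A Y : Matrix (Fin n) (Fin n) ℂ) (z : ℂ) :
    (pkPoly k A Y).eval z = pk k (z • A + Y) := by
  unfold pkPoly pk
  rw [eval_finsetSum]
  refine Finset.sum_congr rfl fun s _ => ?_
  rw [← coe_evalRingHom, RingHom.map_det]
  congr 1
  ext i j
  simp
  ring

open Polynomial in
lemma pkPoly_natDegree_le {n : ℕ} (k : ℕ) (A Y : Matrix (Fin n) (Fin n) ℂ) :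
    (pkPoly k A Y).natDegree ≤ k := by
  unfold pkPoly
  refine natDegree_sum_le_of_forall_le _ _ fun s hs => ?_
  refine (natDegree_det_X_add_C_le _ _).trans ?_
  rw [Fintype.card_coe, (Finset.mem_powersetCard.mp hs).2]

open Polynomial in
lemma pkPoly_coeff {n : ℕ} (k : ℕ) (A Y : Matrix (Fin n) (Fin n) ℂ) :
    (pkPoly k A Y).coeff k = pk k A := by
  unfold pkPoly pk
  rw [finsetSum_coeff]
  refine Finset.sum_congr rfl fun s hs => ?_
  rw [← coeff_det_X_add_C_card (A.submatrix _ _) (Y.submatrix _ _), Fintype.card_coe,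
    (Finset.mem_powersetCard.mp hs).2]

lemma charpoly_neg_coeff {R : Type*} [CommRing R] {n : ℕ} (k : ℕ) (hk : k ≤ n)
    (M : Matrix (Fin n) (Fin n) R) : (-M).charpoly.coeff (n - k) = pk k M := by
  have h := Matrix.charpoly_coeff_eq_sum_minors (-M) k (by simpa using hk)
  rw [Fintype.card_fin] at h
  rw [h]
  change (-1) ^ k * pk k (-M) = _
  rw [← pk_smul]
  simp

open Polynomial in
lemma pk_add_scalar {R : Type*} [CommRing R] {n : ℕ} (k : ℕ) (hk : k ≤ n)
    (M : Matrix (Fin n) (Fin n) R) (w : R) :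
    pk k (M + w • (1 : Matrix (Fin n) (Fin n) R))
      = (hasseDeriv (n - k) (-M).charpoly).eval w := by
  rw [← charpoly_neg_coeff k hk, ← taylor_coeff, taylor_apply, ← Matrix.charpoly_sub_scalar]
  congr 2
  rw [neg_add, sub_eq_add_neg, Matrix.smul_one_eq_diagonal, Matrix.scalar_apply]

open Polynomial in
lemma SkM_eq_pk {n : ℕ} (k : ℕ) (hk : k ≤ n) (M : Matrix (Fin n) (Fin n) ℝ)
    (hM : M.IsHermitian) : sigmaE k hM.eigenvalues = pk k M := by
  have h := Matrix.charpoly_coeff_eq_sum_minors M k (by simpa using hk)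
  change _ = (-1) ^ k * pk k M at h
  have h2 : pk k M = (-1) ^ k * M.charpoly.coeff (n - k) := by
    rw [Fintype.card_fin] at h
    rw [h, ← mul_assoc, ← mul_pow]; simp
  rw [h2, hM.charpoly_eq]
  have h3 := Finset.prod_X_add_C_coeff (Finset.univ : Finset (Fin n))
    (fun i => - hM.eigenvalues i) (k := n - k) (by simp)
  simp only [map_neg, ← sub_eq_add_neg, Finset.card_univ, Fintype.card_fin,
    Nat.sub_sub_self hk] at h3
  simp only [RCLike.ofReal_real_eq_id, id]
  rw [h3, Finset.mul_sum]
  unfold sigmaE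
  refine Finset.sum_congr rfl fun s hs => ?_
  rw [Finset.prod_neg, (Finset.mem_powersetCard.mp hs).2, ← mul_assoc, ← mul_pow]
  simp

open Polynomial in
lemma iter_deriv_real_roots (P : ℂ[X]) (hP : ∀ z, P.eval z = 0 → z.im = 0) (m : ℕ) :
    m ≤ P.natDegree → P ≠ 0 → (derivative^[m] P).natDegree = P.natDegree - m ∧
      derivative^[m] P ≠ 0 ∧ ∀ z, (derivative^[m] P).eval z = 0 → z.im = 0 := by
  induction m with
  | zero => intro _ h; exact ⟨by simp, by simpa using h, by simpa using hP⟩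
  | succ m ih =>
    intro hm h0
    obtain ⟨h1, h2, h3⟩ := ih (by omega) h0
    rw [Function.iterate_succ_apply']
    set Q := derivative^[m] P
    have hQd : 0 < Q.natDegree := by omega
    have hd : Q.derivative.natDegree = Q.natDegree - 1 := natDegree_derivative Q
    have hne : Q.derivative ≠ 0 := by
      intro h
      have := natDegree_eq_zero_of_derivative_eq_zero h
      omega
    refine ⟨by omega, hne, fun z hz => ?_⟩
    have hz' : z ∈ Q.derivative.rootSet ℂ := by
      rw [mem_rootSet, coe_aeval_eq_eval]; exact ⟨hne, hz⟩
    have := rootSet_derivative_subset_convexHull_rootSet (natDegree_pos_iff_degree_pos.mp hQd) hz'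
    have hconv : Convex ℝ {z : ℂ | z.im = 0} := by
      intro x hx y hy a b _ _ _
      simp only [Set.mem_setOf_eq] at *
      simp [hx, hy]
    refine convexHull_min ?_ hconv this
    intro y hy
    rw [mem_rootSet, coe_aeval_eq_eval] at hy
    exact h3 y hy.2

open Polynomial in
/-- Hyperbolicity in direction of the identity. -/
lemma pk_hyp {n : ℕ} (k : ℕ) (hk : k ≤ n) (M : Matrix (Fin n) (Fin n) ℝ) (hM : M.IsHermitian)
    (w : ℂ) (hw : w.im ≠ 0) :
    pk k (M.map Complex.ofRealHom + w • (1 : Matrix (Fin n) (Fin n) ℂ)) ≠ 0 := by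
  rw [pk_add_scalar k hk]
  set N : Matrix (Fin n) (Fin n) ℂ := -(M.map Complex.ofRealHom) with hN
  have hNH : N.IsHermitian := by
    apply Matrix.IsHermitian.neg
    apply Matrix.IsHermitian.ext
    intro i j
    have := hM.apply i j
    simp only [star_trivial] at this
    simp [this]
  intro h
  have hP : ∀ z, N.charpoly.eval z = 0 → z.im = 0 := by
    intro z hz
    rw [hNH.charpoly_eq, eval_prod, Finset.prod_eq_zero_iff] at hz
    obtain ⟨i, -, hi⟩ := hz
    simp [sub_eq_zero] at hi
    rw [hi]; simp
  have hnd : N.charpoly.natDegree = n := by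
    simpa using N.charpoly_natDegree_eq_dim
  obtain ⟨-, -, h3⟩ := iter_deriv_real_roots N.charpoly hP (n - k) (by omega)
    N.charpoly_monic.ne_zero
  refine hw (h3 w ?_)
  rw [← factorial_smul_hasseDeriv]
  simp [h]

/-- Hyperbolicity cone. -/
def InC {n : ℕ} (k : ℕ) (A : Matrix (Fin n) (Fin n) ℝ) : Prop :=
  A.IsHermitian ∧ ∀ w : ℂ, 0 ≤ w.re →
    pk k (A.map Complex.ofRealHom + w • (1 : Matrix (Fin n) (Fin n) ℂ)) ≠ 0

open Polynomial in
lemma inC_of_garding {n : ℕ} (k : ℕ) (hk : k ≤ n) (A : Matrix (Fin n) (Fin n) ℝ)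
    (hA : A.IsHermitian) (hpos : ∀ j, j ≤ k → 0 < pk j A) : InC k A := by
  refine ⟨hA, fun w hw => ?_⟩
  by_cases him : w.im = 0
  swap
  · exact pk_hyp k hk A hA w him
  have hwr : w = ((w.re : ℝ) : ℂ) := by
    apply Complex.ext <;> simp [him]
  set r := w.re
  have e : A.map Complex.ofRealHom + w • (1 : Matrix (Fin n) (Fin n) ℂ)
      = (A + r • (1 : Matrix (Fin n) (Fin n) ℝ)).map Complex.ofRealHom := by
    ext i j
    rw [hwr]
    by_cases h : i = j <;> simp [Matrix.one_apply, h]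
  rw [e, pk_map]
  suffices 0 < pk k (A + r • (1 : Matrix (Fin n) (Fin n) ℝ)) by
    simpa using this.ne'
  rw [pk_add_scalar k hk, eval_eq_sum_range]
  have hc : ∀ i, 0 ≤ (hasseDeriv (n - k) (-A).charpoly).coeff i := by
    intro i
    rw [hasseDeriv_coeff]
    refine mul_nonneg (by positivity) ?_
    by_cases hi : i ≤ k
    · have : i + (n - k) = n - (k - i) := by omega
      rw [this, charpoly_neg_coeff _ (by omega)]
      exact (hpos _ (by omega)).le
    · rw [coeff_eq_zero_of_natDegree_lt]
      rw [Matrix.charpoly_natDegree_eq_dim, Fintype.card_fin]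
      omega
  refine Finset.sum_pos' (fun i _ => mul_nonneg (hc i) (pow_nonneg hw i)) ⟨0, by simp, ?_⟩
  rw [hasseDeriv_coeff, Nat.zero_add, charpoly_neg_coeff k hk]
  simpa using hpos k le_rfl

lemma multiset_bound (s : Multiset ℂ) (z : ℂ) (hz : 0 < z.re) (hs : ∀ r ∈ s, r.re < 0) :
    z.re ^ (Multiset.card s) ≤ ‖(s.map (fun r => z - r)).prod‖ := by
  induction s using Multiset.induction_on with
  | empty => simp
  | cons a s ih =>
    have h1 := ih (fun r hr => hs r (Multiset.mem_cons_of_mem hr))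
    have h2 : z.re ≤ ‖z - a‖ := by
      have := Complex.re_le_norm (z - a)
      have h3 := hs a (Multiset.mem_cons_self a s)
      rw [Complex.sub_re] at this
      linarith
    rw [Multiset.map_cons, Multiset.prod_cons, norm_mul, Multiset.card_cons, pow_succ']
    exact mul_le_mul h2 h1 (by positivity) (norm_nonneg _)

open Polynomial in
lemma poly_bound (P : ℂ[X]) (k : ℕ) (hd : P.natDegree ≤ k) (hc : P.coeff k ≠ 0)
    (hr : ∀ z : ℂ, 0 ≤ z.re → P.eval z ≠ 0) (z : ℂ) (hz : 0 < z.re) :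
    ‖P.coeff k‖ * z.re ^ k ≤ ‖P.eval z‖ := by
  have hdk : P.natDegree = k := le_antisymm hd (le_natDegree_of_ne_zero hc)
  have hsp := IsAlgClosed.splits P
  have hcard : Multiset.card P.roots = k := by rw [← hdk]; exact hsp.natDegree_eq_card_roots.symm
  rw [hsp.eval_eq_prod_roots, norm_mul, leadingCoeff, hdk, ← hcard]
  refine mul_le_mul_of_nonneg_left ?_ (norm_nonneg _)
  refine multiset_bound _ _ hz fun r hr' => ?_
  by_contra hcon
  exact hr r (not_lt.mp hcon) (isRoot_of_mem_roots hr')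

lemma pk_homotopy {n : ℕ} (k : ℕ) (A Y W : Matrix (Fin n) (Fin n) ℂ) (hA : pk k A ≠ 0)
    (h0 : ∀ z : ℂ, 0 ≤ z.re → pk k (z • A + Y) ≠ 0)
    (hax : ∀ θ ∈ Set.Icc (0 : ℝ) 1, ∀ z : ℂ, z.re = 0 → pk k (z • A + (Y + (θ : ℂ) • W)) ≠ 0) :
    ∀ z : ℂ, 0 ≤ z.re → pk k (z • A + (Y + W)) ≠ 0 := by
  let F : ℝ → ℂ → ℂ := fun θ z => pk k (z • A + (Y + (θ : ℂ) • W))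
  have hF : Continuous (fun p : ℝ × ℂ => F p.1 p.2) := by
    refine (pk_continuous k).comp ?_
    have : Continuous fun p : ℝ × ℂ => ((p.1 : ℝ) : ℂ) := Complex.continuous_ofReal.comp continuous_fst
    exact (continuous_snd.smul continuous_const).add (continuous_const.add (this.smul continuous_const))
  -- roots are uniformly bounded
  have hR : ∃ R : ℝ, ∀ θ ∈ Set.Icc (0 : ℝ) 1, ∀ z : ℂ, R < ‖z‖ → F θ z ≠ 0 := by
    have hG : Continuous (fun p : ℂ × ℝ => pk k (A + p.1 • (Y + (p.2 : ℂ) • W))) := by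
      refine (pk_continuous k).comp ?_
      have : Continuous fun p : ℂ × ℝ => ((p.2 : ℝ) : ℂ) :=
        Complex.continuous_ofReal.comp continuous_snd
      exact continuous_const.add (continuous_fst.smul (continuous_const.add (this.smul continuous_const)))
    have hev : ∀ᶠ u in nhds (0 : ℂ), ∀ θ ∈ Set.Icc (0 : ℝ) 1,
        pk k (A + u • (Y + (θ : ℂ) • W)) ≠ 0 := by
      refine isCompact_Icc.eventually_forall_of_forall_eventually fun θ _ => ?_
      refine hG.continuousAt.eventually_ne ?_
      simpa using hA
    obtain ⟨ε, hε, hball⟩ := Metric.eventually_nhds_iff.mp hev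
    refine ⟨ε⁻¹, fun θ hθ z hz => ?_⟩
    have hzpos : 0 < ‖z‖ := (inv_pos.mpr hε).trans hz
    have hz0 : z ≠ 0 := norm_pos_iff.mp hzpos
    have h1 := hball (y := z⁻¹) (by
      rw [dist_zero_right, norm_inv]
      exact inv_lt_of_inv_lt₀ hε hz) θ hθ
    have e : z • A + (Y + (θ : ℂ) • W) = z • (A + z⁻¹ • (Y + (θ : ℂ) • W)) := by
      rw [smul_add, smul_smul, mul_inv_cancel₀ hz0, one_smul]
    change pk k (z • A + (Y + (θ : ℂ) • W)) ≠ 0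
    rw [e, pk_smul]
    exact mul_ne_zero (pow_ne_zero _ hz0) h1
  obtain ⟨R, hR⟩ := hR
  let S1 : Set ℝ := {θ | ∀ z : ℂ, 0 < z.re → ‖pk k A‖ * z.re ^ k ≤ ‖F θ z‖}
  let K : Set (ℝ × ℂ) := (Set.Icc (0 : ℝ) 1 ×ˢ Metric.closedBall (0 : ℂ) R) ∩
    ({p | 0 ≤ p.2.re} ∩ {p | F p.1 p.2 = 0})
  have hK : IsCompact K := by
    refine (isCompact_Icc.prod (isCompact_closedBall _ _)).inter_right ?_
    exact (isClosed_le continuous_const (Complex.continuous_re.comp continuous_snd)).inter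
      (isClosed_eq hF continuous_const)
  have hS2 : IsClosed (Prod.fst '' K) := (hK.image continuous_fst).isClosed
  have hS1 : IsClosed S1 := by
    have : S1 = ⋂ z : ℂ, ⋂ _ : 0 < z.re, {θ | ‖pk k A‖ * z.re ^ k ≤ ‖F θ z‖} := by
      ext θ; simp [S1]
    rw [this]
    refine isClosed_iInter fun z => isClosed_iInter fun _ => ?_
    exact isClosed_le continuous_const
      (hF.comp (continuous_id.prodMk continuous_const)).norm
  have hgood : ∀ θ, (∀ z : ℂ, 0 ≤ z.re → F θ z ≠ 0) → θ ∈ S1 := by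
    intro θ h z hz
    have := poly_bound (pkPoly k A (Y + (θ : ℂ) • W)) k (pkPoly_natDegree_le _ _ _)
      (by rw [pkPoly_coeff]; exact hA) (fun z hz => by rw [pkPoly_eval]; exact h z hz) z hz
    rwa [pkPoly_coeff, pkPoly_eval] at this
  have hmem2 : ∀ θ ∈ Set.Icc (0 : ℝ) 1, ∀ z : ℂ, 0 ≤ z.re → F θ z = 0 → θ ∈ Prod.fst '' K := by
    intro θ hθ z hz hzF
    refine ⟨(θ, z), ⟨⟨hθ, ?_⟩, hz, hzF⟩, rfl⟩
    rw [Metric.mem_closedBall, dist_zero_right]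
    by_contra hcon
    exact hR θ hθ z (not_le.mp hcon) hzF
  intro z hz hzero
  have hpre := isPreconnected_closed_iff.mp (isPreconnected_Icc (a := (0 : ℝ)) (b := 1))
    S1 (Prod.fst '' K) hS1 hS2 (by
      intro θ hθ
      by_cases h : ∀ z : ℂ, 0 ≤ z.re → F θ z ≠ 0
      · exact Or.inl (hgood θ h)
      · push Not at h
        obtain ⟨z, hz, hzF⟩ := h
        exact Or.inr (hmem2 θ hθ z hz hzF))
    ⟨0, by simp, hgood 0 (fun z hz => by simpa [F] using h0 z hz)⟩
    ⟨1, by simp, hmem2 1 (by simp) z hz (by simpa [F] using hzero)⟩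
  obtain ⟨θ, hθ, h1, ⟨⟨θ', z'⟩, ⟨-, hz', hF'⟩, he⟩⟩ := hpre
  dsimp at he
  subst he
  simp only [Set.mem_ofPred_eq] at hz' hF'
  rcases hz'.lt_or_eq with hlt | heq
  · have := h1 z' hlt
    rw [hF', norm_zero] at this
    have h2 : 0 < ‖pk k A‖ * z'.re ^ k := mul_pos (norm_pos_iff.mpr hA) (pow_pos hlt k)
    linarith
  · exact hax θ' hθ z' heq.symm hF'

/-- complexification -/
noncomputable def cx {n : ℕ} (A : Matrix (Fin n) (Fin n) ℝ) : Matrix (Fin n) (Fin n) ℂ :=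
  A.map Complex.ofRealHom

lemma cx_add {n : ℕ} (A B : Matrix (Fin n) (Fin n) ℝ) : cx (A + B) = cx A + cx B := by
  ext i j; simp [cx]

lemma cx_smul {n : ℕ} (c : ℝ) (A : Matrix (Fin n) (Fin n) ℝ) : cx (c • A) = (c : ℂ) • cx A := by
  ext i j; simp [cx]

lemma cx_one {n : ℕ} : cx (1 : Matrix (Fin n) (Fin n) ℝ) = 1 := by
  simp [cx]

lemma InC.ne {n k : ℕ} {A : Matrix (Fin n) (Fin n) ℝ} (h : InC k A) (w : ℂ) (hw : 0 ≤ w.re) :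
    pk k (cx A + w • (1 : Matrix (Fin n) (Fin n) ℂ)) ≠ 0 := h.2 w hw

/-- base point of the homotopies -/
lemma InC.base {n k : ℕ} {A : Matrix (Fin n) (Fin n) ℝ} (h : InC k A) (hk : k ≤ n)
    (z : ℂ) (hz : 0 ≤ z.re) :
    pk k (z • cx A + (1 : Matrix (Fin n) (Fin n) ℂ)) ≠ 0 := by
  by_cases hz0 : z = 0
  · subst hz0
    have := pk_hyp k hk (0 : Matrix (Fin n) (Fin n) ℝ) (by simp) Complex.I (by simp)
    have e : (0 : Matrix (Fin n) (Fin n) ℝ).map Complex.ofRealHom = 0 := by ext; simp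
    rw [e, zero_add, pk_smul] at this
    rw [zero_smul, zero_add]
    exact right_ne_zero_of_mul this
  · have e : z • cx A + (1 : Matrix (Fin n) (Fin n) ℂ)
        = z • (cx A + z⁻¹ • (1 : Matrix (Fin n) (Fin n) ℂ)) := by
      rw [smul_add, smul_smul, mul_inv_cancel₀ hz0, one_smul]
    rw [e, pk_smul]
    refine mul_ne_zero (pow_ne_zero _ hz0) (h.ne _ ?_)
    rw [Complex.inv_re]
    exact div_nonneg hz (Complex.normSq_nonneg _)

lemma InC.pk_ne {n k : ℕ} {A : Matrix (Fin n) (Fin n) ℝ} (h : InC k A) : pk k (cx A) ≠ 0 := by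
  have := h.ne 0 (by simp)
  simpa using this

open Polynomial in
lemma InC.shrink {n k : ℕ} {A : Matrix (Fin n) (Fin n) ℝ} (h : InC k A) (hk : k ≤ n) :
    ∃ ε : ℝ, 0 < ε ∧ InC k (A + (-ε) • (1 : Matrix (Fin n) (Fin n) ℝ)) := by
  set Q := hasseDeriv (n - k) (-(cx A)).charpoly
  have hQ : ∀ w, pk k (cx A + w • (1 : Matrix (Fin n) (Fin n) ℂ)) = Q.eval w :=
    fun w => pk_add_scalar k hk _ w
  have hQ0 : Q ≠ 0 := by
    intro h0
    have := h.ne 0 (by simp)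
    rw [hQ, h0] at this
    simp at this
  have hev : ∀ᶠ ε in nhdsWithin (0 : ℝ) (Set.Ioi 0), ∀ r ∈ Q.roots.toFinset, r.re < -ε := by
    rw [Filter.eventually_all_finset]
    intro r hr
    have hr' : Q.eval r = 0 := by
      rw [Multiset.mem_toFinset] at hr
      exact isRoot_of_mem_roots hr
    have hre : r.re < 0 := by
      by_contra hcon
      exact h.ne r (not_lt.mp hcon) (by rw [hQ, hr'])
    refine Filter.Eventually.filter_mono nhdsWithin_le_nhds ?_
    filter_upwards [gt_mem_nhds (show (0 : ℝ) < -r.re by linarith)] with ε hε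
    linarith
  obtain ⟨ε, hε, hpos⟩ := (hev.and self_mem_nhdsWithin).exists
  refine ⟨ε, hpos, h.1.add (by simp [Matrix.IsHermitian]), fun w hw => ?_⟩
  change pk k (cx _ + _) ≠ 0
  rw [cx_add, cx_smul, cx_one, add_assoc, ← add_smul, hQ]
  intro h0
  have := hε _ (by rw [Multiset.mem_toFinset]; exact (mem_roots hQ0).mpr h0)
  simp at this
  linarith

/-- tube -/
lemma tube_aux {n k : ℕ} (hk : k ≤ n) {A X : Matrix (Fin n) (Fin n) ℝ} (h : InC k A)
    (hX : X.IsHermitian) (z : ℂ) (hz : 0 ≤ z.re) :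
    pk k (z • cx A + (1 + Complex.I • cx X)) ≠ 0 := by
  refine pk_homotopy k (cx A) 1 (Complex.I • cx X) h.pk_ne (h.base hk) ?_ z hz
  intro θ _ w hw
  have hw' : w = Complex.I * (w.im : ℂ) := by
    apply Complex.ext <;> simp [hw]
  have e : w • cx A + (1 + (θ : ℂ) • Complex.I • cx X)
      = Complex.I • (cx (w.im • A + θ • X) + (-Complex.I) • (1 : Matrix (Fin n) (Fin n) ℂ)) := by
    rw [cx_add, cx_smul, cx_smul]
    conv_lhs => rw [hw']
    simp only [smul_add, smul_smul, mul_neg, Complex.I_mul_I, neg_neg, one_smul]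
    rw [mul_comm (θ : ℂ)]
    abel
  rw [e, pk_smul]
  refine mul_ne_zero (pow_ne_zero _ Complex.I_ne_zero) ?_
  refine pk_hyp k hk _ ?_ _ (by simp)
  exact (h.1.smul (by simp [IsSelfAdjoint])).add (hX.smul (by simp [IsSelfAdjoint]))

lemma tube {n k : ℕ} (hk : k ≤ n) {A X : Matrix (Fin n) (Fin n) ℝ} (h : InC k A)
    (hX : X.IsHermitian) : pk k (cx A + Complex.I • cx X) ≠ 0 := by
  obtain ⟨ε, hε, hA'⟩ := h.shrink hk
  have := tube_aux hk hA' (X := ε⁻¹ • X) (hX.smul (by simp [IsSelfAdjoint])) ((ε⁻¹ : ℝ) : ℂ)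
    (by rw [Complex.ofReal_re]; positivity)
  have e : ((ε⁻¹ : ℝ) : ℂ) • cx (A + (-ε) • (1 : Matrix (Fin n) (Fin n) ℝ))
      + (1 + Complex.I • cx (ε⁻¹ • X)) = ((ε⁻¹ : ℝ) : ℂ) • (cx A + Complex.I • cx X) := by
    have hε' : (ε : ℂ) ≠ 0 := by exact_mod_cast hε.ne'
    rw [cx_add, cx_smul, cx_smul, cx_one]
    simp only [smul_add, smul_smul]
    have : ((ε⁻¹ : ℝ) : ℂ) * ((-ε : ℝ) : ℂ) = -1 := by
      push_cast; field_simp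
    rw [this, mul_comm Complex.I, neg_smul, one_smul]
    abel
  rw [e, pk_smul] at this
  exact right_ne_zero_of_mul this

lemma InC.segment {n k : ℕ} {B : Matrix (Fin n) (Fin n) ℝ} (h : InC k B) (hk : k ≤ n) (θ : ℝ)
    (hθ : θ ∈ Set.Icc (0 : ℝ) 1) : InC k (1 + θ • (B + (-1 : ℝ) • 1)) := by
  refine ⟨Matrix.isHermitian_one.add ((h.1.add (by simp [Matrix.IsHermitian])).smul
    (by simp [IsSelfAdjoint])), fun w hw => ?_⟩
  change pk k (cx _ + _) ≠ 0
  rw [cx_add, cx_smul, cx_add, cx_smul, cx_one]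
  set u : ℂ := (1 - θ : ℂ) + w with hu
  have hure : u.re = 1 - θ + w.re := by simp [hu]
  have e : (1 : Matrix (Fin n) (Fin n) ℂ) + (θ : ℂ) • (cx B + ((-1 : ℝ) : ℂ) • 1) + w • 1
      = (θ : ℂ) • cx B + u • (1 : Matrix (Fin n) (Fin n) ℂ) := by
    rw [hu]; push_cast; module
  rw [e]
  by_cases hu0 : u = 0
  · have hθ1 : θ = 1 := by
      rw [hu0, Complex.zero_re] at hure
      linarith [hθ.1, hθ.2]
    rw [hu0, hθ1]
    simpa using h.pk_ne
  · have e2 : (θ : ℂ) • cx B + u • (1 : Matrix (Fin n) (Fin n) ℂ)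
        = u • ((u⁻¹ * θ) • cx B + (1 : Matrix (Fin n) (Fin n) ℂ)) := by
      rw [smul_add, smul_smul, ← mul_assoc, mul_inv_cancel₀ hu0, one_mul]
    rw [e2, pk_smul]
    refine mul_ne_zero (pow_ne_zero _ hu0) (h.base hk _ ?_)
    rw [Complex.re_mul_ofReal, Complex.inv_re]
    refine mul_nonneg (div_nonneg ?_ (Complex.normSq_nonneg _)) hθ.1
    rw [hure]; linarith [hθ.2]

lemma garding_ne {n k : ℕ} (hk : k ≤ n) {A B : Matrix (Fin n) (Fin n) ℝ} (hA : InC k A)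
    (hB : InC k B) (t : ℝ) (ht : 0 ≤ t) : pk k (t • A + B) ≠ 0 := by
  have := pk_homotopy k (cx A) 1 (cx (B + (-1 : ℝ) • 1)) hA.pk_ne (hA.base hk) (by
    intro θ hθ w hw
    have hw' : w = Complex.I * (w.im : ℂ) := by
      apply Complex.ext <;> simp [hw]
    have h1 := tube hk (hB.segment hk θ hθ) (X := w.im • A) (hA.1.smul (by simp [IsSelfAdjoint]))
    rw [cx_add, cx_smul, cx_smul, cx_one, smul_smul, ← hw', add_comm] at h1
    exact h1) (t : ℂ) (by simpa using ht)
  have e : (t : ℂ) • cx A + (1 + cx (B + (-1 : ℝ) • 1)) = cx (t • A + B) := by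
    simp only [cx_add, cx_smul, cx_one]
    push_cast; module
  rw [e] at this
  intro h0
  apply this
  unfold cx
  rw [pk_map, h0, map_zero]

lemma final_ineq (k : ℕ) (hk : 1 ≤ k) (a b : ℝ) (ha : 0 < a) (lam : Fin k → ℝ)
    (hl : ∀ i, 0 < lam i) (hb : b = a * ∏ i, lam i) :
    a ^ (((k : ℝ) - 1) / k) * b ^ ((1 : ℝ) / k)
        + (a / k) * ∑ i, (Real.sqrt (lam i) - (b / a) ^ ((1 : ℝ) / (2 * k))) ^ 2
      ≤ (1 / k : ℝ) * (a * ∑ i, lam i) := by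
  have hk0 : (0 : ℝ) < k := by exact_mod_cast hk
  set P := ∏ i, lam i with hP
  have hPpos : 0 < P := Finset.prod_pos fun i _ => hl i
  have hba : b / a = P := by rw [hb]; field_simp
  rw [hba]
  set g := P ^ ((1 : ℝ) / (2 * k)) with hg
  have hgpos : 0 < g := Real.rpow_pos_of_pos hPpos _
  have hg2 : P ^ ((1 : ℝ) / k) = g ^ 2 := by
    rw [hg, ← Real.rpow_natCast, ← Real.rpow_mul hPpos.le]
    congr 1; push_cast; field_simp
  have h1 : a ^ (((k : ℝ) - 1) / k) * b ^ ((1 : ℝ) / k) = a * g ^ 2 := by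
    rw [hb, Real.mul_rpow ha.le hPpos.le, hg2, ← mul_assoc, ← Real.rpow_add ha]
    have : ((k : ℝ) - 1) / k + 1 / k = 1 := by field_simp; ring
    rw [this, Real.rpow_one]
  have hamgm : k * g ≤ ∑ i, Real.sqrt (lam i) := by
    have h := Real.geom_mean_le_arith_mean Finset.univ (fun _ : Fin k => (1 : ℝ))
      (fun i => Real.sqrt (lam i)) (fun _ _ => zero_le_one) (by simpa using (by omega : 0 < k))
      (fun _ _ => Real.sqrt_nonneg _)
    simp only [Real.rpow_one, Finset.sum_const, Finset.card_univ, Fintype.card_fin, nsmul_eq_mul,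
      mul_one, one_mul] at h
    have h2 : (∏ i, Real.sqrt (lam i)) ^ ((k : ℝ)⁻¹) = g := by
      simp_rw [Real.sqrt_eq_rpow]
      rw [Real.finsetProd_rpow _ _ (fun i _ => (hl i).le), ← hP, ← Real.rpow_mul hPpos.le, hg]
      congr 1; field_simp
    rw [h2, le_div_iff₀ hk0] at h
    linarith
  have hsum : ∑ i, (Real.sqrt (lam i) - g) ^ 2
      = ∑ i, lam i - 2 * g * ∑ i, Real.sqrt (lam i) + k * g ^ 2 := by
    have : ∀ i, (Real.sqrt (lam i) - g) ^ 2 = lam i - 2 * g * Real.sqrt (lam i) + g ^ 2 := by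
      intro i
      rw [sub_sq, Real.sq_sqrt (hl i).le]; ring
    simp_rw [this]
    rw [Finset.sum_add_distrib, Finset.sum_sub_distrib, ← Finset.mul_sum]
    simp
  rw [h1, hsum]
  have key : k * g * g ≤ (∑ i, Real.sqrt (lam i)) * g := mul_le_mul_of_nonneg_right hamgm hgpos.le
  have e : (1 / k : ℝ) * (a * ∑ i, lam i) - (a * g ^ 2 + a / k *
      (∑ i, lam i - 2 * g * ∑ i, Real.sqrt (lam i) + k * g ^ 2))
      = 2 * a / k * ((∑ i, Real.sqrt (lam i)) * g - k * g * g) := by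
    field_simp; ring
  have : 0 ≤ 2 * a / k * ((∑ i, Real.sqrt (lam i)) * g - k * g * g) :=
    mul_nonneg (by positivity) (by linarith)
  linarith

/-- **Quantitative Gårding inequality for the k-Hessian operator** (Statement 1).
If `λ(A), λ(B) ∈ Γ_k` and `S_k(tA + B) = S_k(A)·∏ (t + λ_i)` for all `t`, then each
`λ_i > 0` and `(1/k)·(d/dt)|_{t=0} S_k(A + tB) ≥ S_k(A)^{(k−1)/k} S_k(B)^{1/k}
+ (S_k(A)/k)·Σ (√λ_i − (S_k(B)/S_k(A))^{1/(2k)})²`. -/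
theorem quantitative_garding_kHessian (n k : ℕ) (hn : 2 ≤ n) (hk1 : 1 ≤ k) (hkn : k ≤ n)
    (A B : Matrix (Fin n) (Fin n) ℝ) (hA : A.IsHermitian) (hB : B.IsHermitian)
    (hAG : hA.eigenvalues ∈ GardingCone n k) (hBG : hB.eigenvalues ∈ GardingCone n k)
    (lam : Fin k → ℝ)
    (hfac : ∀ t : ℝ, SkM k (t • A + B) = SkM k A * ∏ i, (t + lam i)) :
    (∀ i, 0 < lam i) ∧
    SkM k A ^ (((k : ℝ) - 1) / k) * SkM k B ^ ((1 : ℝ) / k)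
        + (SkM k A / k) *
          ∑ i, (Real.sqrt (lam i) - (SkM k B / SkM k A) ^ ((1 : ℝ) / (2 * k))) ^ 2
      ≤ (1 / k : ℝ) * deriv (fun t : ℝ => SkM k (A + t • B)) 0 := by
  have hS : ∀ M : Matrix (Fin n) (Fin n) ℝ, M.IsHermitian → SkM k M = pk k M := by
    intro M hM
    rw [SkM, dif_pos hM, SkM_eq_pk k hkn M hM]
  have hcone : ∀ M : Matrix (Fin n) (Fin n) ℝ, ∀ hM : M.IsHermitian,
      hM.eigenvalues ∈ GardingCone n k → ∀ j, j ≤ k → 0 < pk j M := by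
    intro M hM hG j hj
    rcases Nat.eq_zero_or_pos j with rfl | hj0
    · rw [pk_zero]; exact one_pos
    · rw [← SkM_eq_pk j (hj.trans hkn) M hM]
      exact hG j hj0 hj
  have hsm : ∀ (c : ℝ) (M : Matrix (Fin n) (Fin n) ℝ), M.IsHermitian → (c • M).IsHermitian :=
    fun c M hM => hM.smul (by simp [IsSelfAdjoint])
  have hApos := hcone A hA hAG
  have hBpos := hcone B hB hBG
  have hAC := inC_of_garding k hkn A hA hApos
  have hBC := inC_of_garding k hkn B hB hBpos
  have hl : ∀ i, 0 < lam i := by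
    intro i
    by_contra hcon
    have h1 := garding_ne hkn hAC hBC (-lam i) (by linarith)
    rw [← hS _ ((hsm _ _ hA).add hB), hfac] at h1
    apply h1
    rw [Finset.prod_eq_zero (Finset.mem_univ i) (by ring), mul_zero]
  refine ⟨hl, ?_⟩
  have hfun : (fun t : ℝ => SkM k (A + t • B)) = fun t => SkM k A * ∏ i, (1 + t * lam i) := by
    funext t
    by_cases ht : t = 0
    · simp [ht]
    · have e : A + t • B = t • (t⁻¹ • A + B) := by
        rw [smul_add, smul_smul, mul_inv_cancel₀ ht, one_smul]
      have hH := (hsm t⁻¹ A hA).add hB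
      rw [e, hS _ (hsm _ _ hH), pk_smul, ← hS _ hH, hfac, mul_left_comm]
      congr 1
      have : t ^ k = ∏ _i : Fin k, t := by simp
      rw [this, ← Finset.prod_mul_distrib]
      refine Finset.prod_congr rfl fun i _ => ?_
      rw [mul_add, mul_inv_cancel₀ ht]
  have hder : HasDerivAt (fun t : ℝ => SkM k A * ∏ i, (1 + t * lam i))
      (SkM k A * ∑ i, lam i) 0 := by
    have h1 : ∀ i ∈ (Finset.univ : Finset (Fin k)),
        HasDerivAt (fun t : ℝ => 1 + t * lam i) (lam i) 0 := by
      intro i _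
      simpa using ((hasDerivAt_id (0 : ℝ)).mul_const (lam i)).const_add 1
    have h2 := (HasDerivAt.fun_finsetProd h1).const_mul (SkM k A)
    simpa using h2
  rw [hfun, hder.deriv]
  refine final_ineq k hk1 _ _ ?_ lam hl ?_
  · rw [hS A hA]; exact hApos k le_rfl
  · simpa using hfac 0
end

section
/- Let n ≥ 2, 2 ≤ k ≤ n, and let A, B be real symmetric n×n matrices with λ(A) ∈ Γ_k and λ(B) ∈ Γ_k. If (1/k)·(d/dt)|_{t=0} S_k(A + tB) = S_k(A)^{(k−1)/k} · S_k(B)^{1/k}, then there exists a positive real number μ such that B = μ·A. -/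
open Polynomial in
lemma laguerre_prod (m : Multiset ℝ) (x : ℝ) :
    (m.map (fun a => X - C a)).prod.eval x * (derivative (derivative (m.map (fun a => X - C a)).prod)).eval x
      ≤ (derivative (m.map (fun a => X - C a)).prod).eval x ^ 2 := by
  induction m using Multiset.induction with
  | empty => simp
  | cons a m ih =>
    simp only [Multiset.map_cons, Multiset.prod_cons, derivative_mul, derivative_add, derivative_sub,
      derivative_X, derivative_C, sub_zero, one_mul, eval_mul, eval_add, eval_sub, eval_X, eval_C]
    set p := eval x (Multiset.map (fun a => X - C a) m).prod
    set p1 := eval x (derivative (Multiset.map (fun a => X - C a) m).prod)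
    set p2 := eval x (derivative (derivative (Multiset.map (fun a => X - C a) m).prod))
    nlinarith [sq_nonneg p, mul_le_mul_of_nonneg_left ih (sq_nonneg (x - a))]

open Polynomial in
lemma laguerre_splits (f : ℝ[X]) (hf : f.Splits) (x : ℝ) :
    f.eval x * (derivative (derivative f)).eval x ≤ (derivative f).eval x ^ 2 := by
  rw [hf.eq_prod_roots]
  simp only [derivative_C_mul, eval_mul, eval_C]
  have := mul_le_mul_of_nonneg_left (laguerre_prod f.roots x) (sq_nonneg f.leadingCoeff)
  nlinarith

open Polynomial in
lemma splits_derivative_real (f : ℝ[X]) (hf : f.Splits) : (derivative f).Splits := by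
  rw [splits_iff_card_roots] at *
  have h1 := card_roots_le_derivative f
  have h2 := natDegree_derivative_le f
  have h3 := card_roots' (derivative f)
  rcases Nat.eq_zero_or_pos f.natDegree with h | h
  · rw [natDegree_eq_zero] at h
    obtain ⟨c, rfl⟩ := h
    simp
  · omega

/-- elementary symmetric polynomial over a finset of indices -/
noncomputable def ee {ι : Type*} (j : ℕ) (s : Finset ι) (x : ι → ℝ) : ℝ :=
  ∑ t ∈ Finset.powersetCard j s, ∏ i ∈ t, x i

section sec
variable {ι : Type*} [DecidableEq ι]

lemma ee_zero (s : Finset ι) (x : ι → ℝ) : ee 0 s x = 1 := by simp [ee]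

lemma ee_succ_empty (j : ℕ) (x : ι → ℝ) : ee (j+1) (∅ : Finset ι) x = 0 := by
  rw [ee, Finset.powersetCard_eq_empty.2 (by simp)]; simp

lemma ee_one (s : Finset ι) (x : ι → ℝ) : ee 1 s x = ∑ i ∈ s, x i := by
  simp [ee, Finset.powersetCard_one]

lemma ee_insert (j : ℕ) {s : Finset ι} {i : ι} (hi : i ∉ s) (x : ι → ℝ) :
    ee (j+1) (insert i s) x = ee (j+1) s x + x i * ee j s x := by
  have hd : ∀ t ∈ Finset.powersetCard j s, i ∉ t := fun t ht hit =>
    hi ((Finset.mem_powersetCard.1 ht).1 hit)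
  unfold ee
  rw [Finset.powersetCard_succ_insert hi, Finset.sum_union, Finset.sum_image, Finset.mul_sum]
  · congr 1
    exact Finset.sum_congr rfl fun t ht => Finset.prod_insert (hd t ht)
  · intro a ha b hb hab
    have := congrArg (fun u => Finset.erase u i) hab
    simpa [Finset.erase_insert (hd a ha), Finset.erase_insert (hd b hb)] using this
  · rw [Finset.disjoint_left]
    intro t ht ht'
    obtain ⟨u, hu, rfl⟩ := Finset.mem_image.1 ht'
    exact hi ((Finset.mem_powersetCard.1 ht).1 (Finset.mem_insert_self _ _))

lemma ee_erase (j : ℕ) {s : Finset ι} {i : ι} (hi : i ∈ s) (x : ι → ℝ) :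
    ee (j+1) s x = ee (j+1) (s.erase i) x + x i * ee j (s.erase i) x := by
  conv_lhs => rw [← Finset.insert_erase hi]
  exact ee_insert j (Finset.notMem_erase i s) x

open Polynomial in
lemma ee_coeff (j : ℕ) (s : Finset ι) (x : ι → ℝ) :
    (∏ i ∈ s, (1 + C (x i) * X) : ℝ[X]).coeff j = ee j s x := by
  induction s using Finset.induction generalizing j with
  | empty =>
    cases j with
    | zero => simp [ee_zero]
    | succ j => simp [ee_succ_empty, coeff_one]
  | insert a s ha ih =>
    rw [Finset.prod_insert ha, add_mul, one_mul, coeff_add, ih, mul_assoc, coeff_C_mul]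
    cases j with
    | zero => simp [ee_zero]
    | succ j => rw [coeff_X_mul, ih, ee_insert j ha]

open Polynomial in
lemma ee_newton (m : ℕ) (s : Finset ι) (x : ι → ℝ) :
    ee m s x * ee (m+2) s x ≤ ee (m+1) s x ^ 2 := by
  set f : ℝ[X] := ∏ i ∈ s, (1 + C (x i) * X) with hf
  have hs : f.Splits := by
    apply Splits.prod
    intro i _
    apply Splits.of_natDegree_le_one
    compute_degree
  have hsm : (derivative^[m] f).Splits := by
    clear_value f
    clear hf
    induction m generalizing f with
    | zero => simpa
    | succ m ih => exact ih _ (splits_derivative_real f hs)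
  have key := laguerre_splits _ hsm 0
  rw [← Function.iterate_succ_apply' derivative, ← Function.iterate_succ_apply' derivative] at key
  simp only [← coeff_zero_eq_eval_zero, coeff_iterate_derivative, zero_add, Nat.descFactorial_self,
    nsmul_eq_mul, hf, ee_coeff, Nat.succ_eq_add_one] at key
  have e2 : m + 1 + 1 = m + 2 := rfl
  rw [e2] at key
  have h1 : ((m+2).factorial : ℝ) = (m+2) * ((m+1) * m.factorial) := by
    rw [Nat.factorial_succ, Nat.factorial_succ]; push_cast; ring
  have h2 : ((m+1).factorial : ℝ) = (m+1) * m.factorial := by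
    rw [Nat.factorial_succ]; push_cast; ring
  rw [h1, h2] at key
  have hm : (0:ℝ) < m.factorial := by exact_mod_cast Nat.factorial_pos m
  have k2 : (m + 2 : ℝ) * (ee m s x * ee (m+2) s x) ≤ (m+1) * ee (m+1) s x ^ 2 := by
    have hp : (0:ℝ) < m.factorial ^ 2 * (m+1) := by positivity
    refine le_of_mul_le_mul_left ?_ hp
    nlinarith
  by_contra hlt
  push Not at hlt
  have hm0 : (0:ℝ) ≤ m := Nat.cast_nonneg m
  nlinarith [sq_nonneg (ee (m+1) s x), mul_lt_mul_of_pos_left hlt (by linarith : (0:ℝ) < m + 2)]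

/-- cone -/
def cone (k : ℕ) (s : Finset ι) (x : ι → ℝ) : Prop := ∀ j ≤ k, 0 < ee j s x

lemma cone_mono {k l : ℕ} (h : k ≤ l) {s : Finset ι} {x : ι → ℝ} (hx : cone l s x) : cone k s x :=
  fun j hj => hx j (hj.trans h)

lemma cone_erase (k : ℕ) {s : Finset ι} {i : ι} (hi : i ∈ s) {x : ι → ℝ}
    (hx : cone (k+1) s x) : cone k (s.erase i) x := by
  induction k with
  | zero => intro j hj; obtain rfl := Nat.le_zero.1 hj; simp [ee_zero]
  | succ k ih =>
    have ihk := ih (cone_mono (by omega) hx)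
    intro j hj
    rcases Nat.lt_or_ge j (k+1) with h | h
    · exact ihk j (by omega)
    obtain rfl : j = k + 1 := by omega
    have a1 := hx (k+1) (by omega)
    have a2 := hx (k+2) (by omega)
    rw [ee_erase _ hi] at a1 a2
    have a0 := ihk k le_rfl
    have nw := ee_newton k (s.erase i) x
    set u := ee k (s.erase i) x
    set v := ee (k+1) (s.erase i) x
    set w := ee (k+2) (s.erase i) x
    by_contra hv
    push Not at hv
    have b1 : 0 ≤ (v + x i * u) * (-v) := mul_nonneg a1.le (by linarith)
    have b2 : 0 < u * (w + x i * v) := mul_pos a0 a2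
    nlinarith

lemma ee_sum (j : ℕ) (s : Finset ι) (x : ι → ℝ) :
    ∑ i ∈ s, x i * ee j (s.erase i) x = (j + 1) * ee (j+1) s x := by
  induction s using Finset.induction generalizing j with
  | empty => simp [ee_succ_empty]
  | insert a s ha ih =>
    rw [Finset.sum_insert ha, Finset.erase_insert ha]
    have h1 : ∀ i ∈ s, (insert a s).erase i = insert a (s.erase i) := by
      intro i hi
      rw [Finset.erase_insert_of_ne]
      rintro rfl; exact ha hi
    rw [Finset.sum_congr rfl fun i hi => by rw [h1 i hi]]
    cases j with
    | zero => simp only [ee_zero, ee_insert 0 ha]; simp [ee_one]; ring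
    | succ j =>
      have h2 : ∀ i ∈ s, x i * ee (j+1) (insert a (s.erase i)) x
          = x i * ee (j+1) (s.erase i) x + x a * (x i * ee j (s.erase i) x) := by
        intro i hi
        rw [ee_insert j (fun h => ha (Finset.mem_of_mem_erase h))]; ring
      rw [Finset.sum_congr rfl h2, Finset.sum_add_distrib, ← Finset.mul_sum, ih, ih, ee_insert (j+1) ha]
      push_cast; ring

/-- quotient -/
noncomputable def qq (k : ℕ) (s : Finset ι) (x : ι → ℝ) : ℝ := ee (k+1) s x / ee k s x

lemma qq_formula (k : ℕ) (s : Finset ι) (x : ι → ℝ) (h1 : 0 < ee (k+1) s x)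
    (h2 : ∀ i ∈ s, 0 < ee k (s.erase i) x) :
    (k + 2 : ℝ) * qq (k+1) s x = ∑ i ∈ s, (x i - x i ^ 2 / (x i + qq k (s.erase i) x)) := by
  have h := ee_sum (k+1) s x
  have h' : (k + 2 : ℝ) * qq (k+1) s x = (∑ i ∈ s, x i * ee (k+1) (s.erase i) x) / ee (k+1) s x := by
    rw [h, qq]; push_cast; ring
  rw [h', Finset.sum_div]
  refine Finset.sum_congr rfl fun i hi => ?_
  have hu := h2 i hi
  have hw := h1
  rw [ee_erase k hi] at hw ⊢
  rw [qq]
  set u := ee k (s.erase i) x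
  set v := ee (k+1) (s.erase i) x
  have e : x i + v / u = (v + x i * u) / u := by field_simp; ring
  rw [e]
  field_simp
  ring

lemma sq_div_aux (x y u v w : ℝ) (hu : 0 < u) (hv : 0 < v) (hw : u + v ≤ w) :
    (x + y) ^ 2 / w ≤ x ^ 2 / u + y ^ 2 / v := by
  calc (x + y) ^ 2 / w ≤ (x + y) ^ 2 / (u + v) := by gcongr
    _ ≤ x ^ 2 / u + y ^ 2 / v := by
      rw [div_add_div _ _ hu.ne' hv.ne', div_le_div_iff₀ (by positivity) (by positivity)]
      nlinarith [sq_nonneg (x * v - y * u)]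

lemma superadd (k : ℕ) (s : Finset ι) (x y : ι → ℝ) (hx : cone (k+1) s x) (hy : cone (k+1) s y) :
    cone (k+1) s (x + y) ∧ qq k s x + qq k s y ≤ qq k s (x + y) := by
  induction k generalizing s with
  | zero =>
    have h1 := hx 1 le_rfl
    have h2 := hy 1 le_rfl
    have h3 : ee 1 s (x + y) = ee 1 s x + ee 1 s y := by simp [ee_one, Finset.sum_add_distrib]
    refine ⟨?_, by simp [qq, ee_zero, h3]⟩
    intro j hj
    interval_cases j
    · simp [ee_zero]
    · rw [h3]; linarith
  | succ k ih =>
    obtain ⟨c1, -⟩ := ih s (cone_mono (by omega) hx) (cone_mono (by omega) hy)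
    have he := fun i (hi : i ∈ s) => ih (s.erase i) (cone_erase (k+1) hi hx) (cone_erase (k+1) hi hy)
    have fx := qq_formula k s x (hx _ (by omega)) fun i hi => cone_erase (k+1) hi hx _ (by omega)
    have fy := qq_formula k s y (hy _ (by omega)) fun i hi => cone_erase (k+1) hi hy _ (by omega)
    have fxy := qq_formula k s (x+y) (c1 _ (by omega)) fun i hi => (he i hi).1 _ (by omega)
    have pos : ∀ z : ι → ℝ, cone (k+2) s z → ∀ i ∈ s, 0 < z i + qq k (s.erase i) z := by
      intro z hz i hi
      have hu := cone_erase (k+1) hi hz k (by omega)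
      have hw := hz (k+1) (by omega)
      rw [ee_erase k hi] at hw
      have : z i + qq k (s.erase i) z
        = (ee (k+1) (s.erase i) z + z i * ee k (s.erase i) z) / ee k (s.erase i) z := by
        rw [qq]; field_simp; ring
      rw [this]; positivity
    have hq : qq (k+1) s x + qq (k+1) s y ≤ qq (k+1) s (x + y) := by
      have hk : (0:ℝ) < k + 2 := by positivity
      refine le_of_mul_le_mul_left ?_ hk
      rw [mul_add, fx, fy, fxy, ← Finset.sum_add_distrib]
      refine Finset.sum_le_sum fun i hi => ?_
      have := sq_div_aux (x i) (y i) _ _ (x i + y i + qq k (s.erase i) (x+y)) (pos x hx i hi)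
        (pos y hy i hi) (by linarith [(he i hi).2])
      simp only [Pi.add_apply]
      linarith
    refine ⟨?_, hq⟩
    intro j hj
    rcases Nat.lt_or_ge j (k+2) with h | h
    · exact c1 j (by omega)
    obtain rfl : j = k + 2 := by omega
    have p1 : 0 < qq (k+1) s x := div_pos (hx _ (by omega)) (hx _ (by omega))
    have p2 : 0 < qq (k+1) s y := div_pos (hy _ (by omega)) (hy _ (by omega))
    have p3 : 0 < qq (k+1) s (x+y) := by linarith
    have p4 : 0 < ee (k+1) s (x+y) := c1 _ le_rfl
    rw [qq, div_pos_iff_of_pos_right p4] at p3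
    exact p3

lemma ee_smul (j : ℕ) (s : Finset ι) (c : ℝ) (x : ι → ℝ) : ee j s (c • x) = c ^ j * ee j s x := by
  rw [ee, ee, Finset.mul_sum]
  refine Finset.sum_congr rfl fun t ht => ?_
  simp [Finset.prod_mul_distrib, (Finset.mem_powersetCard.1 ht).2]

lemma cone_smul {k : ℕ} {s : Finset ι} {c : ℝ} (hc : 0 < c) {x : ι → ℝ} (hx : cone k s x) :
    cone k s (c • x) := fun j hj => by rw [ee_smul]; have := hx j hj; positivity

lemma qq_smul (k : ℕ) (s : Finset ι) {c : ℝ} (hc : 0 < c) (x : ι → ℝ) :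
    qq k s (c • x) = c * qq k s x := by
  rw [qq, qq, ee_smul, ee_smul, pow_succ, mul_assoc, mul_div_mul_left _ _ (by positivity), mul_div_assoc]
end sec

lemma ee_perm {n : ℕ} (j : ℕ) (σ : Equiv.Perm (Fin n)) (x : Fin n → ℝ) :
    ee j Finset.univ (x ∘ σ) = ee j Finset.univ x := by
  unfold ee
  conv_rhs => rw [← Finset.map_univ_equiv σ, Finset.powersetCard_map, Finset.sum_map]
  simp

lemma ds_mono {n k : ℕ} (P : Matrix (Fin n) (Fin n) ℝ) (hP : P ∈ doublyStochastic ℝ (Fin n))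
    (x : Fin n → ℝ) (hx : cone (k+1) Finset.univ x) :
    cone (k+1) Finset.univ (P.mulVec x) ∧ qq k Finset.univ x ≤ qq k Finset.univ (P.mulVec x) := by
  rw [← SetLike.mem_coe, doublyStochastic_eq_convexHull_permMatrix] at hP
  have hconv : Convex ℝ {M : Matrix (Fin n) (Fin n) ℝ | cone (k+1) Finset.univ (M.mulVec x) ∧
      qq k Finset.univ x ≤ qq k Finset.univ (M.mulVec x)} := by
    rw [convex_iff_forall_pos]
    rintro M ⟨hM1, hM2⟩ N ⟨hN1, hN2⟩ a b ha hb hab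
    have h := superadd k Finset.univ (a • M.mulVec x) (b • N.mulVec x) (cone_smul ha hM1) (cone_smul hb hN1)
    rw [qq_smul _ _ ha, qq_smul _ _ hb] at h
    simp only [Set.mem_ofPred_eq, Matrix.add_mulVec, Matrix.smul_mulVec]
    refine ⟨h.1, le_trans ?_ h.2⟩
    calc qq k Finset.univ x = a * qq k Finset.univ x + b * qq k Finset.univ x := by
          rw [← add_mul, hab, one_mul]
      _ ≤ _ := by gcongr
  refine convexHull_min ?_ hconv hP
  rintro _ ⟨σ, rfl⟩
  simp only [Set.mem_ofPred_eq, Matrix.permMatrix_mulVec]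
  refine ⟨fun j hj => by rw [ee_perm]; exact hx j hj, by simp only [qq, ee_perm]; exact le_rfl⟩

lemma spec' {n : ℕ} {A : Matrix (Fin n) (Fin n) ℝ} (hA : A.IsHermitian) :
    ∃ V : Matrix (Fin n) (Fin n) ℝ, V * V.transpose = 1 ∧ V.transpose * V = 1 ∧
      A = V * Matrix.diagonal hA.eigenvalues * V.transpose := by
  have h := hA.spectral_theorem
  rw [Unitary.conjStarAlgAut_apply] at h
  refine ⟨hA.eigenvectorUnitary, ?_, ?_, ?_⟩
  · have := Unitary.coe_mul_star_self hA.eigenvectorUnitary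
    rwa [Unitary.coe_star, Matrix.star_eq_conjTranspose,
      Matrix.conjTranspose_eq_transpose_of_trivial] at this
  · have := Unitary.coe_star_mul_self hA.eigenvectorUnitary
    rwa [Matrix.star_eq_conjTranspose,
      Matrix.conjTranspose_eq_transpose_of_trivial] at this
  · rw [Matrix.star_eq_conjTranspose, Matrix.conjTranspose_eq_transpose_of_trivial] at h
    exact h

lemma diag_ds {n : ℕ} {A : Matrix (Fin n) (Fin n) ℝ} (hA : A.IsHermitian)
    (U : Matrix (Fin n) (Fin n) ℝ) (hU : U * U.transpose = 1) (hU' : U.transpose * U = 1) :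
    ∃ P ∈ doublyStochastic ℝ (Fin n), ∀ i, (U.transpose * A * U) i i = P.mulVec hA.eigenvalues i := by
  obtain ⟨V, hV, hV', h⟩ := spec' hA
  set W := U.transpose * V with hW
  have hWt : W.transpose = V.transpose * U := by simp [hW]
  have w1 : W * W.transpose = 1 := by
    rw [hWt, hW]
    calc U.transpose * V * (V.transpose * U) = U.transpose * (V * V.transpose) * U := by
          simp only [Matrix.mul_assoc]
      _ = 1 := by rw [hV, Matrix.mul_one, hU']
  have w2 : W.transpose * W = 1 := by
    rw [hWt, hW]
    calc V.transpose * U * (U.transpose * V) = V.transpose * (U * U.transpose) * V := by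
          simp only [Matrix.mul_assoc]
      _ = 1 := by rw [hU, Matrix.mul_one, hV']
  refine ⟨Matrix.of fun i j => W i j ^ 2, ?_, ?_⟩
  · rw [mem_doublyStochastic_iff_sum]
    refine ⟨fun i j => by simp only [Matrix.of_apply]; positivity, fun i => ?_, fun j => ?_⟩
    · have := congrFun (congrFun w1 i) i
      simpa [Matrix.mul_apply, sq] using this
    · have := congrFun (congrFun w2 j) j
      simpa [Matrix.mul_apply, sq] using this
  · intro i
    have e : U.transpose * A * U = W * Matrix.diagonal hA.eigenvalues * W.transpose := by
      rw [hWt, hW]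
      conv_lhs => rw [h]
      simp only [Matrix.mul_assoc]
    rw [e, Matrix.mul_apply]
    simp only [Matrix.mul_diagonal, Matrix.transpose_apply, Matrix.mulVec, dotProduct, Matrix.of_apply]
    exact Finset.sum_congr rfl fun j _ => by ring

lemma eig_add {n : ℕ} {A B C : Matrix (Fin n) (Fin n) ℝ} (hA : A.IsHermitian) (hB : B.IsHermitian)
    (hC : C.IsHermitian) (t : ℝ) (h : C = A + t • B) :
    ∃ P ∈ doublyStochastic ℝ (Fin n), ∃ Q ∈ doublyStochastic ℝ (Fin n),
      hC.eigenvalues = P.mulVec hA.eigenvalues + t • Q.mulVec hB.eigenvalues := by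
  obtain ⟨U, hU, hU', hh⟩ := spec' hC
  obtain ⟨P, hP, hP'⟩ := diag_ds hA U hU hU'
  obtain ⟨Q, hQ, hQ'⟩ := diag_ds hB U hU hU'
  refine ⟨P, hP, Q, hQ, ?_⟩
  have e : U.transpose * C * U = Matrix.diagonal hC.eigenvalues := by
    conv_lhs => rw [hh]
    calc _ = (U.transpose * U) * Matrix.diagonal hC.eigenvalues * (U.transpose * U) := by
          simp only [Matrix.mul_assoc]
      _ = _ := by rw [hU']; simp
  ext i
  have e1 := congrFun (congrFun e i) i
  have e2 : U.transpose * C * U = U.transpose * A * U + t • (U.transpose * B * U) := by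
    rw [h, Matrix.mul_add, Matrix.add_mul, Matrix.mul_smul, Matrix.smul_mul]
  rw [Matrix.diagonal_apply_eq, e2, Matrix.add_apply, Matrix.smul_apply, hP', hQ'] at e1
  rw [← e1]; rfl

lemma eig_super {n k : ℕ} {A B C : Matrix (Fin n) (Fin n) ℝ} (hA : A.IsHermitian) (hB : B.IsHermitian)
    (hC : C.IsHermitian) (t : ℝ) (ht : 0 < t) (h : C = A + t • B)
    (ha : cone (k+1) Finset.univ hA.eigenvalues) (hb : cone (k+1) Finset.univ hB.eigenvalues) :
    cone (k+1) Finset.univ hC.eigenvalues ∧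
    qq k Finset.univ hA.eigenvalues + t * qq k Finset.univ hB.eigenvalues
      ≤ qq k Finset.univ hC.eigenvalues := by
  obtain ⟨P, hP, Q, hQ, e⟩ := eig_add hA hB hC t h
  obtain ⟨p1, p2⟩ := ds_mono P hP _ ha
  obtain ⟨q1, q2⟩ := ds_mono Q hQ _ hb
  obtain ⟨s1, s2⟩ := superadd k _ _ _ p1 (cone_smul ht q1)
  rw [e]
  refine ⟨s1, le_trans ?_ s2⟩
  rw [qq_smul _ _ ht]
  gcongr

lemma eig_sum {n : ℕ} {A : Matrix (Fin n) (Fin n) ℝ} (hA : A.IsHermitian) :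
    ee 1 Finset.univ hA.eigenvalues = A.trace := by
  rw [ee_one, hA.trace_eq_sum_eigenvalues]; simp

lemma eig_sq {n : ℕ} {A : Matrix (Fin n) (Fin n) ℝ} (hA : A.IsHermitian) :
    ∑ i, hA.eigenvalues i ^ 2 = ∑ i, ∑ j, A i j ^ 2 := by
  obtain ⟨V, hV, hV', h⟩ := spec' hA
  have h1 : (A * A.transpose).trace = ∑ i, ∑ j, A i j ^ 2 := by
    simp [Matrix.trace, Matrix.mul_apply, sq]
  rw [← h1]
  conv_rhs => rw [h]
  simp only [Matrix.transpose_mul, Matrix.transpose_transpose, Matrix.diagonal_transpose]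
  have : V * Matrix.diagonal hA.eigenvalues * V.transpose *
      (V * (Matrix.diagonal hA.eigenvalues * V.transpose)) =
      V * (Matrix.diagonal hA.eigenvalues * Matrix.diagonal hA.eigenvalues * V.transpose) := by
    calc _ = V * Matrix.diagonal hA.eigenvalues * (V.transpose * V) *
        (Matrix.diagonal hA.eigenvalues * V.transpose) := by simp only [Matrix.mul_assoc]
      _ = _ := by rw [hV']; simp only [Matrix.mul_assoc, Matrix.one_mul]
  rw [this, Matrix.trace_mul_comm, Matrix.mul_assoc, hV']
  simp [Matrix.trace, sq]

lemma ee_two {n : ℕ} (x : Fin n → ℝ) :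
    2 * ee 2 Finset.univ x = (ee 1 Finset.univ x) ^ 2 - ∑ i, x i ^ 2 := by
  have h := ee_sum 1 Finset.univ x
  have h2 : ∀ i : Fin n, ee 1 (Finset.univ.erase i) x = ee 1 Finset.univ x - x i := by
    intro i
    have := ee_erase 0 (Finset.mem_univ i) x
    simp only [ee_zero, zero_add] at this
    linarith
  simp only [h2] at h
  rw [show (((1:ℕ):ℝ) + 1) = 2 by norm_num] at h
  rw [← h, sq (ee 1 Finset.univ x)]
  conv_rhs => enter [1, 1]; rw [ee_one]
  rw [Finset.sum_mul, ← Finset.sum_sub_distrib]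
  exact Finset.sum_congr rfl fun i _ => by ring

lemma eig_q1 {n : ℕ} {A : Matrix (Fin n) (Fin n) ℝ} (hA : A.IsHermitian) (h : 0 < A.trace) :
    qq 1 Finset.univ hA.eigenvalues = (A.trace - (∑ i, ∑ j, A i j ^ 2) / A.trace) / 2 := by
  have h2 := ee_two hA.eigenvalues
  rw [eig_sq, eig_sum] at h2
  rw [qq, eig_sum]
  field_simp
  linarith

lemma prod_qq {n : ℕ} (k : ℕ) (x : Fin n → ℝ) (hx : cone k Finset.univ x) :
    ∏ j ∈ Finset.range k, qq j Finset.univ x = ee k Finset.univ x := by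
  induction k with
  | zero => simp [ee_zero]
  | succ k ih =>
    rw [Finset.prod_range_succ, ih (cone_mono (by omega) hx), qq]
    have := hx k (by omega)
    field_simp

lemma deriv_nonneg_aux (h : ℝ → ℝ) (d : ℝ) (hd : HasDerivAt h d 0) (h0 : h 0 = 0)
    (hp : ∀ t, 0 < t → 0 ≤ h t) : 0 ≤ d := by
  have h1 : Filter.Tendsto (slope h 0) (nhdsWithin 0 (Set.Ioi 0)) (nhds d) :=
    (hasDerivWithinAt_iff_tendsto_slope' (by simp)).1 (hd.hasDerivWithinAt (s := Set.Ioi 0))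
  refine ge_of_tendsto h1 ?_
  filter_upwards [self_mem_nhdsWithin] with t ht
  have ht : 0 < t := ht
  rw [slope_def_field, h0]
  simp only [sub_zero]
  exact div_nonneg (hp t ht) ht.le

lemma amgm_aux (k : ℕ) (hk : 0 < k) (c : ℕ → ℝ) (hc : ∀ j ∈ Finset.range k, 0 < c j) :
    k * (∏ j ∈ Finset.range k, c j) ^ ((1:ℝ) / k) ≤ ∑ j ∈ Finset.range k, c j := by
  have h := Real.geom_mean_le_arith_mean (Finset.range k) (fun _ => 1) c (fun _ _ => zero_le_one)
    (by simpa using hk) (fun j hj => (hc j hj).le)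
  simp only [Real.rpow_one, one_mul, Finset.sum_const, Finset.card_range, nsmul_eq_mul, mul_one] at h
  have hk' : (0:ℝ) < k := by exact_mod_cast hk
  rw [le_div_iff₀ hk'] at h
  rw [one_div]; linarith

lemma SkM_eq {n : ℕ} (k : ℕ) {A : Matrix (Fin n) (Fin n) ℝ} (hA : A.IsHermitian) :
    SkM k A = ee k Finset.univ hA.eigenvalues := by
  rw [SkM, dif_pos hA]; rfl

/-- **Equality case of the Gårding inequality for the k-Hessian operator** (Statement 2).
For `2 ≤ k ≤ n` and `λ(A), λ(B) ∈ Γ_k`, equality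
`(1/k)·(d/dt)|_{t=0} S_k(A + tB) = S_k(A)^{(k−1)/k}·S_k(B)^{1/k}` forces `B = μ·A`
for some `μ > 0`. -/
theorem garding_equality_case (n k : ℕ) (hn : 2 ≤ n) (hk2 : 2 ≤ k) (hkn : k ≤ n)
    (A B : Matrix (Fin n) (Fin n) ℝ) (hA : A.IsHermitian) (hB : B.IsHermitian)
    (hAG : hA.eigenvalues ∈ GardingCone n k) (hBG : hB.eigenvalues ∈ GardingCone n k)
    (heq : (1 / k : ℝ) * deriv (fun t : ℝ => SkM k (A + t • B)) 0
      = SkM k A ^ (((k : ℝ) - 1) / k) * SkM k B ^ ((1 : ℝ) / k)) :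
    ∃ mu : ℝ, 0 < mu ∧ B = mu • A := by
  have toCone : ∀ x : Fin n → ℝ, x ∈ GardingCone n k → cone k Finset.univ x := by
    intro x hx j hj
    rcases Nat.eq_zero_or_pos j with rfl | h
    · simp [ee_zero]
    · exact hx j h hj
  have ha := toCone _ hAG
  have hb := toCone _ hBG
  clear toCone
  have hkpos : (0:ℝ) < k := by exact_mod_cast (by omega : 0 < k)
  have hC : ∀ t : ℝ, (A + t • B).IsHermitian := fun t => hA.add (by
    rw [Matrix.IsHermitian, Matrix.conjTranspose_smul, hB.eq]; simp)
  have FA : SkM k A = ee k Finset.univ hA.eigenvalues := SkM_eq k hA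
  have FB : SkM k B = ee k Finset.univ hB.eigenvalues := SkM_eq k hB
  have pFA : 0 < SkM k A := FA ▸ ha k le_rfl
  have pFB : 0 < SkM k B := FB ▸ hb k le_rfl
  set F : ℝ → ℝ := fun t => SkM k (A + t • B) with hF
  have F0 : F 0 = SkM k A := by simp [hF]
  have hdiff : DifferentiableAt ℝ F 0 := by
    by_contra hnd
    rw [deriv_zero_of_not_differentiableAt hnd, mul_zero] at heq
    have : 0 < SkM k A ^ (((k : ℝ) - 1) / k) * SkM k B ^ ((1 : ℝ) / k) := by positivity
    linarith
  have hFd := hdiff.hasDerivAt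
  set d := deriv F 0 with hd
  -- quotients
  set qa : ℕ → ℝ := fun j => qq j Finset.univ hA.eigenvalues with hqa
  set qb : ℕ → ℝ := fun j => qq j Finset.univ hB.eigenvalues with hqb
  have pqa : ∀ j ∈ Finset.range k, 0 < qa j := fun j hj => by
    have := Finset.mem_range.1 hj
    exact div_pos (ha _ (by omega)) (ha _ (by omega))
  have pqb : ∀ j ∈ Finset.range k, 0 < qb j := fun j hj => by
    have := Finset.mem_range.1 hj
    exact div_pos (hb _ (by omega)) (hb _ (by omega))
  have prA : ∏ j ∈ Finset.range k, qa j = SkM k A := by rw [FA]; exact prod_qq k _ ha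
  have prB : ∏ j ∈ Finset.range k, qb j = SkM k B := by rw [FB]; exact prod_qq k _ hb
  have pSa : 0 < A.trace := by rw [← eig_sum hA]; exact ha 1 (by omega)
  have pSb : 0 < B.trace := by rw [← eig_sum hB]; exact hb 1 (by omega)
  have qa1 := eig_q1 hA pSa
  have qb1 := eig_q1 hB pSb
  have trC : ∀ t : ℝ, (A + t • B).trace = A.trace + t * B.trace := by
    intro t; simp [Matrix.trace_add, Matrix.trace_smul]
  have frC : ∀ t : ℝ, ∑ i, ∑ j, (A + t • B) i j ^ 2 = ∑ i, ∑ j, A i j ^ 2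
      + 2 * t * (∑ i, ∑ j, A i j * B i j) + t ^ 2 * ∑ i, ∑ j, B i j ^ 2 := by
    intro t
    simp only [Finset.mul_sum, ← Finset.sum_add_distrib]
    refine Finset.sum_congr rfl fun i _ => Finset.sum_congr rfl fun j _ => ?_
    simp only [Matrix.add_apply, Matrix.smul_apply, smul_eq_mul]; ring
  have frD : ∑ i, ∑ j, (B.trace * A i j - A.trace * B i j) ^ 2 = B.trace ^ 2 * ∑ i, ∑ j, A i j ^ 2
      - 2 * (A.trace * B.trace) * (∑ i, ∑ j, A i j * B i j) + A.trace ^ 2 * ∑ i, ∑ j, B i j ^ 2 := by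
    simp only [Finset.mul_sum, ← Finset.sum_add_distrib, ← Finset.sum_sub_distrib]
    refine Finset.sum_congr rfl fun i _ => Finset.sum_congr rfl fun j _ => ?_
    ring
  have qc1 : ∀ t : ℝ, 0 < t → qq 1 Finset.univ (hC t).eigenvalues = _ := fun t ht =>
    eig_q1 (hC t) (by rw [trC]; positivity)
  simp only [trC, frC] at qc1
  set Sa := A.trace
  set Sb := B.trace
  set Na := ∑ i, ∑ j, A i j ^ 2
  set Nb := ∑ i, ∑ j, B i j ^ 2
  set Nab := ∑ i, ∑ j, A i j * B i j
  set m : ℝ → ℝ := fun t => ((Sa + t * Sb) - (Na + 2 * t * Nab + t ^ 2 * Nb) / (Sa + t * Sb)) / 2 with hm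
  set m' : ℝ := (Sb - (2 * Nab * Sa - Na * Sb) / Sa ^ 2) / 2 with hm'
  have hmd : HasDerivAt m m' 0 := by
    have i1 : HasDerivAt (fun t : ℝ => Sa + t * Sb) Sb 0 := by
      simpa using ((hasDerivAt_id (0:ℝ)).mul_const Sb).const_add Sa
    have i2 : HasDerivAt (fun t : ℝ => Na + 2 * t * Nab + t ^ 2 * Nb) (2 * Nab) 0 := by
      have j1 : HasDerivAt (fun t : ℝ => 2 * t * Nab) (2 * Nab) 0 := by
        simpa using (((hasDerivAt_id (0:ℝ)).const_mul 2).mul_const Nab)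
      have j2 : HasDerivAt (fun t : ℝ => t ^ 2 * Nb) 0 0 := by
        simpa using ((hasDerivAt_pow 2 (0:ℝ)).mul_const Nb)
      convert! (j1.const_add Na).add j2 using 1
      simp
    have i3 := (i1.sub (i2.div i1 (by simpa using pSa.ne'))).div_const 2
    convert! i3 using 1
    simp [hm']
  set δ : ℝ := m' - qb 1 with hδ
  have δeq : 2 * Sa ^ 2 * Sb * δ = ∑ i, ∑ j, (Sb * A i j - Sa * B i j) ^ 2 := by
    rw [frD, hδ, hm']
    simp only [hqb]
    rw [qb1]
    field_simp
    ring
  set g : ℕ → ℝ → ℝ := fun j t => if j = 1 then m t else qa j + t * qb j with hg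
  set g' : ℕ → ℝ := fun j => qb j + if j = 1 then δ else 0 with hg'
  have g0 : ∀ j, g j 0 = qa j := by
    intro j
    by_cases h : j = 1
    · subst h; simp only [hg, hm, hqa, qa1]; simp
    · simp [hg, h]
  have gd : ∀ j ∈ Finset.range k, HasDerivAt (g j) (g' j) 0 := by
    intro j _
    by_cases h : j = 1
    · subst h
      have : g 1 = m := by funext t; simp [hg]
      rw [this]; convert hmd using 1; simp [hg', hδ]
    · have : g j = fun t => qa j + t * qb j := by funext t; simp [hg, h]
      rw [this]
      simpa [hg', h] using ((hasDerivAt_id (0:ℝ)).mul_const (qb j)).const_add (qa j)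
  have hG := HasDerivAt.fun_finsetProd gd
  have hineq : 0 ≤ d - ∑ i ∈ Finset.range k, (∏ j ∈ (Finset.range k).erase i, g j 0) • g' i := by
    refine deriv_nonneg_aux _ _ (hFd.sub hG) ?_ ?_
    · simp only [Pi.sub_apply, F0, g0, prA, sub_self]
    · intro t ht
      have hsup := fun j (hj : j ∈ Finset.range k) => eig_super (k := j) hA hB (hC t) t ht rfl
        (cone_mono (by have := Finset.mem_range.1 hj; omega) ha)
        (cone_mono (by have := Finset.mem_range.1 hj; omega) hb)
      have hcone : cone k Finset.univ (hC t).eigenvalues := by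
        have := (hsup (k-1) (by simp; omega)).1
        rwa [Nat.sub_add_cancel (by omega)] at this
      have hFt : F t = ∏ j ∈ Finset.range k, qq j Finset.univ (hC t).eigenvalues := by
        rw [prod_qq k _ hcone]; exact SkM_eq k (hC t)
      simp only [Pi.sub_apply]
      rw [hFt, sub_nonneg]
      refine Finset.prod_le_prod ?_ ?_
      · intro j hj
        by_cases h : j = 1
        · subst h
          have e : g 1 t = qq 1 Finset.univ (hC t).eigenvalues := by rw [qc1 t ht]; simp [hg, hm]
          rw [e]
          have := (hsup 1 hj).2
          have p1 := pqa 1 hj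
          have p2 := pqb 1 hj
          have : 0 < qa 1 + t * qb 1 := by positivity
          linarith
        · have p1 := pqa j hj
          have p2 := pqb j hj
          simp only [hg, h, if_false]; positivity
      · intro j hj
        by_cases h : j = 1
        · subst h
          have e : g 1 t = qq 1 Finset.univ (hC t).eigenvalues := by rw [qc1 t ht]; simp [hg, hm]
          rw [e]
        · simp only [hg, h, if_false]; exact (hsup j hj).2
  simp only [g0, smul_eq_mul] at hineq
  have hsum : ∑ i ∈ Finset.range k, (∏ j ∈ (Finset.range k).erase i, qa j) * g' i
      = SkM k A * (∑ j ∈ Finset.range k, qb j / qa j + δ / qa 1) := by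
    have e1 : ∀ i ∈ Finset.range k, (∏ j ∈ (Finset.range k).erase i, qa j) * g' i
        = SkM k A * (qb i / qa i + if i = 1 then δ / qa 1 else 0) := by
      intro i hi
      have hp := pqa i hi
      rw [← prA, ← Finset.mul_prod_erase _ _ hi]
      by_cases h : i = 1
      · subst h; simp only [hg', if_true]; field_simp
      · simp only [hg', h, if_false]; field_simp; try ring
    rw [Finset.sum_congr rfl e1, ← Finset.mul_sum, Finset.sum_add_distrib, Finset.sum_ite_eq',
      if_pos (Finset.mem_range.2 (by omega))]
  rw [hsum] at hineq
  have ham := amgm_aux k (by omega) (fun j => qb j / qa j) fun j hj => div_pos (pqb j hj) (pqa j hj)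
  rw [Finset.prod_div_distrib, prA, prB] at ham
  have hd2 : d = SkM k A * (k * (SkM k B / SkM k A) ^ ((1:ℝ) / k)) := by
    have e1 : SkM k A ^ (((k : ℝ) - 1) / k) = SkM k A / SkM k A ^ ((1:ℝ) / k) := by
      rw [sub_div, div_self hkpos.ne', Real.rpow_sub pFA, Real.rpow_one]
    rw [e1] at heq
    rw [Real.div_rpow pFB.le pFA.le]
    have e2 : d = k * ((1 / k) * d) := by field_simp
    rw [e2, heq]; ring
  have hδ0 : δ ≤ 0 := by
    have p1 := pqa 1 (Finset.mem_range.2 (by omega))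
    by_contra hpos
    push Not at hpos
    have h3 : 0 < δ / qa 1 := by positivity
    have h4 : SkM k A * (k * (SkM k B / SkM k A) ^ ((1:ℝ) / k)) <
        SkM k A * (∑ j ∈ Finset.range k, qb j / qa j + δ / qa 1) :=
      mul_lt_mul_of_pos_left (by linarith) pFA
    linarith
  have hz : ∑ i, ∑ j, (Sb * A i j - Sa * B i j) ^ 2 = 0 := by
    refine le_antisymm ?_ (by positivity)
    rw [← δeq]
    exact mul_nonpos_of_nonneg_of_nonpos (by positivity) hδ0
  refine ⟨Sb / Sa, by positivity, ?_⟩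
  ext i j
  have h1 := (Finset.sum_eq_zero_iff_of_nonneg (fun i _ => by positivity)).1 hz i (Finset.mem_univ i)
  have h2 := (Finset.sum_eq_zero_iff_of_nonneg (fun i _ => by positivity)).1 h1 j (Finset.mem_univ j)
  have h3 : Sb * A i j - Sa * B i j = 0 := by simpa using h2
  rw [Matrix.smul_apply, smul_eq_mul]
  field_simp
  linarith
end

section
/- Let Ω be a bounded open convex domain in ℝ^n (n ≥ 2) and let λ > 0. Let w : closure(Ω) → ℝ be continuous, convex, smooth (C^∞) in Ω, with w = 0 on ∂Ω, w < 0 and strictly convex in Ω, and satisfying det D²w = λⁿ·|w|ⁿ pointwise in Ω. Let u : closure(Ω) → ℝ be continuous, C⁵ and strictly convex in Ω, with u = 0 on ∂Ω, and suppose ∫_Ω (det D²u)^{1/n} |w|^{n−1} dx < ∞. Then λ · ∫_Ω |u|·|w|ⁿ dx ≥ ∫_Ω (det D²u)^{1/n} |w|ⁿ dx (reverse Aleksandrov estimate). -/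
/-- The Hessian matrix `D²f(x)` of `f : ℝⁿ → ℝ` at `x`, with entries the second partial
derivatives in the standard coordinate directions. -/
noncomputable def hessianMat (n : ℕ) (f : EuclideanSpace ℝ (Fin n) → ℝ)
    (x : EuclideanSpace ℝ (Fin n)) : Matrix (Fin n) (Fin n) ℝ :=
  Matrix.of fun i j =>
    fderiv ℝ (fun y => fderiv ℝ f y (EuclideanSpace.single i (1 : ℝ))) x
      (EuclideanSpace.single j (1 : ℝ))

open scoped MatrixOrder in
theorem ra_trace_det {n : ℕ} (hn : 0 < n) {A B : Matrix (Fin n) (Fin n) ℝ} (hA : A.PosSemidef)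
    (hB : B.PosSemidef) : n * (A.det * B.det) ^ ((1:ℝ)/n) ≤ (A * B).trace := by
  obtain ⟨C, hC⟩ := CStarAlgebra.nonneg_iff_eq_star_mul_self.mp hA.nonneg
  have hM := hB.mul_mul_conjTranspose_same C
  rw [Matrix.star_eq_conjTranspose] at hC
  have h1 : (A * B).trace = (C * B * C.conjTranspose).trace := by
    rw [hC, Matrix.trace_mul_comm (C*B), Matrix.mul_assoc]
  have h2 : A.det * B.det = (C * B * C.conjTranspose).det := by
    rw [hC]; simp only [Matrix.det_mul]; ring
  rw [h1, h2, hM.isHermitian.det_eq_prod_eigenvalues, hM.isHermitian.trace_eq_sum_eigenvalues]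
  have h3 := Real.geom_mean_le_arith_mean (Finset.univ : Finset (Fin n)) (fun _ => (1:ℝ))
    hM.isHermitian.eigenvalues (by simp) (by simpa using hn) (fun i _ => hM.eigenvalues_nonneg i)
  simp only [Real.rpow_one, Finset.sum_const, Finset.card_univ, Fintype.card_fin, one_mul,
    nsmul_eq_mul, mul_one] at h3
  have hn' : (0:ℝ) < n := by exact_mod_cast hn
  rw [le_div_iff₀ hn'] at h3
  simp only [RCLike.ofReal_real_eq_id, id, one_div]
  linarith

theorem ra_adj_psd {n : ℕ} {A : Matrix (Fin n) (Fin n) ℝ} (hA : A.PosSemidef) (hd : 0 < A.det) :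
    A.adjugate.PosSemidef := by
  have : A.adjugate = A.det • A⁻¹ := by
    rw [Matrix.inv_def, smul_smul, Ring.mul_inverse_cancel _ (isUnit_iff_ne_zero.mpr hd.ne'), one_smul]
  rw [this]
  exact hA.inv.smul hd.le

theorem ra_det_deriv {n : ℕ} {E : Type*} [NormedAddCommGroup E] [NormedSpace ℝ E]
    (M : E → Matrix (Fin n) (Fin n) ℝ) (x : E)
    (hM : ∀ i j, DifferentiableAt ℝ (fun y => M y i j) x) (v : E) :
    DifferentiableAt ℝ (fun y => (M y).det) x ∧
    fderiv ℝ (fun y => (M y).det) x v =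
      ∑ i, ∑ j, (M x).adjugate j i * fderiv ℝ (fun y => M y i j) x v := by
  let D : ContinuousMultilinearMap ℝ (fun _ : Fin n => (Fin n → ℝ)) ℝ :=
    ⟨(Matrix.detRowAlternating (R := ℝ) (n := Fin n)).toMultilinearMap,
      (continuous_id.matrix_det : Continuous fun A : Matrix (Fin n) (Fin n) ℝ => A.det)⟩
  have hD : ∀ A : Matrix (Fin n) (Fin n) ℝ, D A = A.det := fun A => rfl
  let N : E → Fin n → Fin n → ℝ := fun y i j => M y i j
  have hM' : HasFDerivAt N
      (ContinuousLinearMap.pi fun i => ContinuousLinearMap.pi fun j =>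
        fderiv ℝ (fun y => M y i j) x) x :=
    hasFDerivAt_pi.2 fun i => hasFDerivAt_pi.2 fun j => (hM i j).hasFDerivAt
  have h := (D.hasFDerivAt (N x)).comp x hM'
  have h' : HasFDerivAt (fun y => (M y).det) _ x := h
  refine ⟨h'.differentiableAt, ?_⟩
  rw [h'.fderiv]
  rw [ContinuousLinearMap.comp_apply, ContinuousMultilinearMap.linearDeriv_apply]
  refine Finset.sum_congr rfl fun i _ => ?_
  have : ∀ b : Fin n → ℝ, D (Function.update (N x) i b) = ∑ j, (M x).adjugate j i * b j := by
    intro b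
    change ((M x).updateRow i b).det = _
    rw [← Matrix.cramer_transpose_apply, Matrix.cramer_eq_adjugate_mulVec,
      ← Matrix.adjugate_transpose]
    rfl
  exact this _

theorem ra_adj_contDiffAt {n : ℕ} {E : Type*} [NormedAddCommGroup E] [NormedSpace ℝ E] {k : ℕ∞}
    (M : E → Matrix (Fin n) (Fin n) ℝ) (x : E)
    (hM : ∀ i j, ContDiffAt ℝ k (fun y => M y i j) x) (i j : Fin n) :
    ContDiffAt ℝ k (fun y => (M y).adjugate i j) x := by
  simp only [Matrix.adjugate_apply, Matrix.det_apply']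
  refine ContDiffAt.sum fun σ _ => contDiffAt_const.mul (contDiffAt_prod fun a _ => ?_)
  simp only [Matrix.updateRow_apply]
  split_ifs
  · exact contDiffAt_const
  · exact hM _ _

/-- Piola identity. -/
theorem ra_piola {n : ℕ} {E : Type*} [NormedAddCommGroup E] [NormedSpace ℝ E]
    (M : E → Matrix (Fin n) (Fin n) ℝ) (e : Fin n → E) (x : E)
    (hM : ∀ i j, ContDiffAt ℝ 1 (fun y => M y i j) x)
    (hsymm : ∀ i j k, fderiv ℝ (fun y => M y i j) x (e k) = fderiv ℝ (fun y => M y i k) x (e j))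
    (hdet : (M x).det ≠ 0) (j : Fin n) :
    ∑ i, fderiv ℝ (fun y => (M y).adjugate i j) x (e i) = 0 := by
  have hMd : ∀ i j, DifferentiableAt ℝ (fun y => M y i j) x :=
    fun i j => (hM i j).differentiableAt (by norm_num)
  have hAd : ∀ i j, DifferentiableAt ℝ (fun y => (M y).adjugate i j) x :=
    fun i j => (ra_adj_contDiffAt (k := 1) M x hM i j).differentiableAt (by norm_num)
  set Z : Fin n → ℝ := fun j => ∑ i, fderiv ℝ (fun y => (M y).adjugate i j) x (e i) with hZ
  have key : ∀ i k, ∑ j, (fderiv ℝ (fun y => (M y).adjugate i j) x (e i) * M x j k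
      + (M x).adjugate i j * fderiv ℝ (fun y => M y j k) x (e i)) =
      if i = k then fderiv ℝ (fun y => (M y).det) x (e k) else 0 := by
    intro i k
    have e1 : (fun y => ∑ j, (M y).adjugate i j * M y j k) =
        fun y => if i = k then (M y).det else 0 := by
      funext y
      have := congrFun (congrFun (Matrix.adjugate_mul (M y)) i) k
      rw [Matrix.mul_apply] at this
      rw [this]; simp [Matrix.one_apply]
    have e2 : fderiv ℝ (fun y => ∑ j, (M y).adjugate i j * M y j k) x (e i) =
        ∑ j, (fderiv ℝ (fun y => (M y).adjugate i j) x (e i) * M x j k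
      + (M x).adjugate i j * fderiv ℝ (fun y => M y j k) x (e i)) := by
      rw [fderiv_fun_sum fun j _ => (hAd i j).fun_mul (hMd j k)]
      rw [sum_apply]
      refine Finset.sum_congr rfl fun j _ => ?_
      rw [fderiv_fun_mul (hAd i j) (hMd j k)]
      simp; ring
    rw [← e2, e1]
    by_cases h : i = k
    · subst h; simp
    · simp [h]
  have hZM : Matrix.vecMul Z (M x) = 0 := by
    funext k
    have h1 : ∑ i, ∑ j, (fderiv ℝ (fun y => (M y).adjugate i j) x (e i) * M x j k
      + (M x).adjugate i j * fderiv ℝ (fun y => M y j k) x (e i)) =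
      fderiv ℝ (fun y => (M y).det) x (e k) := by
      simp [key]
    rw [(ra_det_deriv M x hMd (e k)).2] at h1
    simp only [Finset.sum_add_distrib] at h1
    have h2 : ∑ i, ∑ j, (M x).adjugate i j * fderiv ℝ (fun y => M y j k) x (e i) =
       ∑ i, ∑ j, (M x).adjugate j i * fderiv ℝ (fun y => M y i j) x (e k) := by
      rw [Finset.sum_comm]
      refine Finset.sum_congr rfl fun i _ => Finset.sum_congr rfl fun j _ => ?_
      rw [hsymm i j k]
    rw [h2] at h1
    have h3 : ∑ i, ∑ j, fderiv ℝ (fun y => (M y).adjugate i j) x (e i) * M x j k = 0 := by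
      linarith
    rw [Finset.sum_comm] at h3
    simpa [Matrix.vecMul, dotProduct, hZ, Finset.sum_mul] using h3
  have : Z = 0 := Matrix.eq_zero_of_vecMul_eq_zero hdet hZM
  exact congrFun this j

theorem ra_pd_contDiffAt {E : Type*} [NormedAddCommGroup E] [NormedSpace ℝ E] {m k : ℕ∞}
    {f : E → ℝ} {x : E} (hf : ContDiffAt ℝ k f x) (h : m + 1 ≤ k) (v : E) :
    ContDiffAt ℝ m (fun y => fderiv ℝ f y v) x :=
  (hf.fderiv_right (m := m) (by exact_mod_cast h)).clm_apply contDiffAt_const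

theorem ra_snd {E : Type*} [NormedAddCommGroup E] [NormedSpace ℝ E]
    {f : E → ℝ} {x : E} (hf : ContDiffAt ℝ 2 f x) (a b : E) :
    fderiv ℝ (fun y => fderiv ℝ f y a) x b = fderiv ℝ (fderiv ℝ f) x b a := by
  have h : DifferentiableAt ℝ (fderiv ℝ f) x :=
    (hf.fderiv_right (m := 1) (by norm_num)).differentiableAt (by norm_num)
  rw [fderiv_clm_apply h (differentiableAt_const a)]
  simp

theorem ra_symm {E : Type*} [NormedAddCommGroup E] [NormedSpace ℝ E]
    {f : E → ℝ} {x : E} (hf : ContDiffAt ℝ 2 f x) (a b : E) :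
    fderiv ℝ (fun y => fderiv ℝ f y a) x b = fderiv ℝ (fun y => fderiv ℝ f y b) x a := by
  rw [ra_snd hf, ra_snd hf]
  exact (hf.isSymmSndFDerivAt (by simp)).eq b a

theorem ra_snd_nonneg {E : Type*} [NormedAddCommGroup E] [NormedSpace ℝ E]
    {f : E → ℝ} {Ω : Set E} (hΩ : IsOpen Ω) (hf : ContDiffOn ℝ 2 f Ω) (hc : ConvexOn ℝ Ω f)
    {x : E} (hx : x ∈ Ω) (v : E) : 0 ≤ fderiv ℝ (fderiv ℝ f) x v v := by
  have hfA : ∀ y ∈ Ω, ContDiffAt ℝ 2 f y := fun y hy => hf.contDiffAt (hΩ.mem_nhds hy)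
  let L : ℝ →ᵃ[ℝ] E := AffineMap.lineMap x (x + v)
  have hL : ∀ t, L t = x + t • v := by
    intro t; simp [L, AffineMap.lineMap_apply, add_comm]
  have hLd : ∀ t, HasDerivAt (fun t => L t) v t := by
    intro t
    simp only [hL]
    simpa using ((hasDerivAt_id t).smul_const v).const_add x
  have hg := hc.comp_affineMap L
  have hSo : IsOpen (L ⁻¹' Ω) := hΩ.preimage (by
    have : Continuous (fun t => L t) := continuous_iff_continuousAt.2 fun t => (hLd t).continuousAt
    exact this)
  have hgd : ∀ t ∈ L ⁻¹' Ω, HasDerivAt (f ∘ L) (fderiv ℝ f (L t) v) t := fun t ht =>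
    ((hfA _ ht).differentiableAt (by norm_num)).hasFDerivAt.comp_hasDerivAt t (hLd t)
  have hmono := hg.monotoneOn_deriv fun t ht => (hgd t ht).differentiableAt
  have hmono' : MonotoneOn (fun t => fderiv ℝ f (L t) v) (L ⁻¹' Ω) := by
    intro a ha b hb hab
    have := hmono ha hb hab
    rwa [(hgd a ha).deriv, (hgd b hb).deriv] at this
  have h0 : (0:ℝ) ∈ L ⁻¹' Ω := by simpa [hL] using hx
  have hL0 : L 0 = x := by simp [hL]
  have hd : HasDerivAt (fun t => fderiv ℝ f (L t) v) (fderiv ℝ (fderiv ℝ f) x v v) 0 := by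
    have h1 : DifferentiableAt ℝ (fun y => fderiv ℝ f y v) (L 0) := by
      rw [hL0]
      exact (ra_pd_contDiffAt (m := 1) (k := 2) (hfA x hx) (by norm_num) v).differentiableAt
        (by norm_num)
    have := h1.hasFDerivAt.comp_hasDerivAt (0:ℝ) (hLd 0)
    rw [hL0, ra_snd (hfA x hx)] at this
    exact this
  have := hmono'.derivWithin_nonneg (x := 0)
  rwa [derivWithin_of_isOpen hSo h0, hd.deriv] at this

theorem ra_hess_psd {n : ℕ} {f : EuclideanSpace ℝ (Fin n) → ℝ} {Ω : Set (EuclideanSpace ℝ (Fin n))}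
    (hΩ : IsOpen Ω) (hf : ContDiffOn ℝ 2 f Ω) (hc : ConvexOn ℝ Ω f)
    {x : EuclideanSpace ℝ (Fin n)} (hx : x ∈ Ω) : (hessianMat n f x).PosSemidef := by
  have hfx : ContDiffAt ℝ 2 f x := hf.contDiffAt (hΩ.mem_nhds hx)
  refine Matrix.PosSemidef.of_dotProduct_mulVec_nonneg ?_ ?_
  · ext i j
    simp only [Matrix.conjTranspose_apply, hessianMat, Matrix.of_apply, star_trivial]
    exact ra_symm hfx _ _
  · intro v
    have h := ra_snd_nonneg hΩ hf hc hx (∑ i, v i • EuclideanSpace.single i (1:ℝ))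
    simp only [map_sum, map_smul, sum_apply, smul_apply, smul_eq_mul] at h
    simp only [dotProduct, Matrix.mulVec, hessianMat, Matrix.of_apply, star_trivial, ra_snd hfx,
      Finset.mul_sum]
    refine h.trans_eq (Finset.sum_congr rfl fun i _ => ?_)
    rw [Finset.mul_sum]
    exact Finset.sum_congr rfl fun j _ => by ring

theorem ra_cutoff {ε : ℝ} (hε : 0 < ε) : ∃ g ψ : ℝ → ℝ, ContDiff ℝ 1 g ∧ ContDiff ℝ 1 ψ ∧
    (∀ t, HasDerivAt g (ψ t) t) ∧ Monotone ψ ∧ (∀ t, ψ t ≤ 1) ∧ (∀ t ≤ ε, g t = 0) ∧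
    (∀ t ≤ ε, ψ t = 0) ∧ (∀ t, 0 ≤ g t) ∧ (∀ t, t - 2 * ε ≤ g t) := by
  set ψ : ℝ → ℝ := fun t => Real.smoothTransition (t / ε - 1) with hψ
  have hψc : ContDiff ℝ 1 ψ :=
    (Real.smoothTransition.contDiff (n := 1)).comp ((contDiff_id.div_const ε).sub contDiff_const)
  have hψ0 : ∀ t ≤ ε, ψ t = 0 := fun t ht =>
    Real.smoothTransition.zero_of_nonpos (by rw [sub_nonpos, div_le_one hε]; exact ht)
  have hψ1 : ∀ t, 2 * ε ≤ t → ψ t = 1 := fun t ht =>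
    Real.smoothTransition.one_of_one_le (by rw [le_sub_iff_add_le, le_div_iff₀ hε]; linarith)
  have hψn : ∀ t, 0 ≤ ψ t := fun t => Real.smoothTransition.nonneg _
  have hi : ∀ a b, IntervalIntegrable ψ MeasureTheory.volume a b :=
    fun a b => hψc.continuous.intervalIntegrable a b
  have hd : ∀ t, HasDerivAt (fun t => ∫ s in ε..t, ψ s) (ψ t) t := fun t =>
    hψc.continuous.integral_hasStrictDerivAt ε t |>.hasDerivAt
  have hz : ∀ t ≤ ε, ∫ s in ε..t, ψ s = 0 := by
    intro t ht
    rw [intervalIntegral.integral_symm, neg_eq_zero]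
    rw [intervalIntegral.integral_congr (g := fun _ => (0:ℝ))]
    · simp
    · intro s hs
      rw [Set.uIcc_of_le ht] at hs
      exact hψ0 s hs.2
  have hnn : ∀ t, 0 ≤ ∫ s in ε..t, ψ s := by
    intro t
    rcases le_total t ε with h | h
    · rw [hz t h]
    · exact intervalIntegral.integral_nonneg h fun s _ => hψn s
  refine ⟨fun t => ∫ s in ε..t, ψ s, ψ, ?_, hψc, hd, ?_, fun t => Real.smoothTransition.le_one _,
    hz, hψ0, hnn, ?_⟩
  · rw [contDiff_one_iff_deriv]
    refine ⟨fun t => (hd t).differentiableAt, ?_⟩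
    have : deriv (fun t => ∫ s in ε..t, ψ s) = ψ := funext fun t => (hd t).deriv
    rw [this]; exact hψc.continuous
  · intro a b hab
    apply Real.smoothTransition.monotone
    gcongr
  · intro t
    rcases le_total t (2 * ε) with h | h
    · have := hnn t
      simp only; linarith
    · have h1 := intervalIntegral.integral_add_adjacent_intervals (hi ε (2*ε)) (hi (2*ε) t)
      have h2 : ∫ s in (2*ε)..t, ψ s = t - 2 * ε := by
        rw [intervalIntegral.integral_congr (g := fun _ => (1:ℝ))]
        · simp
        · intro s hs
          rw [Set.uIcc_of_le h] at hs
          exact hψ1 s hs.1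
      have := hnn (2 * ε)
      simp only; linarith

theorem ra_integral_fderiv {n : ℕ} {V : EuclideanSpace ℝ (Fin n) → ℝ} (hV : ContDiff ℝ 1 V)
    (hc : HasCompactSupport V) (v : EuclideanSpace ℝ (Fin n)) :
    MeasureTheory.Integrable (fun x => fderiv ℝ V x v) ∧ ∫ x, fderiv ℝ V x v = 0 := by
  have hi : MeasureTheory.Integrable (fun x => fderiv ℝ V x v) :=
    ((hV.continuous_fderiv (by norm_num)).clm_apply continuous_const).integrable_of_hasCompactSupport
      (hc.fderiv_apply ℝ v)
  refine ⟨hi, ?_⟩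
  have := integral_mul_fderiv_eq_neg_fderiv_mul_of_integrable (μ := MeasureTheory.volume)
    (f := fun _ : EuclideanSpace ℝ (Fin n) => (1:ℝ)) (g := V)
    (v := v) (by simp) (by simpa using hi)
    (by simpa using hV.continuous.integrable_of_hasCompactSupport hc)
    (fun x _ => differentiableAt_const _) (fun x _ => hV.differentiable (by norm_num) x)
  simpa using this

theorem ra_nonpos {E : Type*} [NormedAddCommGroup E] [NormedSpace ℝ E] [ProperSpace E]
    [Nontrivial E] {Ω : Set E}
    (hΩo : IsOpen Ω) (hΩb : Bornology.IsBounded Ω) {u : E → ℝ}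
    (hucont : ContinuousOn u (closure Ω)) (hustrict : StrictConvexOn ℝ Ω u)
    (hubd : ∀ x ∈ frontier Ω, u x = 0) {x : E} (hx : x ∈ Ω) : u x ≤ 0 := by
  obtain ⟨z, hz, hmax⟩ := hΩb.isCompact_closure.exists_isMaxOn ⟨x, subset_closure hx⟩ hucont
  by_cases hzΩ : z ∈ Ω
  · exfalso
    obtain ⟨v, hv⟩ := exists_ne (0 : E)
    obtain ⟨r, hr, hball⟩ := Metric.isOpen_iff.1 hΩo z hzΩ
    have hvn : 0 < ‖v‖ := norm_pos_iff.2 hv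
    set d : E := (r / (2 * ‖v‖)) • v with hd
    have hdn : ‖d‖ < r := by
      rw [hd, norm_smul, Real.norm_of_nonneg (by positivity)]
      field_simp; linarith
    have hd0 : d ≠ 0 := smul_ne_zero (by positivity) hv
    have h1 : z + d ∈ Ω := hball (by simpa using hdn)
    have h2 : z - d ∈ Ω := hball (by simpa using hdn)
    have hne : z + d ≠ z - d := by
      intro h
      have h3 : d + d = 0 := by
        have : z + d - (z - d) = 0 := sub_eq_zero.2 h
        rw [← this]; abel
      rw [← two_smul ℝ d] at h3
      exact (smul_ne_zero two_ne_zero hd0) h3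
    have := hustrict.2 h1 h2 hne (show (0:ℝ) < 1/2 by norm_num)
      (show (0:ℝ) < 1/2 by norm_num) (by norm_num)
    have e : (1/2:ℝ) • (z + d) + (1/2:ℝ) • (z - d) = z := by module
    rw [e] at this
    have a1 : u (z + d) ≤ u z := hmax (subset_closure h1)
    have a2 : u (z - d) ≤ u z := hmax (subset_closure h2)
    simp only [smul_eq_mul] at this
    linarith
  · have : z ∈ frontier Ω := by rw [hΩo.frontier_eq]; exact ⟨hz, hzΩ⟩
    have h0 := hubd z this
    have : u x ≤ u z := hmax (subset_closure hx)
    linarith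

/-- Divergence computation. -/
theorem ra_div {n : ℕ} {u w : EuclideanSpace ℝ (Fin n) → ℝ} {x : EuclideanSpace ℝ (Fin n)}
    (hu : ContDiffAt ℝ 3 u x) (hw : ContDiffAt ℝ 3 w x) (hdet : (hessianMat n w x).det ≠ 0)
    {g ψ : ℝ → ℝ} (hg : ∀ t, HasDerivAt g (ψ t) t) (hψ : ContDiff ℝ 1 ψ) :
    ∑ i, fderiv ℝ (fun y => ∑ j, (hessianMat n w y).adjugate i j *
      (g (-w y) * fderiv ℝ u y (EuclideanSpace.single j 1)
        + u y * ψ (-w y) * fderiv ℝ w y (EuclideanSpace.single j 1))) x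
          (EuclideanSpace.single i 1) =
    g (-w x) * ((hessianMat n w x).adjugate * hessianMat n u x).trace
    + u x * ψ (-w x) * ((hessianMat n w x).adjugate * hessianMat n w x).trace
    - u x * deriv ψ (-w x) * ∑ i, ∑ j, fderiv ℝ w x (EuclideanSpace.single i 1) *
        ((hessianMat n w x).adjugate i j * fderiv ℝ w x (EuclideanSpace.single j 1)) := by
  set e : Fin n → EuclideanSpace ℝ (Fin n) := fun i => EuclideanSpace.single i 1 with he
  have hM : ∀ i j, ContDiffAt ℝ 1 (fun y => hessianMat n w y i j) x := fun i j =>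
    ra_pd_contDiffAt (m := 1) (k := 2)
      (ra_pd_contDiffAt (m := 2) (k := 3) hw (by norm_num) (e i)) (by norm_num) (e j)
  have hpiola := ra_piola (fun y => hessianMat n w y) e x hM (fun i j k =>
    ra_symm (ra_pd_contDiffAt (m := 2) (k := 3) hw (by norm_num) (e i)) (e j) (e k)) hdet
  have hWd : ∀ i j, DifferentiableAt ℝ (fun y => (hessianMat n w y).adjugate i j) x :=
    fun i j => (ra_adj_contDiffAt (k := 1) _ x hM i j).differentiableAt (by norm_num)
  have hud : DifferentiableAt ℝ u x := hu.differentiableAt (by norm_num)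
  have hwd : DifferentiableAt ℝ w x := hw.differentiableAt (by norm_num)
  have hu1 : ∀ j, DifferentiableAt ℝ (fun y => fderiv ℝ u y (e j)) x := fun j =>
    (ra_pd_contDiffAt (m := 2) (k := 3) hu (by norm_num) (e j)).differentiableAt (by norm_num)
  have hw1 : ∀ j, DifferentiableAt ℝ (fun y => fderiv ℝ w y (e j)) x := fun j =>
    (ra_pd_contDiffAt (m := 2) (k := 3) hw (by norm_num) (e j)).differentiableAt (by norm_num)
  have hgw : HasFDerivAt (fun y => g (-w y)) (ψ (-w x) • (-fderiv ℝ w x)) x :=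
    (hg (-w x)).comp_hasFDerivAt x hwd.hasFDerivAt.neg
  have hψw : HasFDerivAt (fun y => ψ (-w y)) (deriv ψ (-w x) • (-fderiv ℝ w x)) x :=
    ((hψ.differentiable (by norm_num)) (-w x)).hasDerivAt.comp_hasFDerivAt x hwd.hasFDerivAt.neg
  set b : Fin n → EuclideanSpace ℝ (Fin n) → ℝ := fun j y =>
    g (-w y) * fderiv ℝ u y (e j) + u y * ψ (-w y) * fderiv ℝ w y (e j) with hb
  have hbd := fun j => (hgw.mul (hu1 j).hasFDerivAt).add
    ((hud.hasFDerivAt.mul hψw).mul (hw1 j).hasFDerivAt)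
  have hbd' : ∀ j, DifferentiableAt ℝ (b j) x := fun j => (hbd j).differentiableAt
  have hbv : ∀ i j, fderiv ℝ (b j) x (e i) =
      g (-w x) * hessianMat n u x j i - ψ (-w x) * fderiv ℝ w x (e i) * fderiv ℝ u x (e j)
      + u x * ψ (-w x) * hessianMat n w x j i
      + fderiv ℝ u x (e i) * ψ (-w x) * fderiv ℝ w x (e j)
      - u x * deriv ψ (-w x) * fderiv ℝ w x (e i) * fderiv ℝ w x (e j) := by
    intro i j
    have : HasFDerivAt (b j) _ x := hbd j
    rw [this.fderiv]
    simp only [hessianMat, Matrix.of_apply, add_apply, smul_apply, neg_apply, smul_eq_mul, he,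
      Pi.mul_apply]
    ring
  set W := (hessianMat n w x).adjugate with hW
  have hWs : ∀ i j, W i j = W j i := by
    intro i j
    have hs : (hessianMat n w x).transpose = hessianMat n w x := by
      ext i j
      exact ra_symm (hw.of_le (by norm_num)) _ _
    have : W.transpose = W := by rw [hW, Matrix.adjugate_transpose, hs]
    exact congrFun (congrFun this j) i
  have hterm : ∀ i, fderiv ℝ (fun y => ∑ j, (hessianMat n w y).adjugate i j * b j y) x (e i) =
      ∑ j, (fderiv ℝ (fun y => (hessianMat n w y).adjugate i j) x (e i) * b j x
        + W i j * fderiv ℝ (b j) x (e i)) := by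
    intro i
    rw [fderiv_fun_sum fun j _ => (hWd i j).fun_mul (hbd' j), sum_apply]
    refine Finset.sum_congr rfl fun j _ => ?_
    rw [fderiv_fun_mul (hWd i j) (hbd' j)]
    simp only [add_apply, smul_apply, smul_eq_mul]
    ring
  change ∑ i, fderiv ℝ (fun y => ∑ j, (hessianMat n w y).adjugate i j * b j y) x (e i) = _
  simp only [hterm, Finset.sum_add_distrib]
  have z1 : ∑ i, ∑ j, fderiv ℝ (fun y => (hessianMat n w y).adjugate i j) x (e i) * b j x = 0 := by
    rw [Finset.sum_comm]
    refine Finset.sum_eq_zero fun j _ => ?_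
    rw [← Finset.sum_mul, hpiola j, zero_mul]
  have z2 : ∑ i, ∑ j, W i j * (fderiv ℝ w x (e i) * fderiv ℝ u x (e j)) =
      ∑ i, ∑ j, W i j * (fderiv ℝ u x (e i) * fderiv ℝ w x (e j)) := by
    rw [Finset.sum_comm]
    refine Finset.sum_congr rfl fun i _ => Finset.sum_congr rfl fun j _ => ?_
    rw [hWs j i]; ring
  have z3 : ∑ i, ∑ j, W i j * fderiv ℝ (b j) x (e i) =
      g (-w x) * (∑ i, ∑ j, W i j * hessianMat n u x j i)
      - ψ (-w x) * (∑ i, ∑ j, W i j * (fderiv ℝ w x (e i) * fderiv ℝ u x (e j)))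
      + u x * ψ (-w x) * (∑ i, ∑ j, W i j * hessianMat n w x j i)
      + ψ (-w x) * (∑ i, ∑ j, W i j * (fderiv ℝ u x (e i) * fderiv ℝ w x (e j)))
      - u x * deriv ψ (-w x) * (∑ i, ∑ j, fderiv ℝ w x (e i) * (W i j * fderiv ℝ w x (e j))) := by
    simp only [Finset.mul_sum, ← Finset.sum_add_distrib, ← Finset.sum_sub_distrib]
    refine Finset.sum_congr rfl fun i _ => Finset.sum_congr rfl fun j _ => ?_
    rw [hbv i j]; ring
  rw [z1, z3, z2]
  simp only [Matrix.trace, Matrix.diag_apply, Matrix.mul_apply, he]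
  ring

/-- Pointwise lower bound for the divergence. -/
theorem ra_pointwise {n : ℕ} (hn : 2 ≤ n) {H U : Matrix (Fin n) (Fin n) ℝ} (hH : H.PosSemidef)
    (hU : U.PosSemidef) {lam wx ux gx ψx dψ ε : ℝ} (hlam : 0 < lam) (hwx : wx < 0) (hux : ux ≤ 0)
    (hdet : H.det = lam ^ n * |wx| ^ n) (hg : 0 ≤ gx) (hg' : -wx - 2 * ε ≤ gx) (hψ : ψx ≤ 1)
    (hdψ : 0 ≤ dψ) (p : Fin n → ℝ) :
    n * lam ^ (n - 1) * (U.det ^ ((1:ℝ)/n) * |wx| ^ n - 2 * ε * (U.det ^ ((1:ℝ)/n) * |wx| ^ (n-1)))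
      - n * lam ^ n * (|ux| * |wx| ^ n) ≤
    gx * (H.adjugate * U).trace + ux * ψx * (H.adjugate * H).trace
      - ux * dψ * ∑ i, ∑ j, p i * (H.adjugate i j * p j) := by
  have hn0 : n ≠ 0 := by omega
  have hw0 : 0 < |wx| := abs_pos.2 hwx.ne
  have hdp : 0 < H.det := by rw [hdet]; positivity
  have hA := ra_adj_psd hH hdp
  have hQ : 0 ≤ ∑ i, ∑ j, p i * (H.adjugate i j * p j) := by
    have := hA.dotProduct_mulVec_nonneg p
    simpa [dotProduct, Matrix.mulVec, Finset.mul_sum] using this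
  have hUd : 0 ≤ U.det := hU.det_nonneg
  have htr := ra_trace_det (by omega) hA hU
  have hroot : (H.adjugate.det * U.det) ^ ((1:ℝ)/n) =
      lam ^ (n-1) * |wx| ^ (n-1) * U.det ^ ((1:ℝ)/n) := by
    rw [Matrix.det_adjugate, Fintype.card_fin, hdet, Real.mul_rpow (by positivity) hUd]
    congr 1
    rw [← mul_pow, ← pow_mul, mul_comm n, pow_mul, one_div, Real.pow_rpow_inv_natCast (by positivity) hn0,
      mul_pow]
  rw [hroot] at htr
  have htrH : (H.adjugate * H).trace = n * lam ^ n * |wx| ^ n := by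
    rw [Matrix.adjugate_mul, Matrix.trace_smul, Matrix.trace_one, Fintype.card_fin, hdet, smul_eq_mul]
    ring
  set D := U.det ^ ((1:ℝ)/n) with hD
  have hD0 : 0 ≤ D := Real.rpow_nonneg hUd _
  have h1 : gx * (n * (lam ^ (n-1) * |wx| ^ (n-1) * D)) ≤ gx * (H.adjugate * U).trace :=
    mul_le_mul_of_nonneg_left htr hg
  have h2 : (-wx - 2 * ε) * (n * (lam ^ (n-1) * |wx| ^ (n-1) * D)) ≤
      gx * (n * (lam ^ (n-1) * |wx| ^ (n-1) * D)) :=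
    mul_le_mul_of_nonneg_right hg' (by positivity)
  have h3 : 0 ≤ -ux * dψ * ∑ i, ∑ j, p i * (H.adjugate i j * p j) := by
    have : 0 ≤ -ux := by linarith
    positivity
  have h4 : ux * (n * lam ^ n * |wx| ^ n) ≤ ux * ψx * (n * lam ^ n * |wx| ^ n) := by
    apply mul_le_mul_of_nonneg_right _ (by positivity)
    nlinarith
  rw [htrH]
  have hwn : |wx| ^ n = |wx| ^ (n-1) * (-wx) := by
    rw [← abs_of_neg hwx, ← pow_succ]; congr 1; omega
  have hu' : |ux| = -ux := abs_of_nonpos hux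
  have e1 : n * lam ^ (n - 1) * (D * |wx| ^ n - 2 * ε * (D * |wx| ^ (n-1))) =
    (-wx - 2 * ε) * (n * (lam ^ (n-1) * |wx| ^ (n-1) * D)) := by rw [hwn]; ring
  rw [e1, hu']
  linarith

open MeasureTheory in
/-- **Reverse Aleksandrov estimate** (Statement 3). Let `Ω ⊂ ℝⁿ` be a bounded open convex
domain, `λ > 0`, and let `w` be a Monge–Ampère eigenfunction: continuous on `closure Ω`,
convex, `C^∞`, negative and strictly convex in `Ω`, vanishing on `∂Ω`, with
`det D²w = λⁿ|w|ⁿ` in `Ω`. If `u` is continuous on `closure Ω`, `C⁵` and strictly convex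
in `Ω`, vanishes on `∂Ω`, and `∫_Ω (det D²u)^{1/n}|w|^{n−1} < ∞`, then
`λ·∫_Ω |u||w|ⁿ ≥ ∫_Ω (det D²u)^{1/n}|w|ⁿ`. -/
theorem reverse_aleksandrov (n : ℕ) (hn : 2 ≤ n)
    (Ω : Set (EuclideanSpace ℝ (Fin n)))
    (hΩo : IsOpen Ω) (hΩb : Bornology.IsBounded Ω) (hΩc : Convex ℝ Ω) (hΩne : Ω.Nonempty)
    (lam : ℝ) (hlam : 0 < lam)
    (w : EuclideanSpace ℝ (Fin n) → ℝ)
    (hwcont : ContinuousOn w (closure Ω))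
    (hwconv : ConvexOn ℝ (closure Ω) w)
    (hwsmooth : ContDiffOn ℝ (⊤ : ℕ∞) w Ω)
    (hwbd : ∀ x ∈ frontier Ω, w x = 0)
    (hwneg : ∀ x ∈ Ω, w x < 0)
    (hwstrict : StrictConvexOn ℝ Ω w)
    (hwMA : ∀ x ∈ Ω, (hessianMat n w x).det = lam ^ n * |w x| ^ n)
    (u : EuclideanSpace ℝ (Fin n) → ℝ)
    (hucont : ContinuousOn u (closure Ω))
    (husmooth : ContDiffOn ℝ 5 u Ω)
    (hustrict : StrictConvexOn ℝ Ω u)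
    (hubd : ∀ x ∈ frontier Ω, u x = 0)
    (hint : MeasureTheory.IntegrableOn
      (fun x => ((hessianMat n u x).det) ^ ((1 : ℝ) / n) * |w x| ^ (n - 1)) Ω) :
    ∫ x in Ω, ((hessianMat n u x).det) ^ ((1 : ℝ) / n) * |w x| ^ n
      ≤ lam * ∫ x in Ω, |u x| * |w x| ^ n := by
  have : Nontrivial (EuclideanSpace ℝ (Fin n)) := by
    refine ⟨EuclideanSpace.single ⟨0, by omega⟩ (1:ℝ), 0, fun h => ?_⟩
    have := congrArg norm h
    simp at this
  have hu0 : ∀ x ∈ Ω, u x ≤ 0 := fun x hx => ra_nonpos hΩo hΩb hucont hustrict hubd hx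
  have huA : ∀ x ∈ Ω, ContDiffAt ℝ 5 u x := fun x hx => husmooth.contDiffAt (hΩo.mem_nhds hx)
  have hwA : ∀ x ∈ Ω, ContDiffAt ℝ (⊤ : ℕ∞) w x := fun x hx =>
    hwsmooth.contDiffAt (hΩo.mem_nhds hx)
  have hw3 : ∀ x ∈ Ω, ContDiffAt ℝ 3 w x := fun x hx =>
    by exact_mod_cast contDiffAt_infty.1 (hwA x hx) 3
  have hu3 : ∀ x ∈ Ω, ContDiffAt ℝ 3 u x := fun x hx => (huA x hx).of_le (by norm_num)
  have hHw : ∀ x ∈ Ω, (hessianMat n w x).PosSemidef := fun x hx =>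
    ra_hess_psd hΩo (fun y hy => ((hw3 y hy).of_le (by norm_num)).contDiffWithinAt)
      hwstrict.convexOn hx
  have hHu : ∀ x ∈ Ω, (hessianMat n u x).PosSemidef := fun x hx =>
    ra_hess_psd hΩo (fun y hy => ((hu3 y hy).of_le (by norm_num)).contDiffWithinAt)
      hustrict.convexOn hx
  have hdet0 : ∀ x ∈ Ω, (hessianMat n w x).det ≠ 0 := by
    intro x hx
    rw [hwMA x hx]
    have := abs_pos.2 (hwneg x hx).ne
    positivity
  have hmeas : MeasurableSet Ω := hΩo.measurableSet
  have hcpt : IsCompact (closure Ω) := hΩb.isCompact_closure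
  -- integrability
  have hI2 : IntegrableOn (fun x => |u x| * |w x| ^ n) Ω :=
    ((hucont.abs.mul (hwcont.abs.pow n)).integrableOn_compact hcpt).mono_set subset_closure
  obtain ⟨C, hC⟩ := hcpt.exists_bound_of_continuousOn hwcont
  have hI1 : IntegrableOn
      (fun x => ((hessianMat n u x).det) ^ ((1 : ℝ) / n) * |w x| ^ n) Ω := by
    have h := Integrable.bdd_mul (c := C) hint (f := fun x => |w x|)
      ((hwcont.mono subset_closure).abs.aestronglyMeasurable hmeas)
      ((ae_restrict_mem hmeas).mono fun x hx => by
        simpa using hC x (subset_closure hx))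
    refine h.congr (Filter.Eventually.of_forall fun x => ?_)
    have : |w x| ^ n = |w x| ^ (n-1) * |w x| := by
      rw [← pow_succ]; congr 1; omega
    simp only [this]; ring
  set I1 := ∫ x in Ω, ((hessianMat n u x).det) ^ ((1 : ℝ) / n) * |w x| ^ n with hI1d
  set J := ∫ x in Ω, ((hessianMat n u x).det) ^ ((1 : ℝ) / n) * |w x| ^ (n - 1) with hJd
  set I2 := ∫ x in Ω, |u x| * |w x| ^ n with hI2d
  have main : ∀ ε : ℝ, 0 < ε → I1 - 2 * ε * J ≤ lam * I2 := by
    intro ε hε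
    obtain ⟨g, ψ, hgc, hψc, hgd, hψm, hψ1, hgz, hψz, hgn, hgl⟩ := ra_cutoff hε
    set F : Fin n → EuclideanSpace ℝ (Fin n) → ℝ := fun i y =>
      ∑ j, (hessianMat n w y).adjugate i j *
        (g (-w y) * fderiv ℝ u y (EuclideanSpace.single j 1)
          + u y * ψ (-w y) * fderiv ℝ w y (EuclideanSpace.single j 1)) with hF
    set V : Fin n → EuclideanSpace ℝ (Fin n) → ℝ := fun i => Ω.indicator (F i) with hV
    set K : Set (EuclideanSpace ℝ (Fin n)) := closure Ω ∩ w ⁻¹' Set.Iic (-ε) with hK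
    have hKc : IsCompact K := hcpt.of_isClosed_subset
      (hwcont.preimage_isClosed_of_isClosed isClosed_closure isClosed_Iic) Set.inter_subset_left
    have hKΩ : K ⊆ Ω := by
      rintro x ⟨hx, hwx⟩
      by_contra hxn
      have := hwbd x (by rw [hΩo.frontier_eq]; exact ⟨hx, hxn⟩)
      simp only [Set.mem_preimage, Set.mem_Iic, this] at hwx
      linarith
    have hV0 : ∀ i x, x ∉ K → V i x = 0 := by
      intro i x hx
      by_cases hxΩ : x ∈ Ω
      · have h1 : -w x ≤ ε := by
          by_contra h
          exact hx ⟨subset_closure hxΩ, by simp only [Set.mem_preimage, Set.mem_Iic]; linarith⟩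
        simp [hV, hF, hxΩ, hgz _ h1, hψz _ h1]
      · simp [hV, hxΩ]
    have hVF : ∀ i, ∀ x ∈ Ω, V i =ᶠ[nhds x] F i := fun i x hx => by
      filter_upwards [hΩo.mem_nhds hx] with y hy
      simp [hV, hy]
    have hFc : ∀ i, ∀ x ∈ Ω, ContDiffAt ℝ 1 (F i) x := by
      intro i x hx
      have hM : ∀ i j, ContDiffAt ℝ 1 (fun y => hessianMat n w y i j) x := fun i j =>
        ra_pd_contDiffAt (m := 1) (k := 2)
          (ra_pd_contDiffAt (m := 2) (k := 3) (hw3 x hx) (by norm_num) _) (by norm_num) _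
      have hw1 : ContDiffAt ℝ 1 w x := (hw3 x hx).of_le (by norm_num)
      have hu1 : ContDiffAt ℝ 1 u x := (hu3 x hx).of_le (by norm_num)
      refine ContDiffAt.sum fun j _ => (ra_adj_contDiffAt (k := 1) _ x hM i j).mul ?_
      refine ContDiffAt.add (ContDiffAt.mul ?_ ?_) (ContDiffAt.mul (ContDiffAt.mul hu1 ?_) ?_)
      · exact hgc.contDiffAt.comp x hw1.neg
      · exact ra_pd_contDiffAt (m := 1) (k := 3) (hu3 x hx) (by norm_num) _
      · exact hψc.contDiffAt.comp x hw1.neg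
      · exact ra_pd_contDiffAt (m := 1) (k := 3) (hw3 x hx) (by norm_num) _
    have hVc : ∀ i, ContDiff ℝ 1 (V i) := by
      intro i
      rw [contDiff_iff_contDiffAt]
      intro x
      by_cases hx : x ∈ Ω
      · exact (hFc i x hx).congr_of_eventuallyEq (hVF i x hx)
      · have hxK : x ∉ K := fun h => hx (hKΩ h)
        refine (contDiffAt_const (c := (0:ℝ))).congr_of_eventuallyEq ?_
        filter_upwards [hKc.isClosed.isOpen_compl.mem_nhds hxK] with y hy
        exact hV0 i y hy
    have hVs : ∀ i, HasCompactSupport (V i) := fun i =>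
      HasCompactSupport.intro hKc fun x hx => hV0 i x hx
    have hVi := fun i => ra_integral_fderiv (hVc i) (hVs i) (EuclideanSpace.single i 1)
    set G : EuclideanSpace ℝ (Fin n) → ℝ := fun x =>
      ∑ i, fderiv ℝ (V i) x (EuclideanSpace.single i 1) with hG
    have hGi : Integrable G := integrable_finsetSum _ fun i _ => (hVi i).1
    have hG0 : ∫ x, G x = 0 := by
      rw [hG, integral_finsetSum _ fun i _ => (hVi i).1]
      exact Finset.sum_eq_zero fun i _ => (hVi i).2
    have hGΩ : ∫ x in Ω, G x = 0 := by
      rw [setIntegral_eq_integral_of_forall_compl_eq_zero, hG0]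
      intro x hx
      have hxK : x ∉ K := fun h => hx (hKΩ h)
      refine Finset.sum_eq_zero fun i _ => ?_
      have : V i =ᶠ[nhds x] fun _ => (0:ℝ) := by
        filter_upwards [hKc.isClosed.isOpen_compl.mem_nhds hxK] with y hy
        exact hV0 i y hy
      rw [this.fderiv_eq]; simp
    have hle : ∀ x ∈ Ω, n * lam ^ (n - 1) *
        (((hessianMat n u x).det) ^ ((1:ℝ)/n) * |w x| ^ n
          - 2 * ε * (((hessianMat n u x).det) ^ ((1:ℝ)/n) * |w x| ^ (n-1)))
        - n * lam ^ n * (|u x| * |w x| ^ n) ≤ G x := by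
      intro x hx
      have e1 : G x = ∑ i, fderiv ℝ (F i) x (EuclideanSpace.single i 1) :=
        Finset.sum_congr rfl fun i _ => by rw [(hVF i x hx).fderiv_eq]
      rw [e1, hF, ra_div (hu3 x hx) (hw3 x hx) (hdet0 x hx) hgd hψc]
      exact ra_pointwise hn (hHw x hx) (hHu x hx) hlam (hwneg x hx) (hu0 x hx) (hwMA x hx)
        (hgn _) (hgl _) (hψ1 _) hψm.deriv_nonneg
        (fun i => fderiv ℝ w x (EuclideanSpace.single i 1))
    have hiA : Integrable (fun x => n * lam ^ (n - 1) *
        (((hessianMat n u x).det) ^ ((1:ℝ)/n) * |w x| ^ n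
          - 2 * ε * (((hessianMat n u x).det) ^ ((1:ℝ)/n) * |w x| ^ (n-1))))
        (volume.restrict Ω) := (hI1.sub (hint.const_mul (2 * ε))).const_mul (n * lam ^ (n - 1))
    have hiB := hI2.const_mul (n * lam ^ n)
    have hmono := setIntegral_mono_on (hiA.sub hiB) hGi.integrableOn hmeas hle
    rw [hGΩ] at hmono
    have e2 : ∫ x in Ω, (n * lam ^ (n - 1) *
        (((hessianMat n u x).det) ^ ((1:ℝ)/n) * |w x| ^ n
          - 2 * ε * (((hessianMat n u x).det) ^ ((1:ℝ)/n) * |w x| ^ (n-1)))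
        - n * lam ^ n * (|u x| * |w x| ^ n)) =
        n * lam ^ (n - 1) * (I1 - 2 * ε * J) - n * lam ^ n * I2 := by
      rw [integral_sub hiA hiB, integral_const_mul, integral_const_mul,
        integral_sub hI1 (hint.const_mul (2 * ε)), integral_const_mul]
    have hmono' : n * lam ^ (n - 1) * (I1 - 2 * ε * J) - n * lam ^ n * I2 ≤ 0 := by
      rw [← e2]; exact hmono
    have hln : lam ^ n = lam ^ (n - 1) * lam := by
      rw [← pow_succ]; congr 1; omega
    have hpos : 0 < (n:ℝ) * lam ^ (n - 1) := by
      have : (0:ℝ) < n := by exact_mod_cast (by omega : 0 < n)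
      positivity
    rw [hln] at hmono'
    have : (n * lam ^ (n-1)) * (I1 - 2 * ε * J) ≤ (n * lam ^ (n-1)) * (lam * I2) := by linarith
    exact le_of_mul_le_mul_left this hpos
  have ht : Filter.Tendsto (fun ε : ℝ => I1 - 2 * ε * J) (nhdsWithin 0 (Set.Ioi 0)) (nhds I1) := by
    have : Continuous fun ε : ℝ => I1 - 2 * ε * J := by fun_prop
    have h := (this.tendsto 0).mono_left (nhdsWithin_le_nhds (s := Set.Ioi (0:ℝ)))
    simpa using h
  exact le_of_tendsto ht (eventually_mem_nhdsWithin.mono fun ε hε => main ε hε)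
end

section
/- Let n ≥ 2, 1 ≤ k ≤ n, and let B be a real symmetric n×n matrix with λ(B) ∈ Γ_k. Then S_k(B)^{1/k} = inf { trace(A·B) : A a real symmetric positive definite n×n matrix with λ(A) ∈ Γ_k^* and ρ_k^*(λ(A)) ≥ (1/n)·C(n,k)^{1/k} }, and the infimum is attained. -/
open Polynomial in
lemma splits_derivative_real_s4 {p : ℝ[X]} (hp : p.Splits) : (derivative p).Splits := by
  rw [splits_iff_card_roots] at hp ⊢
  have h1 := card_roots_le_derivative p
  have h2 := card_roots' (derivative p)
  have h3 := natDegree_derivative_le p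
  rcases Nat.eq_zero_or_pos p.natDegree with h0 | h0
  · omega
  · omega

open Polynomial in
lemma splits_iterate_derivative_real {p : ℝ[X]} (hp : p.Splits) (m : ℕ) :
    (derivative^[m] p).Splits := by
  induction m with
  | zero => simpa using hp
  | succ m ih => rw [Function.iterate_succ_apply']; exact splits_derivative_real_s4 ih

open Polynomial in
lemma laguerre_multiset (x : ℝ) (s : Multiset ℝ) :
    (s.map (fun a => X - C a)).prod.eval x * (derivative (derivative (s.map (fun a => X - C a)).prod)).eval x
      ≤ ((derivative (s.map (fun a => X - C a)).prod).eval x) ^ 2 := by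
  induction s using Multiset.induction_on with
  | empty => simp
  | cons a s ih =>
    rw [Multiset.map_cons, Multiset.prod_cons]
    set g := (s.map (fun a => X - C a)).prod
    simp only [derivative_mul, derivative_sub, derivative_X, derivative_C, eval_mul, eval_sub,
      eval_X, eval_C, eval_add, derivative_add, sub_zero, one_mul]
    nlinarith [sq_nonneg (g.eval x), mul_le_mul_of_nonneg_left ih (sq_nonneg (x - a))]

open Polynomial in
lemma laguerre {p : ℝ[X]} (hp : p.Splits) (x : ℝ) :
    p.eval x * (derivative (derivative p)).eval x ≤ ((derivative p).eval x) ^ 2 := by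
  rw [hp.eq_prod_roots]
  simp only [derivative_mul, derivative_C, zero_mul, zero_add, eval_mul, eval_C]
  have := laguerre_multiset x p.roots
  nlinarith [mul_le_mul_of_nonneg_left this (sq_nonneg p.leadingCoeff)]

open Polynomial in
lemma newton_coeff {p : ℝ[X]} (hp : p.Splits) (m : ℕ) :
    p.coeff m * p.coeff (m + 2) ≤ p.coeff (m + 1) ^ 2 := by
  have h := laguerre (splits_iterate_derivative_real hp m) 0
  rw [← Function.iterate_succ_apply' derivative, ← Function.iterate_succ_apply' derivative] at h
  simp only [← coeff_zero_eq_eval_zero, coeff_iterate_derivative, zero_add, nsmul_eq_mul,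
    Nat.descFactorial_self] at h
  rw [Nat.factorial_succ (m+1), Nat.factorial_succ m] at h
  push_cast at h
  have hm : (0:ℝ) < (m.factorial : ℝ) := by exact_mod_cast Nat.factorial_pos m
  have h2 : ((m:ℝ) + 2) * (p.coeff m * p.coeff (m + 2)) ≤ (m + 1) * p.coeff (m + 1) ^ 2 := by
    have hc : 0 < (m.factorial : ℝ)^2 * ((m:ℝ)+1) := by positivity
    refine le_of_mul_le_mul_left ?_ hc
    nlinarith [h]
  by_contra hcon
  push Not at hcon
  have : (0:ℝ) ≤ m := Nat.cast_nonneg m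
  nlinarith [sq_nonneg (p.coeff (m+1))]

/-- elementary symmetric function over a finset -/
noncomputable def ES {ι : Type*} (S : Finset ι) (j : ℕ) (x : ι → ℝ) : ℝ :=
  ∑ s ∈ Finset.powersetCard j S, ∏ i ∈ s, x i

section
set_option linter.unusedSectionVars false
variable {ι : Type*} [DecidableEq ι]

lemma ES_zero (S : Finset ι) (x : ι → ℝ) : ES S 0 x = 1 := by simp [ES]

lemma ES_gt (S : Finset ι) (x : ι → ℝ) (j : ℕ) (h : S.card < j) : ES S j x = 0 := by
  simp [ES, Finset.powersetCard_eq_empty.2 h]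

lemma ES_insert (S : Finset ι) (x : ι → ℝ) (a : ι) (ha : a ∉ S) (j : ℕ) :
    ES (insert a S) (j + 1) x = ES S (j + 1) x + x a * ES S j x := by
  unfold ES
  rw [Finset.powersetCard_succ_insert ha, Finset.sum_union, Finset.sum_image, Finset.mul_sum]
  · congr 1
    refine Finset.sum_congr rfl fun s hs => ?_
    rw [Finset.prod_insert]
    exact fun h => ha ((Finset.mem_powersetCard.1 hs).1 h)
  · intro s hs t ht hst
    have hs' : a ∉ s := fun h => ha ((Finset.mem_powersetCard.1 hs).1 h)
    have ht' : a ∉ t := fun h => ha ((Finset.mem_powersetCard.1 ht).1 h)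
    rw [← Finset.erase_insert hs', ← Finset.erase_insert ht']
    exact congrArg (fun u => Finset.erase u a) hst
  · rw [Finset.disjoint_left]
    intro s hs hs2
    obtain ⟨t, ht, rfl⟩ := Finset.mem_image.1 hs2
    exact ha ((Finset.mem_powersetCard.1 hs).1 (Finset.mem_insert_self a t))

lemma ES_erase (S : Finset ι) (x : ι → ℝ) (a : ι) (ha : a ∈ S) (j : ℕ) :
    ES S (j + 1) x = ES (S.erase a) (j + 1) x + x a * ES (S.erase a) j x := by
  conv_lhs => rw [← Finset.insert_erase ha]
  exact ES_insert _ _ _ (Finset.notMem_erase a S) j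

/-- Euler-type identity, with a general direction (polarised via induction). -/
lemma ES_euler (S : Finset ι) (x : ι → ℝ) : ∀ j : ℕ,
    ∑ i ∈ S, x i * ES (S.erase i) j x = (j + 1) * ES S (j + 1) x := by
  induction S using Finset.induction_on with
  | empty => intro j; simp [ES_gt (∅ : Finset ι) x (j+1) (by simp)]
  | insert a S ha ih =>
    intro j
    rw [Finset.sum_insert ha, Finset.erase_insert ha]
    have hE : ∀ i ∈ S, (insert a S).erase i = insert a (S.erase i) := by
      intro i hi
      rw [Finset.erase_insert_of_ne]
      rintro rfl; exact ha hi
    have hn : ∀ i ∈ S, a ∉ S.erase i := fun i _ h => ha (Finset.mem_of_mem_erase h)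
    cases j with
    | zero =>
      have := ih 0
      simp only [ES_zero, mul_one] at this ⊢
      rw [ES_insert _ _ _ ha, this, ES_zero]; push_cast; ring
    | succ j =>
      have : ∑ i ∈ S, x i * ES ((insert a S).erase i) (j+1) x
        = ∑ i ∈ S, x i * ES (S.erase i) (j+1) x + x a * ∑ i ∈ S, x i * ES (S.erase i) j x := by
        rw [Finset.mul_sum, ← Finset.sum_add_distrib]
        refine Finset.sum_congr rfl fun i hi => ?_
        rw [hE i hi, ES_insert _ _ _ (hn i hi)]; ring
      rw [this, ih, ih, ES_insert _ _ _ ha]; push_cast; ring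

lemma ES_hasDerivAt (S : Finset ι) (x v : ι → ℝ) : ∀ j : ℕ,
    HasDerivAt (fun t : ℝ => ES S (j + 1) (fun i => x i + t * v i))
      (∑ i ∈ S, v i * ES (S.erase i) j x) 0 := by
  induction S using Finset.induction_on with
  | empty =>
    intro j
    simp only [ES_gt (∅ : Finset ι) _ (j+1) (by simp), Finset.sum_empty]
    exact hasDerivAt_const _ _
  | insert a S ha ih =>
    intro j
    rw [Finset.sum_insert ha, Finset.erase_insert ha]
    have hE : ∀ i ∈ S, (insert a S).erase i = insert a (S.erase i) := by
      intro i hi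
      rw [Finset.erase_insert_of_ne]
      rintro rfl; exact ha hi
    have hn : ∀ i ∈ S, a ∉ S.erase i := fun i _ h => ha (Finset.mem_of_mem_erase h)
    simp only [ES_insert _ _ _ ha]
    have hl : HasDerivAt (fun t : ℝ => x a + t * v a) (v a) 0 := by
      simpa using ((hasDerivAt_id (0:ℝ)).mul_const (v a)).const_add (x a)
    cases j with
    | zero =>
      have := ih 0
      simp only [ES_zero, mul_one] at this ⊢
      exact (this.add hl).congr_deriv (add_comm _ _)
    | succ j =>
      have h2 := (ih (j+1)).add (hl.mul (ih j))
      have e : ∑ i ∈ S, v i * ES ((insert a S).erase i) (j+1) x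
        = ∑ i ∈ S, v i * ES (S.erase i) (j+1) x + x a * ∑ i ∈ S, v i * ES (S.erase i) j x := by
        rw [Finset.mul_sum, ← Finset.sum_add_distrib]
        refine Finset.sum_congr rfl fun i hi => ?_
        rw [hE i hi, ES_insert _ _ _ (hn i hi)]; ring
      rw [e]
      exact h2.congr_deriv (by simp; ring)

open Polynomial in
lemma ES_newton (S : Finset ι) (x : ι → ℝ) (j : ℕ) :
    ES S j x * ES S (j + 2) x ≤ ES S (j + 1) x ^ 2 := by
  rcases lt_or_ge S.card (j + 2) with h | h
  · rw [ES_gt S x _ h, mul_zero]; positivity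
  · obtain ⟨m, hm⟩ := Nat.exists_eq_add_of_le h
    have hs : (∏ i ∈ S, (X + C (x i)) : ℝ[X]).Splits := by
      apply Splits.prod
      intro i _
      exact Splits.X_add_C _
    have hc := newton_coeff hs m
    rw [Finset.prod_X_add_C_coeff _ _ (by omega), Finset.prod_X_add_C_coeff _ _ (by omega),
      Finset.prod_X_add_C_coeff _ _ (by omega)] at hc
    rw [show S.card - m = j + 2 by omega, show S.card - (m+2) = j by omega,
      show S.card - (m+1) = j+1 by omega] at hc
    unfold ES
    rw [mul_comm]; exact hc

/-- Removing a variable from `Γ_{k+1}` lands in `Γ_k`. -/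
lemma ES_remove (S : Finset ι) (x : ι → ℝ) (a : ι) (ha : a ∈ S) : ∀ k : ℕ,
    (∀ j ≤ k + 1, 0 < ES S j x) → ∀ j ≤ k, 0 < ES (S.erase a) j x := by
  intro k
  induction k with
  | zero =>
    intro _ j hj
    obtain rfl : j = 0 := by omega
    rw [ES_zero]; exact one_pos
  | succ k ih =>
    intro h j hj
    have ih' := ih (fun j hj => h j (by omega))
    rcases Nat.lt_or_ge j (k+1) with hj2 | hj2
    · exact ih' j (by omega)
    · obtain rfl : j = k + 1 := by omega
      by_contra hneg
      push Not at hneg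
      have h0 := ih' k le_rfl
      have h1 := h (k+1) (by omega)
      have h2 := h (k+2) (by omega)
      rw [ES_erase S x a ha] at h1 h2
      have hN := ES_newton (S.erase a) x k
      set A := ES (S.erase a) k x
      set B := ES (S.erase a) (k+1) x
      set D := ES (S.erase a) (k+2) x
      nlinarith [mul_pos h0 h2, mul_nonneg h1.le (neg_nonneg.2 hneg)]

lemma ES_smul (S : Finset ι) (x : ι → ℝ) (c : ℝ) (j : ℕ) :
    ES S j (fun i => c * x i) = c ^ j * ES S j x := by
  unfold ES
  rw [Finset.mul_sum]
  refine Finset.sum_congr rfl fun s hs => ?_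
  rw [Finset.prod_mul_distrib, Finset.prod_const, (Finset.mem_powersetCard.1 hs).2]

lemma q_formula (S : Finset ι) (x : ι → ℝ) (k : ℕ) (h1 : 0 < ES S (k + 1) x)
    (h2 : ∀ i ∈ S, 0 < ES (S.erase i) k x) :
    ((k : ℝ) + 2) * (ES S (k + 2) x / ES S (k + 1) x) =
      ∑ i ∈ S, (x i - x i ^ 2 / (x i + ES (S.erase i) (k + 1) x / ES (S.erase i) k x)) := by
  have he := ES_euler S x (k + 1)
  push_cast at he
  rw [mul_div_assoc', show ((k : ℝ) + 2) * ES S (k + 2) x = (k + 1 + 1) * ES S (k + 1 + 1) x by ring,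
    ← he, Finset.sum_div]
  refine Finset.sum_congr rfl fun i hi => ?_
  have h3 := h2 i hi
  have h4 := ES_erase S x i hi k
  have h5 : x i + ES (S.erase i) (k + 1) x / ES (S.erase i) k x
      = ES S (k + 1) x / ES (S.erase i) k x := by
    rw [h4]; field_simp; ring
  rw [h5]
  field_simp
  rw [h4]; ring

lemma sq_div_superadd (l m a b c : ℝ) (h1 : 0 < l + a) (h2 : 0 < m + b) (h3 : a + b ≤ c) :
    (l + m) ^ 2 / (l + m + c) ≤ l ^ 2 / (l + a) + m ^ 2 / (m + b) := by
  have h4 : (l + m) ^ 2 / (l + m + c) ≤ (l + m) ^ 2 / ((l + a) + (m + b)) := by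
    apply div_le_div_of_nonneg_left (sq_nonneg _) (by linarith) (by linarith)
  refine h4.trans ?_
  rw [div_add_div _ _ h1.ne' h2.ne', div_le_div_iff₀ (by linarith) (by positivity)]
  nlinarith [mul_nonneg (sq_nonneg (l * (m + b) - m * (l + a))) (add_pos h1 h2).le,
    sq_nonneg (l * (m + b) - m * (l + a))]

lemma q_superadd (k : ℕ) : ∀ (S : Finset ι) (x y : ι → ℝ), (∀ j ≤ k + 1, 0 < ES S j x) →
    (∀ j ≤ k + 1, 0 < ES S j y) →
    (∀ j ≤ k + 1, 0 < ES S j (fun i => x i + y i)) ∧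
    ES S (k + 1) x / ES S k x + ES S (k + 1) y / ES S k y ≤
      ES S (k + 1) (fun i => x i + y i) / ES S k (fun i => x i + y i) := by
  induction k with
  | zero =>
    intro S x y hx hy
    have h1 : ∀ z : ι → ℝ, ES S 1 z = ∑ i ∈ S, z i := by
      intro z
      have := ES_euler S z 0
      simp only [ES_zero, mul_one] at this
      rw [this]; simp
    have hx1 := hx 1 (by omega)
    have hy1 := hy 1 (by omega)
    simp only [zero_add, ES_zero, div_one, h1, Finset.sum_add_distrib, le_refl, and_true] at hx1 hy1 ⊢
    intro j hj
    interval_cases j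
    · rw [ES_zero]; exact one_pos
    · rw [h1, Finset.sum_add_distrib]; linarith
  | succ k ih =>
    intro S x y hx hy
    obtain ⟨hz, -⟩ := ih S x y (fun j hj => hx j (by omega)) (fun j hj => hy j (by omega))
    have rx : ∀ i ∈ S, ∀ j ≤ k + 1, 0 < ES (S.erase i) j x := fun i hi => ES_remove S x i hi (k+1) hx
    have ry : ∀ i ∈ S, ∀ j ≤ k + 1, 0 < ES (S.erase i) j y := fun i hi => ES_remove S y i hi (k+1) hy
    have rz : ∀ i ∈ S, ∀ j ≤ k, 0 < ES (S.erase i) j (fun i => x i + y i) :=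
      fun i hi => ES_remove S _ i hi k hz
    have fx := q_formula S x k (hx _ (by omega)) (fun i hi => rx i hi k (by omega))
    have fy := q_formula S y k (hy _ (by omega)) (fun i hi => ry i hi k (by omega))
    have fz := q_formula S _ k (hz _ (by omega)) (fun i hi => rz i hi k (by omega))
    have key : ES S (k + 2) x / ES S (k + 1) x + ES S (k + 2) y / ES S (k + 1) y ≤
      ES S (k + 2) (fun i => x i + y i) / ES S (k + 1) (fun i => x i + y i) := by
      have hk : (0:ℝ) < (k:ℝ) + 2 := by positivity
      refine le_of_mul_le_mul_left ?_ hk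
      rw [mul_add, fx, fy, fz, ← Finset.sum_add_distrib]
      refine Finset.sum_le_sum fun i hi => ?_
      have hs := (ih (S.erase i) x y (rx i hi) (ry i hi)).2
      have pos : ∀ w : ι → ℝ, 0 < ES S (k+1) w → 0 < ES (S.erase i) k w →
          0 < w i + ES (S.erase i) (k + 1) w / ES (S.erase i) k w := by
        intro w h1 h2
        rw [ES_erase S w i hi] at h1
        have : w i + ES (S.erase i) (k + 1) w / ES (S.erase i) k w =
          (ES (S.erase i) (k + 1) w + w i * ES (S.erase i) k w) / ES (S.erase i) k w := by
          field_simp; ring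
        rw [this]; exact div_pos h1 h2
      have := sq_div_superadd (x i) (y i) _ _ _
        (pos x (hx _ (by omega)) (rx i hi k (by omega)))
        (pos y (hy _ (by omega)) (ry i hi k (by omega))) hs
      linarith
    refine ⟨?_, key⟩
    intro j hj
    rcases Nat.lt_or_ge j (k+2) with hj2 | hj2
    · exact hz j (by omega)
    · obtain rfl : j = k + 2 := by omega
      have h1 := div_pos (hx (k+2) (by omega)) (hx (k+1) (by omega))
      have h2 := div_pos (hy (k+2) (by omega)) (hy (k+1) (by omega))
      have h3 : 0 < ES S (k + 2) (fun i => x i + y i) / ES S (k + 1) (fun i => x i + y i) := by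
        linarith
      exact (div_pos_iff_of_pos_right (hz (k+1) le_rfl)).1 h3

lemma ES_logconcave (S : Finset ι) (x y : ι → ℝ) (s t : ℝ) (hs : 0 < s) (ht : 0 < t)
    (hst : s + t = 1) (k : ℕ) (hx : ∀ j ≤ k, 0 < ES S j x) (hy : ∀ j ≤ k, 0 < ES S j y) :
    (∀ j ≤ k, 0 < ES S j (fun i => s * x i + t * y i)) ∧
    ES S k x ^ s * ES S k y ^ t ≤ ES S k (fun i => s * x i + t * y i) := by
  induction k with
  | zero =>
    refine ⟨fun j hj => ?_, ?_⟩
    · obtain rfl : j = 0 := by omega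
      rw [ES_zero]; exact one_pos
    · simp [ES_zero]
  | succ k ih =>
    obtain ⟨-, ih2⟩ := ih (fun j hj => hx j (by omega)) (fun j hj => hy j (by omega))
    have sx : ∀ j ≤ k+1, 0 < ES S j (fun i => s * x i) := fun j hj => by
      rw [ES_smul]; exact mul_pos (pow_pos hs _) (hx j hj)
    have sy : ∀ j ≤ k+1, 0 < ES S j (fun i => t * y i) := fun j hj => by
      rw [ES_smul]; exact mul_pos (pow_pos ht _) (hy j hj)
    obtain ⟨h1, h2⟩ := q_superadd k S _ _ sx sy
    refine ⟨h1, ?_⟩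
    simp only [ES_smul] at h2
    have hxk := hx k (by omega)
    have hyk := hy k (by omega)
    have hx1 := hx (k+1) (by omega)
    have hy1 := hy (k+1) (by omega)
    have hzk := h1 k (by omega)
    have e1 : s ^ (k+1) * ES S (k+1) x / (s ^ k * ES S k x) = s * (ES S (k+1) x / ES S k x) := by
      field_simp; ring
    have e2 : t ^ (k+1) * ES S (k+1) y / (t ^ k * ES S k y) = t * (ES S (k+1) y / ES S k y) := by
      field_simp; ring
    rw [e1, e2] at h2
    have amgm := Real.geom_mean_le_arith_mean2_weighted hs.le ht.le
      (div_pos hx1 hxk).le (div_pos hy1 hyk).le hst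
    have h3 := amgm.trans h2
    rw [le_div_iff₀ hzk] at h3
    refine le_trans ?_ h3
    refine le_trans ?_ (mul_le_mul_of_nonneg_left ih2 (by positivity))
    rw [Real.div_rpow hx1.le hxk.le, Real.div_rpow hy1.le hyk.le]
    have a1 := Real.rpow_pos_of_pos hxk s
    have a2 := Real.rpow_pos_of_pos hyk t
    apply le_of_eq
    field_simp

lemma ES_convex (S : Finset ι) (k : ℕ) (c : ℝ) (hc : 0 < c) :
    Convex ℝ {x : ι → ℝ | (∀ j ≤ k, 0 < ES S j x) ∧ c ≤ ES S k x} := by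
  rw [convex_iff_forall_pos]
  rintro x ⟨hx, hcx⟩ y ⟨hy, hcy⟩ s t hs ht hst
  obtain ⟨h1, h2⟩ := ES_logconcave S x y s t hs ht hst k hx hy
  refine ⟨h1, le_trans ?_ h2⟩
  calc c = c ^ s * c ^ t := by rw [← Real.rpow_add hc, hst, Real.rpow_one]
    _ ≤ _ := mul_le_mul (Real.rpow_le_rpow hc.le hcx hs.le) (Real.rpow_le_rpow hc.le hcy ht.le)
      (by positivity) (Real.rpow_nonneg (hc.le.trans hcx) _)

lemma ES_grad (S : Finset ι) (k : ℕ) (x y : ι → ℝ) (hx : ∀ j ≤ k + 1, 0 < ES S j x)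
    (hy : ∀ j ≤ k + 1, 0 < ES S j y) (hxy : ES S (k + 1) x ≤ ES S (k + 1) y) :
    ((k : ℝ) + 1) * ES S (k + 1) x ≤ ∑ i ∈ S, y i * ES (S.erase i) k x := by
  have hd := ES_hasDerivAt S x (fun i => y i - x i) k
  have hc := ES_convex S (k + 1) _ (hx (k+1) le_rfl)
  have hnn : ∀ t ∈ Set.Ioo (0:ℝ) 1, ES S (k+1) x ≤ ES S (k+1) (fun i => x i + t * (y i - x i)) := by
    intro t ht
    have := (hc (x := x) ⟨hx, le_rfl⟩ (y := y) ⟨hy, hxy⟩ (a := 1 - t) (b := t)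
      (by linarith [ht.2]) ht.1.le (by ring)).2
    convert this using 2
    ext i; simp; ring
  have hpos : 0 ≤ ∑ i ∈ S, (y i - x i) * ES (S.erase i) k x := by
    have hw := hd.hasDerivWithinAt (s := Set.Ioi 0)
    rw [hasDerivWithinAt_iff_tendsto_slope' (by simp)] at hw
    refine ge_of_tendsto hw ?_
    filter_upwards [Ioo_mem_nhdsGT (show (0:ℝ) < 1 by norm_num)] with t ht
    rw [slope_def_field]
    apply div_nonneg _ (by linarith [ht.1])
    have := hnn t ht
    simpa using this
  have he := ES_euler S x k
  simp only [sub_mul, Finset.sum_sub_distrib] at hpos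
  linarith

end

lemma ES_perm {n : ℕ} (σ : Equiv.Perm (Fin n)) (x : Fin n → ℝ) (j : ℕ) :
    ES Finset.univ j (x ∘ σ) = ES Finset.univ j x := by
  unfold ES
  rw [← Finset.esymm_map_val, ← Finset.esymm_map_val]
  congr 1
  rw [← Multiset.map_map, Multiset.map_univ_val_equiv]

lemma exists_perm_of_map_eq {n : ℕ} (f g : Fin n → ℝ)
    (h : Multiset.map f Finset.univ.val = Multiset.map g Finset.univ.val) :
    ∃ σ : Equiv.Perm (Fin n), f = g ∘ σ := by
  rw [Fin.univ_val_map, Fin.univ_val_map, Multiset.coe_eq_coe] at h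
  have hp : (List.ofFn (f ∘ Tuple.sort f)).Perm (List.ofFn (g ∘ Tuple.sort g)) :=
    (((Tuple.sort f).ofFn_comp_perm f).trans h).trans ((Tuple.sort g).ofFn_comp_perm g).symm
  have he := List.ofFn_injective (hp.eq_of_pairwise'
    (Tuple.monotone_sort f).sortedLE_ofFn.pairwise (Tuple.monotone_sort g).sortedLE_ofFn.pairwise)
  refine ⟨(Tuple.sort f).symm.trans (Tuple.sort g), ?_⟩
  ext i
  have := congrFun he ((Tuple.sort f).symm i)
  simpa using this

lemma mem_cone_iff {n k : ℕ} (x : Fin n → ℝ) :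
    x ∈ GardingCone n k ↔ ∀ j ≤ k, 0 < ES Finset.univ j x := by
  constructor
  · intro h j hj
    rcases Nat.eq_zero_or_pos j with rfl | h0
    · rw [ES_zero]; exact one_pos
    · exact h j h0 hj
  · intro h j _ hj
    exact h j hj

lemma ds_mem {n k : ℕ} (M : Matrix (Fin n) (Fin n) ℝ) (hM : M ∈ doublyStochastic ℝ (Fin n))
    (x : Fin n → ℝ) (hx : ∀ j ≤ k, 0 < ES Finset.univ j x) :
    (∀ j ≤ k, 0 < ES Finset.univ j (M.mulVec x)) ∧
      ES Finset.univ k x ≤ ES Finset.univ k (M.mulVec x) := by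
  have hc := ES_convex (Finset.univ : Finset (Fin n)) k _ (hx k le_rfl)
  have hM' : M ∈ (doublyStochastic ℝ (Fin n) : Set (Matrix (Fin n) (Fin n) ℝ)) := hM
  rw [doublyStochastic_eq_convexHull_permMatrix] at hM'
  have hconv : Convex ℝ {N : Matrix (Fin n) (Fin n) ℝ | N.mulVec x ∈
      {x' : Fin n → ℝ | (∀ j ≤ k, 0 < ES Finset.univ j x') ∧
        ES Finset.univ k x ≤ ES Finset.univ k x'}} := by
    intro N hN P hP a b ha hb hab
    have := hc hN hP ha hb hab
    simp only [Set.mem_ofPred_eq] at this ⊢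
    rwa [Matrix.add_mulVec, Matrix.smul_mulVec, Matrix.smul_mulVec]
  refine convexHull_min ?_ hconv hM'
  rintro _ ⟨σ, rfl⟩
  simp only [Set.mem_ofPred_eq, Matrix.permMatrix_mulVec, ES_perm]
  exact ⟨hx, le_rfl⟩

open Matrix in
lemma sq_ds {n : ℕ} (W : Matrix (Fin n) (Fin n) ℝ) (h1 : W * Wᵀ = 1) (h2 : Wᵀ * W = 1) :
    (Matrix.of fun i j => W i j ^ 2) ∈ doublyStochastic ℝ (Fin n) := by
  rw [mem_doublyStochastic_iff_sum]
  refine ⟨fun i j => by simp [sq_nonneg], fun i => ?_, fun j => ?_⟩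
  · have := congrFun (congrFun h1 i) i
    simpa [Matrix.mul_apply, sq] using this
  · have := congrFun (congrFun h2 j) j
    simpa [Matrix.mul_apply, sq] using this

open Matrix in
lemma spectral_real {n : ℕ} (A : Matrix (Fin n) (Fin n) ℝ) (hA : A.IsHermitian) :
    ∃ U : Matrix (Fin n) (Fin n) ℝ, U * Uᵀ = 1 ∧ Uᵀ * U = 1 ∧
      A = U * diagonal hA.eigenvalues * Uᵀ := by
  refine ⟨hA.eigenvectorUnitary, ?_, ?_, ?_⟩
  · have := Unitary.coe_mul_star_self hA.eigenvectorUnitary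
    simpa [star_eq_conjTranspose] using this
  · have := Unitary.coe_star_mul_self hA.eigenvectorUnitary
    simpa [star_eq_conjTranspose] using this
  · have := hA.spectral_theorem
    rw [Unitary.conjStarAlgAut_apply] at this
    simpa [star_eq_conjTranspose, Function.comp_def] using this

open Matrix in
lemma trace_lower {n k : ℕ} (A B : Matrix (Fin n) (Fin n) ℝ) (hA : A.IsHermitian)
    (hB : B.IsHermitian) (hBG : ∀ j ≤ k, 0 < ES Finset.univ j hB.eigenvalues) :
    ∃ d : Fin n → ℝ, (∀ j ≤ k, 0 < ES Finset.univ j d) ∧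
      ES Finset.univ k hB.eigenvalues ≤ ES Finset.univ k d ∧
      (A * B).trace = ∑ i, hA.eigenvalues i * d i := by
  obtain ⟨U, hU1, hU2, hAU⟩ := spectral_real A hA
  obtain ⟨V, hV1, hV2, hBV⟩ := spectral_real B hB
  set a := hA.eigenvalues
  set b := hB.eigenvalues
  set W := Uᵀ * V with hW
  have hW1 : W * Wᵀ = 1 := by
    rw [hW, transpose_mul, transpose_transpose, Matrix.mul_assoc, ← Matrix.mul_assoc V, hV1,
      Matrix.one_mul, hU2]
  have hW2 : Wᵀ * W = 1 := by
    rw [hW, transpose_mul, transpose_transpose, Matrix.mul_assoc, ← Matrix.mul_assoc U, hU1,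
      Matrix.one_mul, hV2]
  obtain ⟨h1, h2⟩ := ds_mem _ (sq_ds W hW1 hW2) b hBG
  refine ⟨_, h1, h2, ?_⟩
  have e : (A * B).trace = (diagonal a * (W * diagonal b * Wᵀ)).trace := by
    rw [hAU, hBV, hW, transpose_mul, transpose_transpose]
    rw [Matrix.mul_assoc U, Matrix.mul_assoc U, Matrix.trace_mul_comm]
    simp only [Matrix.mul_assoc]
  rw [e, Matrix.trace]
  refine Finset.sum_congr rfl fun i _ => ?_
  rw [diag_apply, diagonal_mul, Matrix.mul_apply]
  congr 1
  simp only [mul_diagonal, transpose_apply, mulVec, dotProduct, of_apply]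
  exact Finset.sum_congr rfl fun j _ => by ring

open Matrix in
lemma eig_conj {n : ℕ} (U : Matrix (Fin n) (Fin n) ℝ) (h2 : Uᵀ * U = 1) (a : Fin n → ℝ)
    (hA : (U * diagonal a * Uᵀ).IsHermitian) :
    ∃ σ : Equiv.Perm (Fin n), hA.eigenvalues = a ∘ σ := by
  have h := hA.roots_charpoly_eq_eigenvalues
  rw [charpoly_mul_comm, ← Matrix.mul_assoc, h2, Matrix.one_mul, charpoly_diagonal,
    show (∏ i, (Polynomial.X - Polynomial.C (a i)) : Polynomial ℝ) =
      ((Finset.univ.val.map a).map fun r => Polynomial.X - Polynomial.C r).prod by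
        rw [Multiset.map_map]; rfl,
    Polynomial.roots_multiset_prod_X_sub_C] at h
  have h' : Multiset.map hA.eigenvalues Finset.univ.val = Multiset.map a Finset.univ.val := by
    simpa [Function.comp_def] using h.symm
  exact exists_perm_of_map_eq _ _ h'

lemma grad_scaled {n m : ℕ} (x y : Fin n → ℝ) (hx : ∀ j ≤ m + 1, 0 < ES Finset.univ j x)
    (hy : ∀ j ≤ m + 1, 0 < ES Finset.univ j y) (c : ℝ) (hc : 0 < c)
    (hcy : c ≤ ES Finset.univ (m + 1) y) :
    c ^ ((1 : ℝ) / (m + 1 : ℕ)) ≤ ∑ i, (ES Finset.univ (m + 1) x ^ ((1 : ℝ) / (m + 1 : ℕ)) /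
      (((m : ℝ) + 1) * ES Finset.univ (m + 1) x) * ES (Finset.univ.erase i) m x) * y i := by
  set F := ES Finset.univ (m + 1) x
  have hF : 0 < F := hx _ le_rfl
  set s := F ^ ((1 : ℝ) / (m + 1 : ℕ)) / c ^ ((1 : ℝ) / (m + 1 : ℕ)) with hs
  have hFp : 0 < F ^ ((1 : ℝ) / (m + 1 : ℕ)) := Real.rpow_pos_of_pos hF _
  have hcp : 0 < c ^ ((1 : ℝ) / (m + 1 : ℕ)) := Real.rpow_pos_of_pos hc _
  have hs0 : 0 < s := div_pos hFp hcp
  have hroot : ∀ z : ℝ, 0 ≤ z → (z ^ ((1 : ℝ) / (m + 1 : ℕ))) ^ (m + 1) = z := by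
    intro z hz
    rw [one_div]
    exact Real.rpow_inv_natCast_pow hz (by omega)
  have hsp : s ^ (m + 1) = F / c := by
    rw [hs, div_pow, hroot _ hF.le, hroot _ hc.le]
  have hg := ES_grad Finset.univ m x (fun i => s * y i) hx
    (fun j hj => by rw [ES_smul]; exact mul_pos (pow_pos hs0 _) (hy j hj))
    (by
      rw [ES_smul, hsp]
      change F ≤ _
      rw [div_mul_eq_mul_div, le_div_iff₀ hc]
      exact mul_le_mul_of_nonneg_left hcy hF.le)
  change ((m:ℝ) + 1) * F ≤ _ at hg
  have e : ∑ i, (F ^ ((1 : ℝ) / (m + 1 : ℕ)) / (((m : ℝ) + 1) * F) *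
      ES (Finset.univ.erase i) m x) * y i =
      (c ^ ((1 : ℝ) / (m + 1 : ℕ)) / (((m : ℝ) + 1) * F)) *
        ∑ i, s * y i * ES (Finset.univ.erase i) m x := by
    rw [Finset.mul_sum]
    refine Finset.sum_congr rfl fun i _ => ?_
    rw [hs]; field_simp
  rw [e]
  have hm : (0:ℝ) < (m:ℝ) + 1 := by positivity
  calc c ^ ((1 : ℝ) / (m + 1 : ℕ)) = (c ^ ((1 : ℝ) / (m + 1 : ℕ)) / (((m : ℝ) + 1) * F)) *
        (((m:ℝ) + 1) * F) := by field_simp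
    _ ≤ _ := mul_le_mul_of_nonneg_left hg (by positivity)

theorem Sk_eq_inf_trace (n k : ℕ) (hn : 2 ≤ n) (hk1 : 1 ≤ k) (hkn : k ≤ n)
    (B : Matrix (Fin n) (Fin n) ℝ) (hB : B.IsHermitian)
    (hBG : hB.eigenvalues ∈ GardingCone n k) :
    IsLeast {r : ℝ | ∃ (A : Matrix (Fin n) (Fin n) ℝ) (hA : A.IsHermitian),
        A.PosDef ∧ hA.eigenvalues ∈ GardingDual n k ∧
        (1 / n : ℝ) * (n.choose k : ℝ) ^ ((1 : ℝ) / k) ≤ rhoStar n k hA.eigenvalues ∧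
        r = (A * B).trace}
      (SkM k B ^ ((1 : ℝ) / k)) := by
  have hn0 : (0:ℝ) < n := by exact_mod_cast (by omega : 0 < n)
  have hC : (0:ℝ) < (n.choose k : ℝ) := by exact_mod_cast Nat.choose_pos hkn
  have hS : SkM k B = ES Finset.univ k hB.eigenvalues := by
    unfold SkM; rw [dif_pos hB]; rfl
  rw [mem_cone_iff] at hBG
  obtain ⟨m, rfl⟩ : ∃ m, k = m + 1 := ⟨k - 1, by omega⟩
  have hroot : ∀ z : ℝ, 0 ≤ z → (z ^ ((1 : ℝ) / (m + 1 : ℕ))) ^ (m + 1) = z := by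
    intro z hz
    rw [one_div]
    exact Real.rpow_inv_natCast_pow hz (by omega)
  rw [hS]
  have hF := hBG _ le_rfl
  constructor
  · obtain ⟨V, hV1, hV2, hBV⟩ := spectral_real B hB
    set b := hB.eigenvalues
    set F := ES Finset.univ (m + 1) b with hFdef
    set a : Fin n → ℝ := fun i => F ^ ((1 : ℝ) / (m + 1 : ℕ)) /
      (((m : ℝ) + 1) * F) * ES (Finset.univ.erase i) m b with ha
    have hFp : 0 < F ^ ((1 : ℝ) / (m + 1 : ℕ)) := Real.rpow_pos_of_pos hF _
    have ha0 : ∀ i, 0 < a i := fun i =>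
      mul_pos (by positivity) (ES_remove _ b i (Finset.mem_univ i) m hBG m le_rfl)
    have hA : (V * Matrix.diagonal a * V.transpose).IsHermitian := by
      rw [Matrix.IsHermitian, Matrix.conjTranspose_eq_transpose_of_trivial]
      simp [Matrix.transpose_mul, Matrix.mul_assoc]
    obtain ⟨σ, hσ⟩ := eig_conj V hV2 a hA
    have hge : ∀ mu : Fin n → ℝ, (∀ j ≤ m + 1, 0 < ES Finset.univ j mu) → ∀ c, 0 < c →
        c ≤ ES Finset.univ (m + 1) mu →
        c ^ ((1 : ℝ) / (m + 1 : ℕ)) ≤ ∑ i, hA.eigenvalues i * mu i := by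
      intro mu hmu c hc hcm
      have := grad_scaled b (mu ∘ σ.symm) hBG (fun j hj => by rw [ES_perm]; exact hmu j hj) c hc
        (by rw [ES_perm]; exact hcm)
      refine this.trans (le_of_eq ?_)
      rw [hσ, ← Equiv.sum_comp σ]
      simp [ha, F]
    refine ⟨_, hA, ?_, ?_, ?_, ?_⟩
    · rw [hA.posDef_iff_eigenvalues_pos]
      intro i; rw [hσ]; exact ha0 _
    · intro mu hmu
      rw [mem_cone_iff] at hmu
      have h1 := hmu _ le_rfl
      exact (Real.rpow_pos_of_pos h1 _).le.trans (hge mu hmu _ h1 le_rfl)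
    · unfold rhoStar
      apply le_csInf
      · have ht : 0 < (n.choose (m+1) : ℝ) / F := div_pos hC hF
        set s := ((n.choose (m+1) : ℝ) / F) ^ ((1 : ℝ) / (m + 1 : ℕ))
        have hs : 0 < s := Real.rpow_pos_of_pos ht _
        refine ⟨_, fun i => s * b i, ?_, ?_, rfl⟩
        · rw [mem_cone_iff]
          intro j hj
          rw [ES_smul]; exact mul_pos (pow_pos hs _) (hBG j hj)
        · change _ ≤ ES _ _ _
          rw [ES_smul, hroot _ ht.le]
          change _ ≤ _ * F
          rw [div_mul_cancel₀ _ hF.ne']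
      · rintro r ⟨mu, hmu, hmc, rfl⟩
        rw [mem_cone_iff] at hmu
        have := hge mu hmu _ hC hmc
        rw [one_div, ← div_eq_inv_mul]
        exact div_le_div_of_nonneg_right this hn0.le
    · have e : (V * Matrix.diagonal a * V.transpose * B).trace
          = (Matrix.diagonal a * Matrix.diagonal b).trace := by
        rw [hBV, Matrix.mul_assoc V, Matrix.mul_assoc V, Matrix.trace_mul_comm]
        simp only [Matrix.mul_assoc]
        rw [hV2, Matrix.mul_one, ← Matrix.mul_assoc V.transpose, hV2, Matrix.one_mul]
      rw [e, Matrix.diagonal_mul_diagonal, Matrix.trace_diagonal]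
      have he := ES_euler Finset.univ b m
      have : ∑ i, a i * b i = F ^ ((1 : ℝ) / (m + 1 : ℕ)) / (((m : ℝ) + 1) * F) *
          ∑ i, b i * ES (Finset.univ.erase i) m b := by
        rw [Finset.mul_sum]
        exact Finset.sum_congr rfl fun i _ => by simp only [ha]; ring
      rw [this, he]
      change _ = _ * (((m:ℝ) + 1) * F)
      have hm : (0:ℝ) < (m:ℝ) + 1 := by positivity
      field_simp
  · rintro r ⟨A, hA, hpd, hdual, hrho, rfl⟩
    obtain ⟨d, hd, hbd, htr⟩ := trace_lower A B hA hB hBG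
    rw [htr]
    have hD := hd _ le_rfl
    set D := ES Finset.univ (m + 1) d
    have ht : 0 < (n.choose (m+1) : ℝ) / D := div_pos hC hD
    set s := ((n.choose (m+1) : ℝ) / D) ^ ((1 : ℝ) / (m + 1 : ℕ)) with hs
    have hs0 : 0 < s := Real.rpow_pos_of_pos ht _
    have hle : rhoStar n (m+1) hA.eigenvalues ≤ (∑ i, hA.eigenvalues i * (s * d i)) / n := by
      apply csInf_le
      · refine ⟨0, ?_⟩
        rintro r ⟨mu, hmu, -, rfl⟩
        exact div_nonneg (hdual mu hmu) hn0.le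
      · refine ⟨fun i => s * d i, ?_, ?_, rfl⟩
        · rw [mem_cone_iff]
          intro j hj
          rw [ES_smul]; exact mul_pos (pow_pos hs0 _) (hd j hj)
        · change _ ≤ ES _ _ _
          rw [ES_smul, hroot _ ht.le]
          change _ ≤ _ * D
          rw [div_mul_cancel₀ _ hD.ne']
    have h1 := hrho.trans hle
    rw [one_div (n:ℝ), ← div_eq_inv_mul, div_le_div_iff_of_pos_right hn0] at h1
    have e : ∑ i, hA.eigenvalues i * (s * d i) = s * ∑ i, hA.eigenvalues i * d i := by
      rw [Finset.mul_sum]; exact Finset.sum_congr rfl fun i _ => by ring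
    rw [e, hs, Real.div_rpow hC.le hD.le] at h1
    have hCp := Real.rpow_pos_of_pos hC ((1 : ℝ) / (m + 1 : ℕ))
    have hDp := Real.rpow_pos_of_pos hD ((1 : ℝ) / (m + 1 : ℕ))
    rw [div_mul_eq_mul_div, le_div_iff₀ hDp, mul_le_mul_iff_right₀ hCp] at h1
    exact (Real.rpow_le_rpow hF.le hbd (by positivity)).trans h1
end
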